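/- Let K be a field and n ≥ 2, where additionally n ≥ 3 if K has exactly two elements. Then there exists a cyclic, strictly hyperbolic matrix P ∈ Sp(2n, K) such that every M ∈ Sp(2n, K) with M ≠ −I₂ₙ can be written as M = (S₁ P S₁⁻¹) · (S₂ P S₂⁻¹) for some S₁, S₂ ∈ Sp(2n, K); that is, Sp(2n, K) = Ω² ∪ {−I₂ₙ} for the Sp(2n,K)-conjugacy class Ω of P. -/

import Mathlib

open Matrix Polynomial

noncomputable section

/-- The standard symplectic form matrix `G = [[0, Iₙ], [-Iₙ, 0]]`. -/
def sympJ (n : ℕ) (K : Type*) [Field K] : Matrix (Fin n ⊕ Fin n) (Fin n ⊕ Fin n) K :=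
  Matrix.fromBlocks 0 1 (-1) 0

/-- Membership in the standard symplectic group `Sp(2n, K)`: `P G Pᵀ = G`. -/
def IsSymplectic {n : ℕ} {K : Type*} [Field K]
    (P : Matrix (Fin n ⊕ Fin n) (Fin n ⊕ Fin n) K) : Prop :=
  P * sympJ n K * Pᵀ = sympJ n K

/-- A matrix is cyclic if its characteristic polynomial equals its minimal polynomial. -/
def IsCyclicMat {ι : Type*} [Fintype ι] [DecidableEq ι] {K : Type*} [Field K]
    (A : Matrix ι ι K) : Prop :=
  A.charpoly = minpoly K A

/-- The reciprocal polynomial `q*(x) = q(0)⁻¹ xⁿ q(1/x)` of a polynomial `q`. -/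
def recipPoly {K : Type*} [Field K] (q : Polynomial K) : Polynomial K :=
  Polynomial.C (q.coeff 0)⁻¹ * q.reverse

/-- A symplectic matrix is strictly hyperbolic if its minimal polynomial is `q q*`
with `q` monic of degree `n`, `q(0) ≠ 0`, and `q` coprime to its reciprocal `q*`. -/
def IsStrictlyHyperbolic {n : ℕ} {K : Type*} [Field K]
    (P : Matrix (Fin n ⊕ Fin n) (Fin n ⊕ Fin n) K) : Prop :=
  ∃ q : Polynomial K, q.Monic ∧ q.natDegree = n ∧ q.coeff 0 ≠ 0 ∧
    IsCoprime q (recipPoly q) ∧ minpoly K P = q * recipPoly q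

universe u

set_option linter.unusedSectionVars false
set_option linter.unusedSimpArgs false



/-- `v` is a cyclic vector of `A`. -/
def Cv {ι : Type} [Fintype ι] [DecidableEq ι] {K : Type u} [Field K]
    (A : Matrix ι ι K) (v : ι → K) : Prop :=
  ∀ w, ∃ r : K[X], aeval A r *ᵥ v = w

/-- `A` is a cyclic matrix with characteristic polynomial `p`. -/
def Cyc {ι : Type} [Fintype ι] [DecidableEq ι] {K : Type u} [Field K]
    (A : Matrix ι ι K) (p : K[X]) : Prop :=
  p.Monic ∧ p.natDegree = Fintype.card ι ∧ ∃ v, aeval A p *ᵥ v = 0 ∧ Cv A v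

section cyc
variable {ι κ : Type} [Fintype ι] [DecidableEq ι] [Fintype κ] [DecidableEq κ]
  {K : Type u} [Field K]

lemma aeval_mul_vec (A : Matrix ι ι K) (r s : K[X]) (v : ι → K) :
    aeval A (r * s) *ᵥ v = aeval A r *ᵥ (aeval A s *ᵥ v) := by
  rw [map_mul, Matrix.mulVec_mulVec]

/-- evaluation map at a vector -/
def evMap (A : Matrix ι ι K) (v : ι → K) : K[X] →ₗ[K] (ι → K) where
  toFun r := aeval A r *ᵥ v
  map_add' r s := by rw [map_add, Matrix.add_mulVec]
  map_smul' c r := by rw [map_smul, Matrix.smul_mulVec]; rfl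

lemma evMap_apply (A : Matrix ι ι K) (v : ι → K) (r : K[X]) :
    evMap A v r = aeval A r *ᵥ v := rfl

lemma ev_mod (A : Matrix ι ι K) {v : ι → K} {p : K[X]}
    (h : aeval A p *ᵥ v = 0) (r : K[X]) :
    aeval A (r %ₘ p) *ᵥ v = aeval A r *ᵥ v := by
  conv_rhs => rw [← modByMonic_add_div r p]
  rw [map_add, Matrix.add_mulVec, mul_comm p, aeval_mul_vec, h, Matrix.mulVec_zero, add_zero]

lemma key_dvd {A : Matrix ι ι K} {v : ι → K} {p : K[X]} (hp : p.Monic)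
    (hd : p.natDegree = Fintype.card ι)
    (h : aeval A p *ᵥ v = 0) (hc : Cv A v) (r : K[X]) :
    aeval A r *ᵥ v = 0 ↔ p ∣ r := by
  constructor
  · intro hr
    rw [← modByMonic_eq_zero_iff_dvd hp]
    set n := Fintype.card ι
    let T : degreeLT K n →ₗ[K] (ι → K) := (evMap A v).comp (Submodule.subtype _)
    have hmem : ∀ r : K[X], r %ₘ p ∈ degreeLT K n := by
      intro r
      rw [mem_degreeLT, ← hd, ← degree_eq_natDegree hp.ne_zero]
      exact degree_modByMonic_lt r hp
    have hs : Function.Surjective T := by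
      intro w
      obtain ⟨r, hr⟩ := hc w
      exact ⟨⟨r %ₘ p, hmem r⟩, by
        change aeval A (r %ₘ p) *ᵥ v = w
        rw [ev_mod A h, hr]⟩
    have hfr : Module.finrank K (degreeLT K n) = Module.finrank K (ι → K) := by
      rw [(degreeLTEquiv K n).finrank_eq]; simp [n]
    have : FiniteDimensional K (degreeLT K n) :=
      Module.Finite.equiv (degreeLTEquiv K n).symm
    have hi := (LinearMap.injective_iff_surjective_of_finrank_eq_finrank hfr).2 hs
    have h0 : T ⟨r %ₘ p, hmem r⟩ = 0 := by
      change aeval A (r %ₘ p) *ᵥ v = 0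
      rw [ev_mod A h, hr]
    have := hi (h0.trans (map_zero T).symm)
    simpa using congrArg Subtype.val this
  · rintro ⟨s, rfl⟩
    rw [mul_comm, aeval_mul_vec, h, Matrix.mulVec_zero]

lemma aeval_eq_zero_of_cv {A : Matrix ι ι K} {v : ι → K} {p : K[X]} 
    (h : aeval A p *ᵥ v = 0) (hc : Cv A v) : aeval A p = 0 := by
  apply Matrix.toLin'.injective
  ext1 i
  ext1
  simp only [LinearMap.comp_apply, toLin'_apply, map_zero, LinearMap.zero_apply]
  obtain ⟨r, hr⟩ := hc (LinearMap.single K _ i 1)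
  rw [← hr, ← aeval_mul_vec, mul_comm, aeval_mul_vec, h, Matrix.mulVec_zero]

lemma Cyc.aeval {A : Matrix ι ι K} {p : K[X]} (h : Cyc A p) : aeval A p = 0 := by
  obtain ⟨_, _, v, h, hc⟩ := h
  exact aeval_eq_zero_of_cv h hc

lemma Cyc.minpoly {A : Matrix ι ι K} {p : K[X]} (h : Cyc A p) : minpoly K A = p := by
  have h0 := h.aeval
  obtain ⟨hm, hd, v, h, hc⟩ := h
  refine (minpoly.unique' K A hm h0 ?_).symm
  intro r hr
  by_cases h1 : r = 0
  · exact Or.inl h1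
  right
  intro h2
  have := (key_dvd hm hd h hc r).1 (by rw [h2, Matrix.zero_mulVec])
  exact absurd (degree_le_of_dvd this h1) (not_le.2 hr)

lemma Cyc.charpoly {A : Matrix ι ι K} {p : K[X]} (h : Cyc A p) : A.charpoly = p := by
  have h1 := h.minpoly
  rw [← h1]
  refine eq_of_monic_of_dvd_of_natDegree_le (minpoly.monic (Matrix.isIntegral A)) A.charpoly_monic
    (Matrix.minpoly_dvd_charpoly A) ?_
  rw [h1, h.2.1, Matrix.charpoly_natDegree_eq_dim]

/-- coordinates along the last Krylov vector -/
lemma exists_last {A : Matrix ι ι K} {v : ι → K} {p : K[X]} (hp : p.Monic)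
    (hd : p.natDegree = Fintype.card ι)
    (h : Polynomial.aeval A p *ᵥ v = 0) (hc : Cv A v) :
    ∃ l : (ι → K) →ₗ[K] K, ∀ r, l (Polynomial.aeval A r *ᵥ v) = (r %ₘ p).coeff (p.natDegree - 1) := by
  obtain ⟨s, hs⟩ := LinearMap.exists_rightInverse_of_surjective (evMap A v)
    (LinearMap.range_eq_top.2 (fun w => hc w))
  let μ : K[X] →ₗ[K] K := (lcoeff K (p.natDegree - 1)).comp (modByMonicHom p)
  refine ⟨μ.comp s, fun r => ?_⟩
  have h1 : evMap A v (s (evMap A v r) - r) = 0 := by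
    rw [map_sub, ← LinearMap.comp_apply, hs]; simp
  have h2 := (key_dvd hp hd h hc _).1 h1
  rw [← modByMonic_eq_zero_iff_dvd hp, sub_modByMonic, sub_eq_zero] at h2
  change ((s (evMap A v r)) %ₘ p).coeff _ = _
  rw [h2]

lemma aeval_intertwine {A : Matrix ι ι K} {B : Matrix κ κ K} {P : Matrix κ ι K}
    (h : P * A = B * P) (r : K[X]) : P * Polynomial.aeval A r = Polynomial.aeval B r * P := by
  induction r using Polynomial.induction_on' with
  | add r s hr hs => rw [map_add, map_add, Matrix.mul_add, Matrix.add_mul, hr, hs]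
  | monomial n c =>
    rw [aeval_monomial, aeval_monomial, Algebra.algebraMap_eq_smul_one,
      Algebra.algebraMap_eq_smul_one]
    simp only [smul_mul_assoc, one_mul, Matrix.mul_smul, Matrix.smul_mul]
    congr 1
    induction n with
    | zero => simp
    | succ n ih => rw [pow_succ, ← Matrix.mul_assoc, ih, Matrix.mul_assoc, h, pow_succ,
        Matrix.mul_assoc]

lemma card_eq_of_inv {P : Matrix κ ι K} {Q : Matrix ι κ K} (h1 : P * Q = 1) (h2 : Q * P = 1) :
    Fintype.card ι = Fintype.card κ := by
  have e : (ι → K) ≃ₗ[K] (κ → K) := Matrix.toLin'OfInv h2 h1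
  simpa using e.finrank_eq

lemma Cyc.conj {A : Matrix ι ι K} {p : K[X]} (h : Cyc A p) {P : Matrix κ ι K} {Q : Matrix ι κ K}
    (h1 : P * Q = 1) (h2 : Q * P = 1) : Cyc (P * A * Q) p := by
  obtain ⟨hm, hd, v, h, hc⟩ := h
  have hinw : P * A = (P * A * Q) * P := by rw [Matrix.mul_assoc _ Q, h2, Matrix.mul_one]
  have key := aeval_intertwine hinw
  refine ⟨hm, hd.trans (card_eq_of_inv h1 h2), P *ᵥ v, ?_, fun w => ?_⟩
  · rw [Matrix.mulVec_mulVec, ← key, ← Matrix.mulVec_mulVec, h, Matrix.mulVec_zero]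
  · obtain ⟨r, hr⟩ := hc (Q *ᵥ w)
    refine ⟨r, ?_⟩
    rw [Matrix.mulVec_mulVec, ← key, ← Matrix.mulVec_mulVec, hr, Matrix.mulVec_mulVec, h1,
      Matrix.one_mulVec]

lemma Cyc.similar {A : Matrix ι ι K} {B : Matrix κ κ K} {p : K[X]} (hA : Cyc A p) (hB : Cyc B p) :
    ∃ (P : Matrix κ ι K) (Q : Matrix ι κ K), P * Q = 1 ∧ Q * P = 1 ∧ P * A * Q = B := by
  obtain ⟨hm, hd, v, hv, hc⟩ := hA
  obtain ⟨_, hd', w, hw, hc'⟩ := hB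
  obtain ⟨s, hs⟩ := LinearMap.exists_rightInverse_of_surjective (evMap A v)
    (LinearMap.range_eq_top.2 (fun w => hc w))
  obtain ⟨t, ht⟩ := LinearMap.exists_rightInverse_of_surjective (evMap B w)
    (LinearMap.range_eq_top.2 (fun w => hc' w))
  let f : (ι → K) →ₗ[K] (κ → K) := (evMap B w).comp s
  let g : (κ → K) →ₗ[K] (ι → K) := (evMap A v).comp t
  have hf : ∀ r, f (evMap A v r) = evMap B w r := by
    intro r
    have h1 : evMap A v (s (evMap A v r) - r) = 0 := by
      rw [map_sub, ← LinearMap.comp_apply, hs]; simp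
    have h2 := (key_dvd hm hd' hw hc' _).2 ((key_dvd hm hd hv hc _).1 h1)
    rw [← evMap_apply, map_sub, sub_eq_zero] at h2
    exact h2
  have hg : ∀ r, g (evMap B w r) = evMap A v r := by
    intro r
    have h1 : evMap B w (t (evMap B w r) - r) = 0 := by
      rw [map_sub, ← LinearMap.comp_apply, ht]; simp
    have h2 := (key_dvd hm hd hv hc _).2 ((key_dvd hm hd' hw hc' _).1 h1)
    rw [← evMap_apply, map_sub, sub_eq_zero] at h2
    exact h2
  have hfg : ∀ x, f (g x) = x := by
    intro x
    obtain ⟨r, rfl⟩ := hc' x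
    rw [← evMap_apply, hg, hf]
  have hgf : ∀ x, g (f x) = x := by
    intro x
    obtain ⟨r, rfl⟩ := hc x
    rw [← evMap_apply, hf, hg]
  have hfA : ∀ x, f (A *ᵥ x) = B *ᵥ f x := by
    intro x
    obtain ⟨r, rfl⟩ := hc x
    rw [← evMap_apply, hf]
    have : ∀ (j : Type) [Fintype j] [DecidableEq j] (D : Matrix j j K) (y : j → K),
        D *ᵥ (evMap D y r) = evMap D y (X * r) := by
      intro j _ _ D y
      rw [evMap_apply, evMap_apply, aeval_mul_vec, aeval_X]
    rw [this, hf, this]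
  refine ⟨LinearMap.toMatrix' f, LinearMap.toMatrix' g, ?_, ?_, ?_⟩
  · rw [← LinearMap.toMatrix'_comp, show f.comp g = LinearMap.id from LinearMap.ext hfg,
      LinearMap.toMatrix'_id]
  · rw [← LinearMap.toMatrix'_comp, show g.comp f = LinearMap.id from LinearMap.ext hgf,
      LinearMap.toMatrix'_id]
  · have : LinearMap.toMatrix' f * A = B * LinearMap.toMatrix' f := by
      have h3 : f.comp (Matrix.toLin' A) = (Matrix.toLin' B).comp f := LinearMap.ext hfA
      have h4 := congrArg LinearMap.toMatrix' h3
      rwa [LinearMap.toMatrix'_comp, LinearMap.toMatrix'_comp, LinearMap.toMatrix'_toLin',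
        LinearMap.toMatrix'_toLin'] at h4
    rw [this, Matrix.mul_assoc, ← LinearMap.toMatrix'_comp,
      show f.comp g = LinearMap.id from LinearMap.ext hfg, LinearMap.toMatrix'_id, Matrix.mul_one]

/-- cyclic vector from an injectivity criterion -/
lemma cv_of_inj {A : Matrix ι ι K} {v : ι → K}
    (h : ∀ r : K[X], r.natDegree < Fintype.card ι → Polynomial.aeval A r *ᵥ v = 0 → r = 0) : Cv A v := by
  set n := Fintype.card ι with hn
  let T : degreeLT K n →ₗ[K] (ι → K) := (evMap A v).comp (Submodule.subtype _)
  have hfr : Module.finrank K (degreeLT K n) = Module.finrank K (ι → K) := by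
    rw [(degreeLTEquiv K n).finrank_eq]; simp [n]
  have : FiniteDimensional K (degreeLT K n) :=
    Module.Finite.equiv (degreeLTEquiv K n).symm
  have hi : Function.Injective T := by
    rw [← LinearMap.ker_eq_bot, LinearMap.ker_eq_bot']
    rintro ⟨r, hr⟩ h0
    have h0' : Polynomial.aeval A r *ᵥ v = 0 := h0
    by_cases hr0 : r = 0
    · simp [hr0]
    rw [mem_degreeLT] at hr
    exact Subtype.ext (h r ((natDegree_lt_iff_degree_lt hr0).2 hr) h0')
  have hs := (LinearMap.injective_iff_surjective_of_finrank_eq_finrank hfr).1 hi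
  intro w
  obtain ⟨r, hr⟩ := hs w
  exact ⟨r.1, hr⟩

lemma aeval_transpose' (A : Matrix ι ι K) (r : K[X]) :
    Polynomial.aeval Aᵀ r = (Polynomial.aeval A r)ᵀ := by
  induction r using Polynomial.induction_on' with
  | add r s hr hs => rw [map_add, map_add, Matrix.transpose_add, hr, hs]
  | monomial n c =>
    rw [aeval_monomial, aeval_monomial, Algebra.algebraMap_eq_smul_one]
    simp [Matrix.transpose_pow]

lemma Cyc.transpose {A : Matrix ι ι K} {p : K[X]} (h : Cyc A p) : Cyc Aᵀ p := by
  have h00 := h.aeval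
  obtain ⟨hm, hd, v, hv, hc⟩ := h
  obtain ⟨l, hl⟩ := exists_last hm hd hv hc
  refine ⟨hm, hd, fun i => l (Pi.single i 1), ?_, ?_⟩
  · rw [aeval_transpose', h00]; simp
  apply cv_of_inj
  intro r hr h0
  -- pairing: r(Aᵀ) l = 0 means l (r(A) w) = 0 for all w
  have hlw : ∀ w, l w = (fun i => l (Pi.single i 1)) ⬝ᵥ w := by
    intro w
    conv_lhs => rw [← Matrix.one_mulVec w]
    rw [dotProduct]
    conv_lhs => rw [Matrix.one_mulVec, pi_eq_sum_univ' w, map_sum]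
    refine Finset.sum_congr rfl fun i _ => ?_
    rw [map_smul, smul_eq_mul, mul_comm]
  have h1 : ∀ w, l (Polynomial.aeval A r *ᵥ w) = 0 := by
    intro w
    rw [hlw, Matrix.dotProduct_mulVec, ← Matrix.mulVec_transpose, ← aeval_transpose', h0,
      zero_dotProduct]
  by_contra hr0
  have hn : 0 < p.natDegree := by omega
  set d := r.natDegree
  have h2 := h1 (Polynomial.aeval A ((X : K[X]) ^ (p.natDegree - 1 - d)) *ᵥ v)
  rw [← aeval_mul_vec, hl] at h2
  have hdeg : (r * X ^ (p.natDegree - 1 - d)).natDegree = p.natDegree - 1 := by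
    rw [natDegree_mul_X_pow _ hr0]; omega
  have hne : r * X ^ (p.natDegree - 1 - d) ≠ 0 := mul_ne_zero hr0 (pow_ne_zero _ X_ne_zero)
  rw [(modByMonic_eq_self_iff hm).2 (by
    rw [degree_eq_natDegree hne, degree_eq_natDegree hm.ne_zero, hdeg]
    exact_mod_cast (by omega))] at h2
  have h3 := coeff_natDegree (p := r * X ^ (p.natDegree - 1 - d))
  rw [hdeg, h2] at h3
  exact hne (leadingCoeff_eq_zero.1 h3.symm)

end cyc



section good
variable {ι κ : Type} [Fintype ι] [DecidableEq ι] [Fintype κ] [DecidableEq κ]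
  {K : Type u} [Field K]

lemma exists_cyc (p : K[X]) (hp : p.Monic) (hd : p.natDegree = Fintype.card ι) :
    ∃ A : Matrix ι ι K, Cyc A p := by
  have hfin : ∃ A : Matrix (Fin (AdjoinRoot.powerBasis' hp).dim) (Fin (AdjoinRoot.powerBasis' hp).dim) K,
      Cyc A p := by
    let b := (AdjoinRoot.powerBasis' hp).basis
    have key : ∀ r : K[X], aeval (Algebra.leftMulMatrix b (AdjoinRoot.root p)) r *ᵥ b.repr 1
        = b.repr (aeval (AdjoinRoot.root p) r) := by
      intro r
      rw [aeval_algHom_apply, Algebra.leftMulMatrix_mulVec_repr, mul_one]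
    refine ⟨Algebra.leftMulMatrix b (AdjoinRoot.root p), hp, by simp, b.repr 1, ?_, ?_⟩
    · rw [key]; simp
    · intro w
      obtain ⟨y, hy⟩ := b.equivFun.surjective w
      obtain ⟨r, rfl⟩ := AdjoinRoot.mk_surjective y
      refine ⟨r, ?_⟩
      rw [key, AdjoinRoot.aeval_eq, ← hy]
      rfl
  obtain ⟨A, hA⟩ := hfin
  let e : Fin (AdjoinRoot.powerBasis' hp).dim ≃ ι := Fintype.equivOfCardEq (by simp [hd])
  have h1 := hA.conj (P := (1 : Matrix ι ι K).submatrix id e)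
    (Q := (1 : Matrix ι ι K).submatrix e id) (by
      rw [Matrix.submatrix_mul_equiv]; simp) (by
      rw [← Matrix.submatrix_mul _ _ _ _ _ Function.bijective_id]; simp)
  exact ⟨_, h1⟩

lemma isUnit_of_cyc {A : Matrix ι ι K} {p : K[X]} (h : Cyc A p) (h0 : p.coeff 0 ≠ 0) :
    IsUnit A.det := by
  rw [Matrix.det_eq_sign_charpoly_coeff, h.charpoly]
  refine IsUnit.mul ?_ (isUnit_iff_ne_zero.2 h0)
  exact (isUnit_one.neg).pow _

lemma pow_mul_aeval_reflect {A : Matrix ι ι K} (hA : IsUnit A.det) (N : ℕ) (f : K[X])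
    (hf : f.natDegree ≤ N) : A ^ N * aeval A⁻¹ (reflect N f) = aeval A f := by
  refine Polynomial.induction_with_natDegree_le
    (fun f => A ^ N * aeval A⁻¹ (reflect N f) = aeval A f) N ?_ ?_ ?_ f hf
  · simp
  · intro k c _ hk
    have h1 : A ^ N = A ^ k * A ^ (N - k) := by rw [← pow_add]; congr 1; omega
    rw [reflect_C_mul_X_pow, revAt_le hk]
    simp only [map_mul, aeval_C, map_pow, aeval_X, Algebra.algebraMap_eq_smul_one,
      Matrix.mul_smul, Matrix.smul_mul, Matrix.one_mul]
    congr 1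
    rw [h1, Matrix.mul_assoc, Matrix.inv_pow', Matrix.mul_nonsing_inv _ (by
      rw [Matrix.det_pow]; exact hA.pow _), Matrix.mul_one]
  · intro f g _ _ h1 h2
    rw [reflect_add, map_add, map_add, Matrix.mul_add, h1, h2]

lemma recip_monic {p : K[X]} (h0 : p.coeff 0 ≠ 0) : (recipPoly p).Monic := by
  unfold recipPoly Polynomial.Monic
  rw [leadingCoeff_mul, leadingCoeff_C, reverse_leadingCoeff]
  rw [show p.trailingCoeff = p.coeff 0 from by
    rw [trailingCoeff, natTrailingDegree_eq_zero.2 (Or.inr h0)]]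
  exact inv_mul_cancel₀ h0

lemma recip_natDegree {p : K[X]} (h0 : p.coeff 0 ≠ 0) :
    (recipPoly p).natDegree = p.natDegree := by
  unfold recipPoly
  rw [natDegree_C_mul (inv_ne_zero h0), reverse_natDegree, natTrailingDegree_eq_zero.2 (Or.inr h0)]
  simp

lemma recip_mul (p q : K[X]) : recipPoly (p * q) = recipPoly p * recipPoly q := by
  unfold recipPoly
  rw [reverse_mul_of_domain, mul_coeff_zero, mul_inv, C_mul]
  ring

lemma recip_one : recipPoly (1 : K[X]) = 1 := by
  unfold recipPoly
  rw [← C_1, reverse_C]; simp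

lemma recip_pow (p : K[X]) (n : ℕ) : recipPoly (p ^ n) = recipPoly p ^ n := by
  induction n with
  | zero => simp [recip_one]
  | succ n ih => rw [pow_succ, recip_mul, ih, pow_succ]

lemma Cyc.inv {A : Matrix ι ι K} {p : K[X]} (h : Cyc A p) (h0 : p.coeff 0 ≠ 0) :
    Cyc A⁻¹ (recipPoly p) := by
  have hu := isUnit_of_cyc h h0
  have hz := h.aeval
  obtain ⟨hm, hd, v, hv, hc⟩ := h
  refine ⟨recip_monic h0, (recip_natDegree h0).trans hd, v, ?_, ?_⟩
  · have h1 := pow_mul_aeval_reflect hu p.natDegree p le_rfl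
    rw [hz] at h1
    have h2 : Polynomial.aeval A⁻¹ (reflect p.natDegree p) = 0 := by
      have hu2 : IsUnit (A ^ p.natDegree).det := by rw [Matrix.det_pow]; exact hu.pow _
      have := congrArg (fun B => (A ^ p.natDegree)⁻¹ * B) h1
      simpa [← Matrix.mul_assoc, Matrix.nonsing_inv_mul _ hu2] using this
    unfold recipPoly
    rw [map_mul, reverse, h2]; simp
  · have hu' : IsUnit A⁻¹.det := by
      rw [Matrix.det_nonsing_inv]; exact hu.ringInverse
    -- A is a polynomial in A⁻¹
    obtain ⟨s, hs⟩ : ∃ s : K[X], Polynomial.aeval A⁻¹ s = A := by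
      have hc0 : A⁻¹.charpoly.coeff 0 ≠ 0 := by
        intro h
        rw [Matrix.det_eq_sign_charpoly_coeff, h, mul_zero] at hu'
        exact not_isUnit_zero hu'
      have hch := Matrix.aeval_self_charpoly A⁻¹
      rw [← divX_mul_X_add A⁻¹.charpoly, map_add, map_mul, aeval_X, aeval_C,
        Algebra.algebraMap_eq_smul_one] at hch
      refine ⟨C (-(A⁻¹.charpoly.coeff 0)⁻¹) * divX A⁻¹.charpoly, ?_⟩
      have h3 := congrArg (fun B => B * A) hch
      simp only [Matrix.add_mul, Matrix.mul_assoc, Matrix.nonsing_inv_mul _ hu, Matrix.mul_one,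
        Matrix.smul_mul, Matrix.one_mul, Matrix.zero_mul] at h3
      rw [map_mul, aeval_C, Algebra.algebraMap_eq_smul_one, Matrix.smul_mul, Matrix.one_mul,
        eq_neg_of_add_eq_zero_left h3, smul_neg, neg_smul, neg_neg, smul_smul,
        inv_mul_cancel₀ hc0, one_smul]
    intro w
    obtain ⟨r, hr⟩ := hc w
    exact ⟨r.comp s, by rw [aeval_comp, hs, hr]⟩

/-- the twist `p(-x)` up to sign -/
lemma Cyc.neg {A : Matrix ι ι K} {p p' : K[X]} (h : Cyc A p)
    (hp : p' = C ((-1) ^ p.natDegree) * p.comp (-X)) : Cyc (-A) p' := by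
  obtain ⟨hm, hd, v, hv, hc⟩ := h
  have hdeg : p'.natDegree = p.natDegree := by
    rw [hp, natDegree_C_mul (pow_ne_zero _ (neg_ne_zero.2 one_ne_zero)), natDegree_comp]
    simp
  refine ⟨?_, hdeg.trans hd, v, ?_, ?_⟩
  · rw [hp, Polynomial.Monic, leadingCoeff_mul, leadingCoeff_C, leadingCoeff_comp (by simp),
      hm.leadingCoeff]
    simp [← mul_pow]
  · rw [hp, aeval_mul_vec, aeval_comp]
    simp [hv]
  · intro w
    obtain ⟨r, hr⟩ := hc w
    exact ⟨r.comp (-X), by rw [aeval_comp]; simp [hr]⟩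

lemma cv_of_irred {A : Matrix ι ι K} {p : K[X]} (hp : Irreducible p)
    (hd : p.natDegree = Fintype.card ι) (hA : aeval A p = 0) {z : ι → K} (hz : z ≠ 0) :
    Cv A z := by
  apply cv_of_inj
  intro r hr h0
  by_contra hr0
  have hcop : IsCoprime p r := by
    refine hp.coprime_iff_not_dvd.2 fun h => ?_
    exact absurd (natDegree_le_of_dvd h hr0) (by omega)
  obtain ⟨a, b, hab⟩ := hcop
  apply hz
  have := congrArg (fun s => aeval A s *ᵥ z) hab
  simp only [map_add, Matrix.add_mulVec, aeval_mul_vec, h0, hA] at this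
  simpa using this.symm

/-- `a = A C⁻¹` with `A`, `C` cyclic with characteristic polynomials `p₁`, `p₂`. -/
def Good (p₁ p₂ : K[X]) (a : Matrix ι ι K) : Prop :=
  ∃ A C : Matrix ι ι K, A = a * C ∧ Cyc A p₁ ∧ Cyc C p₂

lemma Good.conj {p₁ p₂ : K[X]} {a : Matrix ι ι K} (h : Good p₁ p₂ a) {b : Matrix κ κ K}
    {P : Matrix κ ι K} {Q : Matrix ι κ K}
    (h1 : P * Q = 1) (h2 : Q * P = 1) (hb : P * a * Q = b) : Good p₁ p₂ b := by
  obtain ⟨A, C, hA, cA, cC⟩ := h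
  refine ⟨P * A * Q, P * C * Q, ?_, cA.conj h1 h2, cC.conj h1 h2⟩
  rw [← hb, hA]
  calc P * (a * C) * Q = P * a * (1 * C) * Q := by
        simp only [Matrix.mul_assoc, Matrix.one_mul]
    _ = P * a * Q * (P * C * Q) := by rw [← h2]; simp only [Matrix.mul_assoc]

lemma Good.reindex {p₁ p₂ : K[X]} {a : Matrix ι ι K} (h : Good p₁ p₂ a) (e : κ ≃ ι) :
    Good p₁ p₂ (a.submatrix e e) := by
  refine h.conj (P := (1 : Matrix ι ι K).submatrix e id)
    (Q := (1 : Matrix ι ι K).submatrix id e) ?_ ?_ ?_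
  · rw [← Matrix.submatrix_mul _ _ _ _ _ Function.bijective_id]; simp
  · rw [Matrix.submatrix_mul_equiv]; simp
  · ext i j; simp [Matrix.mul_apply, Matrix.one_apply]

lemma good_one {p : K[X]} (hp : p.Monic) (hd : p.natDegree = Fintype.card ι) :
    Good p p (1 : Matrix ι ι K) := by
  obtain ⟨A, hA⟩ := exists_cyc (ι := ι) p hp hd
  exact ⟨A, A, by simp, hA, hA⟩

lemma good_neg_one {p p' : K[X]} (hp : p.Monic) (hd : p.natDegree = Fintype.card ι)
    (hp' : p' = C ((-1) ^ p.natDegree) * p.comp (-X)) :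
    Good p' p (-1 : Matrix ι ι K) := by
  obtain ⟨A, hA⟩ := exists_cyc (ι := ι) p hp hd
  exact ⟨-A, A, by simp, hA.neg hp', hA⟩

/-- A cell: can be linked on top of a `Good` matrix. -/
def Cell (p₁ p₂ : K[X]) (a : Matrix ι ι K) : Prop :=
  p₁.Monic ∧ p₂.Monic ∧ p₁.natDegree = Fintype.card ι ∧ p₂.natDegree = Fintype.card ι ∧
  IsUnit a.det ∧
  ∃ A C : Matrix ι ι K, A = a * C ∧ aeval A p₁ = 0 ∧ aeval C p₂ = 0 ∧
    ∀ (W : Type u) [AddCommGroup W] [Module K W] (l₁ l₂ : W →ₗ[K] (ι → K)) (k : ι → K),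
      Function.Surjective l₁ → Function.Surjective l₂ →
      ∃ Y, Cv C (l₁ Y) ∧ Cv A (l₂ Y + k)

lemma Cell.good {p₁ p₂ : K[X]} {a : Matrix ι ι K} (h : Cell p₁ p₂ a) : Good p₁ p₂ a := by
  obtain ⟨m1, m2, d1, d2, _, A, C, hA, h1, h2, hY⟩ := h
  obtain ⟨Y, y1, y2⟩ := hY (ι → K) LinearMap.id LinearMap.id 0 Function.surjective_id
    Function.surjective_id
  exact ⟨A, C, hA, ⟨m1, d1, _, by rw [h1, Matrix.zero_mulVec], y2⟩,
    ⟨m2, d2, _, by rw [h2, Matrix.zero_mulVec], y1⟩⟩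

lemma cv_conj {A : Matrix ι ι K} {v : ι → K} (hc : Cv A v) {P : Matrix κ ι K} {Q : Matrix ι κ K}
    (h1 : P * Q = 1) (h2 : Q * P = 1) : Cv (P * A * Q) (P *ᵥ v) := by
  have hinw : P * A = (P * A * Q) * P := by rw [Matrix.mul_assoc _ Q, h2, Matrix.mul_one]
  have key := aeval_intertwine hinw
  intro w
  obtain ⟨r, hr⟩ := hc (Q *ᵥ w)
  refine ⟨r, ?_⟩
  rw [Matrix.mulVec_mulVec, ← key, ← Matrix.mulVec_mulVec, hr, Matrix.mulVec_mulVec, h1,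
    Matrix.one_mulVec]

lemma cell_of_irred {p₁ p₂ : K[X]} {a : Matrix ι ι K} (i1 : Irreducible p₁) (i2 : Irreducible p₂)
    (m1 : p₁.Monic) (m2 : p₂.Monic) (d1 : p₁.natDegree = Fintype.card ι)
    (d2 : p₂.natDegree = Fintype.card ι) (hcard : 2 ≤ Fintype.card ι) (ha : IsUnit a.det)
    {A C : Matrix ι ι K} (hA : A = a * C) (h1 : aeval A p₁ = 0) (h2 : aeval C p₂ = 0) :
    Cell p₁ p₂ a := by
  refine ⟨m1, m2, d1, d2, ha, A, C, hA, h1, h2, ?_⟩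
  intro W _ _ l₁ l₂ k s1 s2
  suffices ∃ Y, l₁ Y ≠ 0 ∧ l₂ Y + k ≠ 0 by
    obtain ⟨Y, y1, y2⟩ := this
    exact ⟨Y, cv_of_irred i2 d2 h2 y1, cv_of_irred i1 d1 h1 y2⟩
  obtain ⟨i, j, hij⟩ := Fintype.one_lt_card_iff.1 (show 1 < Fintype.card ι by omega)
  by_contra! hcon
  obtain ⟨Y0, hY0⟩ := s2 (Pi.single i 1 - k)
  have hne : l₂ Y0 + k ≠ 0 := by
    rw [hY0, sub_add_cancel]; intro h; have := congrFun h i; simp at this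
  have h0 : l₁ Y0 = 0 := by
    by_contra h; exact hne (hcon Y0 h)
  have hstep : ∀ Y, l₁ Y ≠ 0 → l₂ Y = -(l₂ Y0 + k) := by
    intro Y hY
    have := hcon (Y0 + Y) (by rw [map_add, h0, zero_add]; exact hY)
    rw [map_add] at this
    rw [eq_neg_iff_add_eq_zero, ← this]; abel
  obtain ⟨Y1, hY1⟩ := s1 (Pi.single i 1)
  obtain ⟨Y2, hY2⟩ := s1 (Pi.single j 1)
  have e1 := hstep Y1 (by rw [hY1]; intro h; have := congrFun h i; simp at this)
  have e2 := hstep Y2 (by rw [hY2]; intro h; have := congrFun h j; simp at this)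
  have e3 := hstep (Y1 + Y2) (by
    rw [map_add, hY1, hY2]; intro h; have := congrFun h i; simp [hij] at this)
  rw [map_add, e1, e2] at e3
  apply hne
  have : -(l₂ Y0 + k) = 0 := by simpa using e3
  exact neg_eq_zero.1 this

lemma avoid {W : Type*} [AddCommGroup W] [Module K W] {J : Type*} [DecidableEq J] (s : Finset J)
    (φ : J → W →ₗ[K] K) (k : J → K) (hφ : ∀ i ∈ s, φ i ≠ 0) (T : Finset K)
    (hT : s.card < T.card) : ∃ Y, ∀ i ∈ s, φ i Y + k i ≠ 0 := by
  classical
  induction s using Finset.induction_on with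
  | empty => exact ⟨0, by simp⟩
  | insert j s hj ih =>
    rw [Finset.card_insert_of_notMem hj] at hT
    obtain ⟨Y0, hY0⟩ := ih (fun i hi => hφ i (Finset.mem_insert_of_mem hi)) (by omega)
    by_cases hj0 : φ j Y0 + k j = 0
    swap
    · refine ⟨Y0, fun i hi => ?_⟩
      rcases Finset.mem_insert.1 hi with rfl | hi
      · exact hj0
      · exact hY0 i hi
    obtain ⟨w, hw⟩ : ∃ w, φ j w ≠ 0 := by
      by_contra! h
      exact hφ j (Finset.mem_insert_self _ _) (LinearMap.ext h)
    let bad : Finset K := insert 0 (s.image fun i => -(φ i Y0 + k i) / φ i w)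
    have hb : bad.card < T.card := by
      refine lt_of_le_of_lt (Finset.card_insert_le _ _) ?_
      exact lt_of_le_of_lt (Nat.succ_le_succ Finset.card_image_le) hT
    obtain ⟨t, _, htb⟩ := Finset.exists_mem_notMem_of_card_lt_card hb
    have ht0 : t ≠ 0 := fun h => htb (by rw [h]; exact Finset.mem_insert_self _ _)
    refine ⟨Y0 + t • w, fun i hi => ?_⟩
    rw [map_add, map_smul, smul_eq_mul]
    rcases Finset.mem_insert.1 hi with rfl | hi
    · intro h
      have : t * φ i w = 0 := by linear_combination h - hj0
      exact (mul_ne_zero ht0 hw) this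
    · intro h
      by_cases hz : φ i w = 0
      · rw [hz, mul_zero, add_zero] at h
        exact hY0 i hi h
      · apply htb
        refine Finset.mem_insert_of_mem (Finset.mem_image.2 ⟨i, hi, ?_⟩)
        rw [div_eq_iff hz]; linear_combination -h

lemma cell_of_functionals {p₁ p₂ : K[X]} {a : Matrix ι ι K}
    (m1 : p₁.Monic) (m2 : p₂.Monic) (d1 : p₁.natDegree = Fintype.card ι)
    (d2 : p₂.natDegree = Fintype.card ι) (ha : IsUnit a.det)
    {A C : Matrix ι ι K} (hA : A = a * C) (h1 : aeval A p₁ = 0) (h2 : aeval C p₂ = 0)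
    {N₁ N₂ : ℕ} (φ : Fin N₁ → (ι → K) →ₗ[K] K) (ψ : Fin N₂ → (ι → K) →ₗ[K] K)
    (hφ : ∀ i, φ i ≠ 0) (hψ : ∀ i, ψ i ≠ 0)
    (cA : ∀ z, (∀ i, φ i z ≠ 0) → Cv A z) (cC : ∀ z, (∀ i, ψ i z ≠ 0) → Cv C z)
    (T : Finset K) (hT : N₁ + N₂ < T.card) : Cell p₁ p₂ a := by
  refine ⟨m1, m2, d1, d2, ha, A, C, hA, h1, h2, ?_⟩
  intro W _ _ l₁ l₂ k s1 s2
  obtain ⟨Y, hY⟩ := avoid (Finset.univ : Finset (Fin N₁ ⊕ Fin N₂))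
    (Sum.elim (fun i => (φ i).comp l₂) (fun i => (ψ i).comp l₁))
    (Sum.elim (fun i => φ i k) (fun _ => 0)) (by
      rintro (i | i) - h
      · apply hφ i; ext1 j
        ext1
        obtain ⟨Y, hY⟩ := s2 (LinearMap.single K _ j 1)
        have := LinearMap.congr_fun h Y
        simp only [Sum.elim_inl, LinearMap.comp_apply, hY] at this
        simpa using this
      · apply hψ i; ext1 j
        ext1
        obtain ⟨Y, hY⟩ := s1 (LinearMap.single K _ j 1)
        have := LinearMap.congr_fun h Y
        simp only [Sum.elim_inr, LinearMap.comp_apply, hY] at this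
        simpa using this) T (by simpa using hT)
  refine ⟨Y, cC _ fun i => ?_, cA _ fun i => ?_⟩
  · simpa using hY (Sum.inr i) (Finset.mem_univ _)
  · simpa using hY (Sum.inl i) (Finset.mem_univ _)

end good



section link
variable {ι κ : Type} [Fintype ι] [DecidableEq ι] [Fintype κ] [DecidableEq κ]
  {K : Type u} [Field K]

lemma block_lin (D : Matrix κ κ K) (E : Matrix ι ι K) (h : K[X]) :
    ∃ Φ : Matrix κ ι K →ₗ[K] Matrix κ ι K, ∀ Y,
      aeval (fromBlocks D Y 0 E) h = fromBlocks (aeval D h) (Φ Y) 0 (aeval E h) := by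
  induction h using Polynomial.induction_on' with
  | add r s hr hs =>
    obtain ⟨f, hf⟩ := hr
    obtain ⟨g, hg⟩ := hs
    exact ⟨f + g, fun Y => by
      rw [map_add, hf, hg, fromBlocks_add, map_add, map_add, LinearMap.add_apply, add_zero]⟩
  | monomial n c =>
    have : ∃ Φ : Matrix κ ι K →ₗ[K] Matrix κ ι K, ∀ Y,
        (fromBlocks D Y 0 E) ^ n = fromBlocks (D ^ n) (Φ Y) 0 (E ^ n) := by
      induction n with
      | zero => exact ⟨0, fun Y => by simp [fromBlocks_one]⟩
      | succ n ih =>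
        obtain ⟨f, hf⟩ := ih
        refine ⟨{ toFun := fun Y => D ^ n * Y + f Y * E, map_add' := ?_, map_smul' := ?_ },
          fun Y => ?_⟩
        · intro x y; rw [map_add, Matrix.mul_add, Matrix.add_mul]; abel
        · intro a x; simp [Matrix.mul_smul, Matrix.smul_mul]
        · rw [pow_succ, hf, fromBlocks_multiply, pow_succ, pow_succ]
          simp
    obtain ⟨f, hf⟩ := this
    refine ⟨c • f, fun Y => ?_⟩
    rw [aeval_monomial, aeval_monomial, aeval_monomial, hf, Algebra.algebraMap_eq_smul_one,
      Algebra.algebraMap_eq_smul_one, Algebra.algebraMap_eq_smul_one]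
    simp only [smul_mul_assoc, one_mul, fromBlocks_smul, smul_zero, LinearMap.smul_apply]

/-- the linear map `Y ↦ z` where `p(C) (0,v) = (z,0)` -/
lemma link_map (D : Matrix κ κ K) {E : Matrix ι ι K} {v : ι → K} {p : K[X]} (hp : p.Monic)
    (hd : p.natDegree = Fintype.card ι) (hv : aeval E p *ᵥ v = 0) (hc : Cv E v) [Nonempty ι] :
    ∃ L : Matrix κ ι K →ₗ[K] (κ → K), Function.Surjective L ∧
      ∀ Y, aeval (fromBlocks D Y 0 E) p *ᵥ (Sum.elim 0 v) = Sum.elim (L Y) 0 := by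
  obtain ⟨Φ, hΦ⟩ := block_lin D E p
  have hL : ∀ Y, aeval (fromBlocks D Y 0 E) p *ᵥ (Sum.elim 0 v) = Sum.elim (Φ Y *ᵥ v) 0 := by
    intro Y
    rw [hΦ, fromBlocks_mulVec]
    simp [hv]
  refine ⟨{ toFun := fun Y => Φ Y *ᵥ v, map_add' := ?_, map_smul' := ?_ }, ?_, hL⟩
  · intro x y; rw [map_add, Matrix.add_mulVec]
  · intro a x; rw [map_smul, Matrix.smul_mulVec]; rfl
  intro y
  obtain ⟨l, hl⟩ := exists_last hp hd hv hc
  have hn : 0 < p.natDegree := by rw [hd]; exact Fintype.card_pos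
  set n := p.natDegree with hnn
  -- Y w = l(w) y
  let g : (ι → K) →ₗ[K] (κ → K) := l.smulRight y
  let Y : Matrix κ ι K := LinearMap.toMatrix' g
  have hY : ∀ w, Y *ᵥ w = l w • y := by
    intro w
    rw [← Matrix.toLin'_apply, Matrix.toLin'_toMatrix']; rfl
  refine ⟨Y, ?_⟩
  have hpow : ∀ j, j < n → aeval (fromBlocks D Y 0 E) ((X : K[X]) ^ j) *ᵥ (Sum.elim 0 v) =
      Sum.elim (0 : κ → K) (aeval E ((X : K[X]) ^ j) *ᵥ v) := by
    intro j
    induction j with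
    | zero => intro _; simp
    | succ j ih =>
      intro hj
      rw [pow_succ', aeval_mul_vec, ih (by omega), aeval_X, fromBlocks_mulVec, aeval_mul_vec,
        aeval_X]
      simp only [Sum.elim_comp_inl, Sum.elim_comp_inr, Matrix.mulVec_zero,
        zero_add]
      rw [hY, hl, (modByMonic_eq_self_iff hp).2 (by
        rw [degree_X_pow, degree_eq_natDegree hp.ne_zero]; exact_mod_cast (by omega)),
        coeff_X_pow, if_neg (by omega), zero_smul]
  have hXn : aeval (fromBlocks D Y 0 E) ((X : K[X]) ^ n) *ᵥ (Sum.elim 0 v) =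
      Sum.elim y (aeval E ((X : K[X]) ^ n) *ᵥ v) := by
    obtain ⟨m, hm⟩ : ∃ m, n = m + 1 := ⟨n - 1, by omega⟩
    rw [hm, pow_succ', aeval_mul_vec, hpow m (by omega), aeval_X, fromBlocks_mulVec, aeval_mul_vec,
        aeval_X]
    simp only [Sum.elim_comp_inl, Sum.elim_comp_inr, Matrix.mulVec_zero,
        zero_add]
    rw [hY, hl, (modByMonic_eq_self_iff hp).2 (by
        rw [degree_X_pow, degree_eq_natDegree hp.ne_zero]; exact_mod_cast (by omega)),
        coeff_X_pow, if_pos (by omega), one_smul]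
  have hlow : ∀ r : K[X], r.degree < n → aeval (fromBlocks D Y 0 E) r *ᵥ (Sum.elim 0 v) =
      Sum.elim (0 : κ → K) (aeval E r *ᵥ v) := by
    intro r hr
    have hs := r.as_sum_range' n (by
      by_cases h0 : r = 0
      · rw [h0]; simpa using hn
      · exact (natDegree_lt_iff_degree_lt h0).2 hr)
    rw [hs, map_sum, map_sum, Matrix.sum_mulVec, Matrix.sum_mulVec]
    have : ∀ j ∈ Finset.range n, aeval (fromBlocks D Y 0 E) (monomial j (r.coeff j)) *ᵥ
        (Sum.elim 0 v) = Sum.elim (0 : κ → K) (aeval E (monomial j (r.coeff j)) *ᵥ v) := by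
      intro j hj
      have := hpow j (Finset.mem_range.1 hj)
      rw [← C_mul_X_pow_eq_monomial, aeval_mul_vec, aeval_mul_vec, this, aeval_C, aeval_C,
        Algebra.algebraMap_eq_smul_one, Algebra.algebraMap_eq_smul_one]
      simp only [Matrix.smul_mulVec, Matrix.one_mulVec]
      ext (i | i) <;> simp
    rw [Finset.sum_congr rfl this]
    ext (i | i) <;> simp [Finset.sum_apply]
  have h1 := hL Y
  have hsplit : p = X ^ n + (p - X ^ n) := by ring
  have hdeg : (p - X ^ n).degree < (n : WithBot ℕ) := by
    have := degree_sub_lt_left (p := p) (q := X ^ n) (by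
      rw [degree_X_pow, degree_eq_natDegree hp.ne_zero]) hp.ne_zero (by
      rw [hp.leadingCoeff, leadingCoeff_X_pow])
    rwa [degree_eq_natDegree hp.ne_zero] at this
  rw [hsplit, map_add, Matrix.add_mulVec, hXn, hlow _ hdeg] at h1
  have h2 := congrArg (fun f => f ∘ Sum.inl) h1
  ext i
  have := congrFun h2 i
  simpa using this.symm

lemma cyc_block {D : Matrix κ κ K} {E : Matrix ι ι K} {Y : Matrix κ ι K} {f p : K[X]}
    {v : ι → K} {z : κ → K} (hf : f.Monic) (hp : p.Monic)
    (hdf : f.natDegree = Fintype.card κ) (hdp : p.natDegree = Fintype.card ι)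
    (hD : aeval D f = 0) (hz : Cv D z) (hE : Cv E v)
    (h : aeval (fromBlocks D Y 0 E) p *ᵥ (Sum.elim 0 v) = Sum.elim z 0) :
    Cyc (fromBlocks D Y 0 E) (f * p) := by
  refine ⟨hf.mul hp, ?_, Sum.elim 0 v, ?_, ?_⟩
  · rw [hf.natDegree_mul hp, hdf, hdp, Fintype.card_sum]
  · obtain ⟨Φ, hΦ⟩ := block_lin D E f
    rw [aeval_mul_vec, h, hΦ, hD, fromBlocks_mulVec]
    ext (i | i) <;> simp
  · intro w
    obtain ⟨r, hr⟩ := hE (w ∘ Sum.inr)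
    obtain ⟨Φ, hΦ⟩ := block_lin D E r
    obtain ⟨s, hs⟩ := hz (w ∘ Sum.inl - Φ Y *ᵥ v)
    obtain ⟨Ψ, hΨ⟩ := block_lin D E s
    refine ⟨r + s * p, ?_⟩
    rw [map_add, Matrix.add_mulVec, aeval_mul_vec, h, hΦ, hΨ, fromBlocks_mulVec, fromBlocks_mulVec]
    simp only [Sum.elim_comp_inl, Sum.elim_comp_inr, Matrix.mulVec_zero, Matrix.zero_mulVec,
        zero_add, add_zero, hr, hs]
    ext (i | i) <;> simp

lemma Good.monic₁ {p₁ p₂ : K[X]} {a : Matrix ι ι K} (h : Good p₁ p₂ a) : p₁.Monic := by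
  obtain ⟨A, C, _, h, _⟩ := h; exact h.1

/-- The link lemma. -/
lemma Cell.link {f₁ f₂ p₁ p₂ : K[X]} {a : Matrix κ κ K} {a' : Matrix ι ι K}
    (hcell : Cell f₁ f₂ a) (hgood : Good p₁ p₂ a') (b : Matrix κ ι K) :
    Good (f₁ * p₁) (f₂ * p₂) (fromBlocks a b 0 a') := by
  cases isEmpty_or_nonempty ι with
  | inl he =>
    have h1 := hcell.good.reindex (Equiv.sumEmpty κ ι)
    have hone : ∀ p : K[X], p.Monic → p.natDegree = Fintype.card ι → p = 1 := by
      intro p hp hd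
      rw [Fintype.card_eq_zero] at hd
      exact hp.natDegree_eq_zero.1 hd
    obtain ⟨A, C, _, hA, hC⟩ := hgood
    rw [hone p₁ hA.1 hA.2.1, hone p₂ hC.1 hC.2.1, mul_one, mul_one]
    convert h1 using 1
    ext (i | i) (j | j)
    · simp
    · exact (he.false j).elim
    · exact (he.false i).elim
    · exact (he.false i).elim
  | inr hne =>
    obtain ⟨m1, m2, d1, d2, hu, A, C, hA, h1, h2, hY⟩ := hcell
    obtain ⟨A', C', hA', ⟨n1, e1, v1, hv1, c1⟩, ⟨n2, e2, v2, hv2, c2⟩⟩ := hgood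
    obtain ⟨L1, s1, hL1⟩ := link_map C n2 e2 hv2 c2
    obtain ⟨L2, s2, hL2⟩ := link_map A n1 e1 hv1 c1
    let l₂ : Matrix κ ι K →ₗ[K] (κ → K) :=
      { toFun := fun Y => L2 (a * Y)
        map_add' := fun x y => by rw [Matrix.mul_add, map_add]
        map_smul' := fun c x => by rw [Matrix.mul_smul, map_smul]; rfl }
    have sl₂ : Function.Surjective l₂ := by
      intro y
      obtain ⟨Y, hY⟩ := s2 y
      refine ⟨a⁻¹ * Y, ?_⟩
      change L2 (a * (a⁻¹ * Y)) = y
      rw [← Matrix.mul_assoc, Matrix.mul_nonsing_inv _ hu, Matrix.one_mul, hY]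
    obtain ⟨Y, y1, y2⟩ := hY (Matrix κ ι K) L1 l₂ (L2 (b * C')) s1 sl₂
    refine ⟨fromBlocks A (a * Y + b * C') 0 A', fromBlocks C Y 0 C', ?_, ?_, ?_⟩
    · rw [fromBlocks_multiply, hA, hA']; simp
    · refine cyc_block m1 n1 d1 e1 h1 y2 c1 ?_
      rw [hL2, map_add]; rfl
    · exact cyc_block m2 n2 d2 e2 h2 y1 c2 (hL1 Y)

end link


section Geom
variable {K : Type u} [Field K] {V : Type u} [AddCommGroup V] [Module K V]
  {ι κ : Type} [Fintype ι] [DecidableEq ι] [Fintype κ] [DecidableEq κ]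

/-- `M` is an isometry of the symplectic space `(V, ω)`. -/
structure Iso (ω : V →ₗ[K] V →ₗ[K] K) (M : V →ₗ[K] V) : Prop where
  alt : ∀ x, ω x x = 0
  nd : ∀ x, (∀ y, ω x y = 0) → x = 0
  iso : ∀ x y, ω (M x) (M y) = ω x y

lemma Iso.skew {ω : V →ₗ[K] V →ₗ[K] K} {M : V →ₗ[K] V} (H : Iso ω M) (x y : V) :
    ω y x = - ω x y := by
  have h := H.alt (x + y)
  simp only [map_add, LinearMap.add_apply, H.alt, zero_add, add_zero] at h
  linear_combination h

/-- Symplectic frames. -/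
structure Frame (ω : V →ₗ[K] V →ₗ[K] K) (e f : ι → V) : Prop where
  ee : ∀ i j, ω (e i) (e j) = 0
  ff : ∀ i j, ω (f i) (f j) = 0
  ef : ∀ i j, ω (e i) (f j) = if i = j then 1 else 0
  span : ∀ x, (∀ i, ω x (e i) = 0) → (∀ i, ω x (f i) = 0) → x = 0

/-- The isometry `M` has upper left block `a` in some symplectic frame. -/
def FrameMat (ω : V →ₗ[K] V →ₗ[K] K) (M : V →ₗ[K] V) (a : Matrix ι ι K) : Prop :=
  ∃ e f : ι → V, Frame ω e f ∧ ∀ i k, ω (M (e k)) (f i) = a i k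

lemma FrameMat.reindex {ω : V →ₗ[K] V →ₗ[K] K} {M : V →ₗ[K] V} {a : Matrix ι ι K}
    (h : FrameMat ω M a) (s : κ ≃ ι) : FrameMat ω M (a.submatrix s s) := by
  obtain ⟨e, f, hf, ha⟩ := h
  refine ⟨e ∘ s, f ∘ s, ⟨fun i j => hf.ee _ _, fun i j => hf.ff _ _, fun i j => ?_, ?_⟩,
    fun i k => ha _ _⟩
  · simp [hf.ef]
  · intro x h1 h2
    refine hf.span x (fun i => ?_) (fun i => ?_)
    · simpa using h1 (s.symm i)
    · simpa using h2 (s.symm i)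

lemma Frame.finrank {ω : V →ₗ[K] V →ₗ[K] K} {M : V →ₗ[K] V} (H : Iso ω M) {e f : ι → V}
    (h : Frame ω e f) : Module.finrank K V = 2 * Fintype.card ι := by
  let L : V →ₗ[K] (ι ⊕ ι → K) := LinearMap.pi (Sum.elim (fun i => ω.flip (e i)) (fun i => ω.flip (f i)))
  have hL1 : ∀ x i, L x (Sum.inl i) = ω x (e i) := fun x i => rfl
  have hL2 : ∀ x i, L x (Sum.inr i) = ω x (f i) := fun x i => rfl
  have inj : Function.Injective L := by
    rw [← LinearMap.ker_eq_bot, LinearMap.ker_eq_bot']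
    intro x hx
    refine h.span x (fun i => ?_) (fun i => ?_)
    · rw [← hL1, hx]; rfl
    · rw [← hL2, hx]; rfl
  have surj : Function.Surjective L := by
    intro c
    refine ⟨∑ i, c (Sum.inr i) • e i - ∑ i, c (Sum.inl i) • f i, ?_⟩
    funext j
    rcases j with j | j
    · rw [hL1]
      simp [h.ee, H.skew (e j) (f _), h.ef]
    · rw [hL2]
      simp [h.ff, h.ef]
  rw [(LinearEquiv.ofBijective L ⟨inj, surj⟩).finrank_eq]
  simp [two_mul]

lemma peel [FiniteDimensional K V] {ω : V →ₗ[K] V →ₗ[K] K} {M : V →ₗ[K] V} (H : Iso ω M)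
    (e : κ → V) (he : ∀ i j, ω (e i) (e j) = 0) (F : Matrix κ κ K)
    (hF : ∀ i j, ω (M (e i)) (e j) = F i j) (hdet : IsUnit F.det) :
    ∃ (W : Submodule K V) (ω₁ : W →ₗ[K] W →ₗ[K] K) (M₁ : W →ₗ[K] W) (ψ : κ → W →ₗ[K] K),
      Iso ω₁ M₁ ∧ Module.finrank K V = 2 * Fintype.card κ + Module.finrank K W ∧
      (∀ x y : W, ω₁ x y = ω x y) ∧ (∀ x y : W, ω₁ (M₁ x) y = ω (M x) y) ∧
      (∀ x : W, ∀ i, ω (e i) x = 0 ∧ ω (M (e i)) x = 0) ∧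
      (∀ (x : W) j, ∑ i, ψ i x * F i j = ω (M x) (e j)) ∧
      ∀ (ι : Type) [Fintype ι] [DecidableEq ι] (e' f' : ι → W), Frame ω₁ e' f' →
        ∀ a₁ : Matrix ι ι K, (∀ i k, ω₁ (M₁ (e' k)) (f' i) = a₁ i k) →
        ∀ a₀ : Matrix κ κ K, (F * a₀)ᵀ = F * a₀ →
        ∃ f, Frame ω (Sum.elim e (fun i => (e' i : V))) f ∧
          ∀ i k, ω (M (Sum.elim e (fun i => (e' i : V)) k)) (f i) =
            fromBlocks a₀ (a₀ * Matrix.of fun j k => ψ j (e' k)) 0 a₁ i k := by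
  have sk := H.skew
  have FI : F * F⁻¹ = 1 := Matrix.mul_nonsing_inv _ hdet
  have IF : F⁻¹ * F = 1 := Matrix.nonsing_inv_mul _ hdet
  have FI' : ∀ i j, ∑ k, F i k * F⁻¹ k j = (1 : Matrix κ κ K) i j := fun i j => by
    rw [← FI, Matrix.mul_apply]
  have IF' : ∀ i j, ∑ k, F⁻¹ i k * F k j = (1 : Matrix κ κ K) i j := fun i j => by
    rw [← IF, Matrix.mul_apply]
  have hF' : ∀ i j, ω (e j) (M (e i)) = - F i j := fun i j => by rw [sk (M (e i)), hF]
  let L : V →ₗ[K] (κ ⊕ κ → K) :=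
    LinearMap.pi (Sum.elim (fun i => ω.flip (e i)) (fun i => ω.flip (M (e i))))
  have hL1 : ∀ x i, L x (Sum.inl i) = ω x (e i) := fun x i => rfl
  have hL2 : ∀ x i, L x (Sum.inr i) = ω x (M (e i)) := fun x i => rfl
  -- a section of L
  have sec : ∀ c d : κ → K, ∃ s : V, (∃ α β : κ → K, s = ∑ i, α i • e i + ∑ i, β i • M (e i)) ∧
      (∀ j, ω s (e j) = c j) ∧ ∀ j, ω s (M (e j)) = d j := by
    intro c d
    refine ⟨_, ⟨fun i => - ∑ k, F⁻¹ i k * d k, fun i => ∑ k, c k * F⁻¹ k i, rfl⟩, ?_, ?_⟩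
    · intro j
      simp only [map_add, map_sum, map_smul, LinearMap.add_apply, LinearMap.sum_apply,
        LinearMap.smul_apply, he, hF, smul_eq_mul, mul_zero, Finset.sum_const_zero, zero_add]
      simp only [Finset.sum_mul, mul_assoc]
      rw [Finset.sum_comm]
      simp only [← Finset.mul_sum, IF']
      simp [Matrix.one_apply]
    · intro j
      simp only [map_add, map_sum, map_smul, LinearMap.add_apply, LinearMap.sum_apply,
        LinearMap.smul_apply, hF', H.iso, he, smul_eq_mul, mul_zero, Finset.sum_const_zero,
        add_zero]
      simp only [neg_mul_neg, Finset.sum_mul]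
      rw [Finset.sum_comm]
      have : ∀ y, ∑ x, F⁻¹ x y * d y * F j x = d y * (1 : Matrix κ κ K) j y := fun y => by
        rw [← FI', Finset.mul_sum]; exact Finset.sum_congr rfl fun _ _ => by ring
      simp only [this]
      simp [Matrix.one_apply]
  let W : Submodule K V := LinearMap.ker L
  have hW : ∀ x : V, x ∈ W ↔ ∀ i, ω x (e i) = 0 ∧ ω x (M (e i)) = 0 := by
    intro x
    rw [LinearMap.mem_ker]
    constructor
    · intro h i
      exact ⟨by rw [← hL1, h]; rfl, by rw [← hL2, h]; rfl⟩
    · intro h; funext j; rcases j with j | j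
      · exact (h j).1
      · exact (h j).2
  have hrank : Module.finrank K V = 2 * Fintype.card κ + Module.finrank K W := by
    have hs : Function.Surjective L := by
      intro c
      obtain ⟨s, -, h1, h2⟩ := sec (fun i => c (Sum.inl i)) (fun i => c (Sum.inr i))
      refine ⟨s, ?_⟩
      funext j; rcases j with j | j
      · rw [hL1, h1]
      · rw [hL2, h2]
    rw [← LinearMap.finrank_range_add_finrank_ker L, LinearMap.range_eq_top.2 hs, finrank_top]
    simp [two_mul, W]
  let ψ₀ : κ → V →ₗ[K] K := fun i => ∑ j, F⁻¹ j i • (ω.flip (e j)).comp M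
  have hψ₀ : ∀ x i, ψ₀ i x = ∑ j, F⁻¹ j i * ω (M x) (e j) := by
    intro x i; simp [ψ₀]
  have hψ₁ : ∀ x j, ∑ i, ψ₀ i x * F i j = ω (M x) (e j) := by
    intro x j
    simp only [hψ₀, Finset.sum_mul]
    rw [Finset.sum_comm]
    have : ∀ y, ∑ i, F⁻¹ y i * ω (M x) (e y) * F i j
        = ω (M x) (e y) * (1 : Matrix κ κ K) y j := fun y => by
      rw [← IF', Finset.mul_sum]; exact Finset.sum_congr rfl fun _ _ => by ring
    simp only [this]
    simp [Matrix.one_apply]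
  let M₀ : V →ₗ[K] V := M - ∑ i, (ψ₀ i).smulRight (M (e i))
  have hM₀ : ∀ x, M₀ x = M x - ∑ i, ψ₀ i x • M (e i) := by intro x; simp [M₀]
  have hM₀W : ∀ x ∈ W, M₀ x ∈ W := by
    intro x hx
    rw [hW] at hx ⊢
    intro j
    rw [hM₀]
    simp only [map_sub, map_sum, map_smul, LinearMap.sub_apply, LinearMap.sum_apply,
      LinearMap.smul_apply, hF, H.iso, smul_eq_mul, hψ₁, he, (hx j).1]
    simp
  let M₁ : W →ₗ[K] W := M₀.restrict hM₀W
  have hM₁ : ∀ x : W, ((M₁ x : W) : V) = M x - ∑ i, ψ₀ i x • M (e i) := fun x => hM₀ x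
  let ω₁ : W →ₗ[K] W →ₗ[K] K := ω.compl₁₂ W.subtype W.subtype
  have hω₁ : ∀ x y : W, ω₁ x y = ω x y := fun x y => rfl
  have hperp : ∀ x : W, ∀ i, ω (e i) x = 0 ∧ ω (M (e i)) x = 0 := by
    intro x i
    have := (hW x).1 x.2 i
    rw [sk x (e i), sk x (M (e i)), this.1, this.2]; simp
  have hM₁ω : ∀ x y : W, ω₁ (M₁ x) y = ω (M x) y := by
    intro x y
    rw [hω₁, hM₁]
    simp only [map_sub, map_sum, map_smul, LinearMap.sub_apply, LinearMap.sum_apply,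
      LinearMap.smul_apply, (hperp y _).2]
    simp
  have HI : Iso ω₁ M₁ := by
    refine ⟨fun x => H.alt x, ?_, ?_⟩
    · intro x hx
      apply Subtype.ext
      refine H.nd x fun v => ?_
      obtain ⟨s, ⟨α, β, hs⟩, h1, h2⟩ := sec (fun j => ω v (e j)) (fun j => ω v (M (e j)))
      have hv : v - s ∈ W := by
        rw [hW]; intro i
        rw [map_sub, LinearMap.sub_apply, LinearMap.sub_apply, h1, h2]; simp
      have hxs : ω (x : V) s = 0 := by
        have hx' := (hW x).1 x.2
        rw [hs]; simp [(hx' _).1, (hx' _).2]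
      have := hx ⟨v - s, hv⟩
      rw [hω₁] at this
      simp only [map_sub, hxs, sub_zero] at this
      exact this
    · intro x y
      rw [hω₁, hω₁]
      have : ∀ x : W, ((M₁ x : W) : V) = M (x - ∑ i, ψ₀ i x • e i) := by
        intro x; rw [hM₁]; simp
      rw [this x, this y, H.iso]
      have hx' := (hW x).1 x.2
      simp [(hx' _).1, (hperp y _).1, he]
  refine ⟨W, ω₁, M₁, fun i => (ψ₀ i).comp W.subtype, HI, hrank, hω₁, hM₁ω, hperp,
    fun x j => hψ₁ x j, ?_⟩
  intro ι _ _ e' f' hfr a₁ ha₁ a₀ hS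
  let g : κ → V := fun j => M (e j) - ∑ l, a₀ l j • e l
  let f₀ : κ → V := fun k => - ∑ j, F⁻¹ k j • g j
  have hS' : ∀ i j, (F * a₀) i j = (F * a₀) j i := fun i j => congrFun (congrFun hS j) i
  have eg : ∀ i j, ω (e i) (g j) = - F j i := by
    intro i j; simp [g, he, hF']
  have Meg : ∀ i j, ω (M (e i)) (g j) = - (F * a₀) i j := by
    intro i j; simp only [g, map_sub, map_sum, map_smul, H.iso, he, hF, smul_eq_mul,
      Matrix.mul_apply, zero_sub]
    congr 1; exact Finset.sum_congr rfl fun _ _ => mul_comm _ _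
  have gg : ∀ i j, ω (g i) (g j) = 0 := by
    intro i j
    have : ω (g i) (g j) = ω (M (e i)) (g j) - ∑ l, a₀ l i * ω (e l) (g j) := by
      conv_lhs => rw [show g i = M (e i) - ∑ l, a₀ l i • e l from rfl]
      simp
    rw [this, Meg, hS']
    simp only [eg, Matrix.mul_apply]
    simp [mul_comm]
  have ef₀ : ∀ i k, ω (e i) (f₀ k) = if i = k then 1 else 0 := by
    intro i k
    simp only [f₀, map_neg, map_sum, map_smul, eg, smul_eq_mul, mul_neg, Finset.sum_neg_distrib,
      neg_neg, IF', Matrix.one_apply]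
    simp [eq_comm]
  have ff₀ : ∀ i k, ω (f₀ i) (f₀ k) = 0 := by
    intro i k; simp [f₀, gg]
  have Mf₀ : ∀ i k, ω (M (e i)) (f₀ k) = a₀ k i := by
    intro i k
    have : a₀ k i = (F⁻¹ * (F * a₀)) k i := by rw [← Matrix.mul_assoc, IF, Matrix.one_mul]
    rw [this, Matrix.mul_apply]
    simp only [f₀, map_neg, map_sum, map_smul, Meg, smul_eq_mul, mul_neg, Finset.sum_neg_distrib,
      neg_neg]
    exact Finset.sum_congr rfl fun j _ => by rw [hS']
  have Wf₀ : ∀ (x : W) k, ω (x : V) (f₀ k) = 0 := by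
    intro x k
    have hx' := (hW x).1 x.2
    simp [f₀, g, (hx' _).1, (hx' _).2]
  have f₀W : ∀ (x : W) k, ω (f₀ k) (x : V) = 0 := by
    intro x k; rw [sk x, Wf₀, neg_zero]
  have We : ∀ (x : W) k, ω (x : V) (e k) = 0 := fun x k => ((hW x).1 x.2 k).1
  refine ⟨Sum.elim f₀ (fun i => (f' i : V)), ⟨?_, ?_, ?_, ?_⟩, ?_⟩
  · rintro (i | i) (j | j)
    · exact he _ _
    · exact (hperp _ _).1
    · exact We _ _
    · exact hfr.ee _ _
  · rintro (i | i) (j | j)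
    · exact ff₀ _ _
    · exact f₀W _ _
    · exact Wf₀ _ _
    · exact hfr.ff _ _
  · rintro (i | i) (j | j)
    · simpa using ef₀ i j
    · simpa using (hperp _ _).1
    · simpa using Wf₀ _ _
    · have h := hfr.ef i j
      rw [hω₁] at h
      simpa using h
  · intro x h1 h2
    have hg : ∀ j, ω x (g j) = 0 := by
      intro j
      have : g j = - ∑ k, F j k • f₀ k := by
        simp only [f₀, smul_neg, Finset.sum_neg_distrib, neg_neg, Finset.smul_sum, smul_smul]
        rw [Finset.sum_comm]
        simp only [← Finset.sum_smul, FI', Matrix.one_apply]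
        simp
      rw [this]
      have := fun k => h2 (Sum.inl k)
      simp only [Sum.elim_inl] at this
      simp [this]
    have hxe : ∀ i, ω x (e i) = 0 := fun i => h1 (Sum.inl i)
    have hxW : x ∈ W := by
      rw [hW]; intro i
      refine ⟨hxe i, ?_⟩
      have := hg i
      simpa [g, hxe] using this
    have := hfr.span ⟨x, hxW⟩ (fun i => h1 (Sum.inr i)) (fun i => h2 (Sum.inr i))
    exact congrArg Subtype.val this
  · rintro (i | i) (k | k)
    · simpa using Mf₀ k i
    · have : M (e' k : V) = (M₁ (e' k) : V) + ∑ i, ψ₀ i (e' k) • M (e i) := by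
        rw [hM₁]; abel
      simp only [Sum.elim_inl, Sum.elim_inr, this, fromBlocks_apply₁₂, Matrix.mul_apply]
      simp [Wf₀, Mf₀, mul_comm]
    · simpa using (hperp (f' i) k).2
    · simp only [Sum.elim_inr, fromBlocks_apply₂₂]
      rw [← hM₁ω, ha₁]

end Geom


section Geom2
variable {K : Type u} [Field K]

lemma exists_frame (m : ℕ) : ∀ (V : Type u) [AddCommGroup V] [Module K V] [FiniteDimensional K V]
    (ω : V →ₗ[K] V →ₗ[K] K) (M : V →ₗ[K] V) (_ : Iso ω M) (_ : Module.finrank K V = 2 * m)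
    (ψ : V →ₗ[K] K), ∃ (ι : Type) (_ : Fintype ι) (_ : DecidableEq ι) (e f : ι → V),
      Frame ω e f ∧ ∀ i, ψ (e i) = 0 := by
  induction m with
  | zero =>
    intro V _ _ _ ω M H hr ψ
    refine ⟨Empty, inferInstance, inferInstance, Empty.elim, Empty.elim,
      ⟨fun i => i.elim, fun i => i.elim, fun i => i.elim, fun x _ _ => ?_⟩, fun i => i.elim⟩
    have : Subsingleton V := Module.finrank_zero_iff.1 (by omega)
    exact Subsingleton.elim _ _
  | succ m ih =>
    intro V _ _ _ ω M H hr ψ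
    obtain ⟨e, hψe, he0⟩ : ∃ e, ψ e = 0 ∧ e ≠ 0 := by
      have h1 := LinearMap.finrank_range_add_finrank_ker ψ
      have h2 : Module.finrank K (LinearMap.range ψ) ≤ 1 := by
        simpa using Submodule.finrank_le (LinearMap.range ψ)
      have : 0 < Module.finrank K (LinearMap.ker ψ) := by omega
      have := Module.finrank_pos_iff.1 this
      obtain ⟨x, hx⟩ := exists_ne (0 : LinearMap.ker ψ)
      exact ⟨x, x.2, fun h => hx (Subtype.ext h)⟩
    obtain ⟨f, hf⟩ : ∃ f, ω e f ≠ 0 := by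
      by_contra! h; exact he0 (H.nd e h)
    let M0 : V →ₗ[K] V := LinearMap.id + (ω.flip f).smulRight f
    have hM0 : ∀ x, M0 x = x + ω x f • f := fun x => by simp [M0]
    have H0 : Iso ω M0 := by
      refine ⟨H.alt, H.nd, fun x y => ?_⟩
      rw [hM0, hM0]
      simp only [map_add, map_smul, LinearMap.add_apply, LinearMap.smul_apply, H.alt, smul_eq_mul]
      rw [H.skew y f]; ring
    obtain ⟨W, ω₁, M₁, ψ₁, HI, hrank, hω, hMω, hp, -, hfr⟩ := peel H0 (fun _ : Unit => e)
      (fun _ _ => H.alt _) (Matrix.of fun _ _ => ω (M0 e) e) (fun _ _ => rfl) (by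
        rw [isUnit_iff_ne_zero]
        simp [hM0, H.alt, H.skew e f, hf])
    obtain ⟨ι, _, _, e', f', hF, hψ'⟩ := ih W ω₁ M₁ HI (by simp at hrank; omega)
      (ψ.comp W.subtype)
    obtain ⟨f'', hF'', -⟩ := hfr ι e' f' hF (Matrix.of fun i k => ω₁ (M₁ (e' k)) (f' i))
      (fun _ _ => rfl) 0 (by simp)
    refine ⟨Unit ⊕ ι, inferInstance, inferInstance, _, f'', hF'', ?_⟩
    rintro (i | i)
    · exact hψe
    · exact hψ' i

variable {V : Type u} [AddCommGroup V] [Module K V] 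

lemma trichotomy {ω : V →ₗ[K] V →ₗ[K] K} {M : V →ₗ[K] V} (H : Iso ω M) :
    (∃ e, ω (M e) e ≠ 0) ∨
    (∀ x, ω (M x) x = 0) ∧ ((∃ x y t, ω x y = 0 ∧ ω (M x) x = 0 ∧ ω (M y) y = 0 ∧ ω (M x) y = t ∧
      ω (M y) x = - t ∧ t ≠ 0) ∨
    (∃ ε : K, (ε = 1 ∨ ε = -1) ∧ ∀ x, M x = ε • x)) := by
  by_cases h : ∃ e, ω (M e) e ≠ 0
  · exact Or.inl h
  push Not at h
  refine Or.inr ⟨h, ?_⟩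
  have sk : ∀ x y, ω (M y) x = - ω (M x) y := by
    intro x y
    have := h (x + y)
    simp only [map_add, LinearMap.add_apply, h, zero_add, add_zero] at this
    linear_combination this
  by_cases h2 : ∃ x y, ω x y = 0 ∧ ω (M x) y ≠ 0
  · obtain ⟨x, y, hxy, hne⟩ := h2
    exact Or.inl ⟨x, y, _, hxy, h x, h y, rfl, sk x y, hne⟩
  push Not at h2
  right
  have hM : ∀ x, ∃ c : K, M x = c • x := by
    intro x
    obtain ⟨c, hc⟩ : ∃ c : K, ω (M x) = c • ω x := by
      by_cases hx : ∃ z, ω x z ≠ 0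
      · obtain ⟨z, hz⟩ := hx
        refine ⟨ω (M x) z / ω x z, ?_⟩
        ext y
        have := h2 x (y - (ω x y / ω x z) • z) (by simp [hz])
        simp only [map_sub, map_smul, smul_eq_mul] at this
        simp only [LinearMap.smul_apply, smul_eq_mul]
        linear_combination this
      · push Not at hx
        refine ⟨0, ?_⟩
        ext y
        have := h2 x y (hx y)
        simpa using this
    refine ⟨c, ?_⟩
    have : M x - c • x = 0 := H.nd _ fun y => by simp [hc]
    exact sub_eq_zero.1 this
  obtain ⟨ε, hε⟩ := LinearMap.exists_eq_smul_id_of_forall_notLinearIndependent (f := M) (by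
    intro v hv
    obtain ⟨c, hc⟩ := hM v
    rw [LinearIndependent.pair_iff] at hv
    have := (hv c (-1) (by rw [hc]; simp)).2
    simp at this)
  have hε' : ∀ x, M x = ε • x := fun x => by rw [hε]; simp
  by_cases hz : ∃ x y, ω x y ≠ 0
  · obtain ⟨x, y, hxy⟩ := hz
    have := H.iso x y
    simp only [hε', map_smul, LinearMap.smul_apply, smul_eq_mul] at this
    have h3 : (ε - 1) * (ε + 1) = 0 := by
      have : ((ε - 1) * (ε + 1)) * ω x y = 0 := by linear_combination this
      exact (mul_eq_zero.1 this).resolve_right hxy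
    refine ⟨ε, ?_, hε'⟩
    rcases mul_eq_zero.1 h3 with h | h
    · left; linear_combination h
    · right; linear_combination h
  · push Not at hz
    refine ⟨1, Or.inl rfl, fun x => ?_⟩
    rw [H.nd x (hz x), map_zero, smul_zero]

/-- `M` admits a frame whose upper left block is `Good p q`. -/
def HasGood (ω : V →ₗ[K] V →ₗ[K] K) (M : V →ₗ[K] V) (p q : K[X]) : Prop :=
  ∃ (ι : Type) (_ : Fintype ι) (_ : DecidableEq ι) (a : Matrix ι ι K),
    FrameMat ω M a ∧ Good p q a

lemma frameMat_scalar [FiniteDimensional K V] {ω : V →ₗ[K] V →ₗ[K] K} {M : V →ₗ[K] V}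
    (H : Iso ω M) {m : ℕ}
    (hr : Module.finrank K V = 2 * m) {ε : K} (hε : ∀ x, M x = ε • x) (ψ : V →ₗ[K] K) :
    ∃ e f : Fin m → V, Frame ω e f ∧ (∀ i k, ω (M (e k)) (f i) = (ε • (1 : Matrix (Fin m) (Fin m) K)) i k) ∧
      ∀ i, ψ (e i) = 0 := by
  obtain ⟨ι, _, _, e, f, hF, hψ⟩ := exists_frame m V ω M H hr ψ
  have hc := hF.finrank H
  have hcard : Fintype.card ι = Fintype.card (Fin m) := by simp; omega
  let s := Fintype.equivOfCardEq hcard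
  refine ⟨e ∘ s.symm, f ∘ s.symm, ⟨fun i j => hF.ee _ _, fun i j => hF.ff _ _, fun i j => ?_, ?_⟩, ?_,
    fun i => hψ _⟩
  · simp [hF.ef]
  · intro x h1 h2
    refine hF.span x (fun i => ?_) (fun i => ?_)
    · simpa using h1 (s i)
    · simpa using h2 (s i)
  · intro i k
    simp [hε, hF.ef, Matrix.one_apply, eq_comm]

end Geom2


section Assembly
variable {K : Type u} [Field K] {n : ℕ}

abbrev SM (n : ℕ) (K : Type u) := Matrix (Fin n ⊕ Fin n) (Fin n ⊕ Fin n) K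

lemma symp_iff (P : SM n K) : IsSymplectic P ↔ P ∈ symplecticGroup (Fin n) K := by
  rw [SymplecticGroup.mem_iff]
  have : sympJ n K = - Matrix.J (Fin n) K := by
    rw [sympJ, Matrix.J, Matrix.fromBlocks_neg]; simp
  rw [IsSymplectic, this]; simp

lemma symp_mul {P Q : SM n K} (hP : IsSymplectic P) (hQ : IsSymplectic Q) :
    IsSymplectic (P * Q) := by
  rw [symp_iff] at *; exact mul_mem hP hQ

lemma symp_det {P : SM n K} (hP : IsSymplectic P) : IsUnit P.det := by
  rw [symp_iff] at hP; exact SymplecticGroup.symplectic_det hP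

lemma symp_inv {P : SM n K} (hP : IsSymplectic P) : IsSymplectic P⁻¹ := by
  have hd := symp_det hP
  have h1 : P⁻¹ * P = 1 := Matrix.nonsing_inv_mul _ hd
  have h2 : Pᵀ * P⁻¹ᵀ = 1 := by rw [← Matrix.transpose_mul, h1, Matrix.transpose_one]
  unfold IsSymplectic at *
  calc P⁻¹ * sympJ n K * P⁻¹ᵀ = P⁻¹ * (P * sympJ n K * Pᵀ) * P⁻¹ᵀ := by rw [hP]
    _ = (P⁻¹ * P) * sympJ n K * (Pᵀ * P⁻¹ᵀ) := by simp only [Matrix.mul_assoc]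
    _ = _ := by rw [h1, h2]; simp

lemma symp_J : IsSymplectic (sympJ n K) := by
  simp [IsSymplectic, sympJ, Matrix.fromBlocks_transpose, Matrix.fromBlocks_multiply]

lemma symp_blocks (a b c d : Matrix (Fin n) (Fin n) K) :
    IsSymplectic (fromBlocks a b c d) ↔
      a * bᵀ = b * aᵀ ∧ a * dᵀ - b * cᵀ = 1 ∧ c * dᵀ = d * cᵀ := by
  unfold IsSymplectic sympJ
  rw [Matrix.fromBlocks_transpose, Matrix.fromBlocks_multiply, Matrix.fromBlocks_multiply,
    Matrix.fromBlocks_inj]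
  simp only [mul_zero, mul_one, mul_neg, zero_add, add_zero, Matrix.neg_mul]
  constructor
  · rintro ⟨h1, h2, h3, h4⟩
    refine ⟨?_, ?_, ?_⟩
    · rw [neg_add_eq_zero] at h1; exact h1.symm
    · rw [← h2]; abel
    · rw [neg_add_eq_zero] at h4; exact h4.symm
  · rintro ⟨h1, h2, h3⟩
    refine ⟨by rw [h1]; abel, by rw [← h2]; abel, ?_, by rw [h3]; abel⟩
    have := congrArg Matrix.transpose h2
    simp only [Matrix.transpose_sub, Matrix.transpose_mul, Matrix.transpose_transpose,
      Matrix.transpose_one] at this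
    rw [← this]; abel

/-- Symplectic conjugacy. -/
def SC (P M : SM n K) : Prop := ∃ S, IsSymplectic S ∧ M = S * P * S⁻¹

lemma SC.conj {P M R : SM n K} (h : SC P M) (hR : IsSymplectic R) : SC P (R * M * R⁻¹) := by
  obtain ⟨S, hS, rfl⟩ := h
  exact ⟨R * S, symp_mul hR hS, by rw [Matrix.mul_inv_rev]; simp only [Matrix.mul_assoc]⟩

lemma SC.trans {P M N : SM n K} (h : SC P M) (h' : SC M N) : SC P N := by
  obtain ⟨R, hR, rfl⟩ := h'
  exact h.conj hR

lemma sc_of_intertwine {P M S : SM n K} (hS : IsSymplectic S) (h : S * P = M * S) : SC P M := by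
  refine ⟨S, hS, ?_⟩
  rw [h, Matrix.mul_assoc, Matrix.mul_nonsing_inv _ (symp_det hS), Matrix.mul_one]

/-- The diagonal block embedding. -/
def dg (A B : Matrix (Fin n) (Fin n) K) : SM n K := fromBlocks A 0 0 B

lemma symp_dg {A B : Matrix (Fin n) (Fin n) K} (h : A * Bᵀ = 1) : IsSymplectic (dg A B) := by
  rw [dg, symp_blocks]; simp [h]

lemma sc_swap (A B : Matrix (Fin n) (Fin n) K) : SC (dg A B) (dg B A) := by
  apply sc_of_intertwine (symp_J (n := n) (K := K))
  simp [dg, sympJ, Matrix.fromBlocks_multiply]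

lemma sc_dg_similar {A B A' B' P Q : Matrix (Fin n) (Fin n) K} (h1 : P * Q = 1)
    (hA : A * Bᵀ = 1) (hA' : A' * B'ᵀ = 1) (h : P * A * Q = A') : SC (dg A B) (dg A' B') := by
  have h2 : Q * P = 1 := mul_eq_one_comm.1 h1
  apply sc_of_intertwine (S := dg P Qᵀ) (symp_dg (by simpa using h1))
  simp only [dg, Matrix.fromBlocks_multiply]
  simp only [Matrix.zero_mul, Matrix.mul_zero, add_zero, zero_add]
  congr 1
  · rw [← h, Matrix.mul_assoc, h2, Matrix.mul_one]
  · have e1 : B'ᵀ = P * Bᵀ * Q := by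
      have hB : Bᵀ * A = 1 := mul_eq_one_comm.1 hA
      have : (P * Bᵀ * Q) * A' = 1 := by
        rw [← h]
        calc P * Bᵀ * Q * (P * A * Q) = P * Bᵀ * (Q * P) * A * Q := by
              simp only [Matrix.mul_assoc]
          _ = P * (Bᵀ * A) * Q := by rw [h2]; simp only [Matrix.mul_assoc, Matrix.mul_one, Matrix.one_mul]
          _ = 1 := by rw [hB, Matrix.mul_one, h1]
      calc B'ᵀ = (P * Bᵀ * Q) * A' * B'ᵀ := by rw [this, Matrix.one_mul]
        _ = _ := by rw [Matrix.mul_assoc, hA', Matrix.mul_one]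
    have e2 : B' = Qᵀ * B * Pᵀ := by
      have := congrArg Matrix.transpose e1
      simpa [Matrix.mul_assoc] using this
    rw [e2, Matrix.mul_assoc _ Pᵀ, ← Matrix.transpose_mul, h2, Matrix.transpose_one, Matrix.mul_one]

lemma aeval_diag {ι κ : Type} [Fintype ι] [DecidableEq ι] [Fintype κ] [DecidableEq κ]
    (D : Matrix ι ι K) (E : Matrix κ κ K) (r : K[X]) :
    aeval (fromBlocks D 0 0 E) r = fromBlocks (aeval D r) 0 0 (aeval E r) := by
  induction r using Polynomial.induction_on with
  | C a =>
    simp only [aeval_C, Algebra.algebraMap_eq_smul_one, ← Matrix.fromBlocks_one,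
      Matrix.fromBlocks_smul, smul_zero]
  | add p q hp hq => rw [map_add, map_add, map_add, hp, hq, Matrix.fromBlocks_add]; simp
  | monomial m a h =>
    rw [pow_succ, ← mul_assoc, map_mul, h, map_mul _ (_ * _), map_mul _ (_ * _), aeval_X, aeval_X,
      aeval_X, Matrix.fromBlocks_multiply]
    simp

lemma cyc_diag {ι κ : Type} [Fintype ι] [DecidableEq ι] [Fintype κ] [DecidableEq κ]
    {D : Matrix ι ι K} {E : Matrix κ κ K} {p₁ p₂ : K[X]} (h1 : Cyc D p₁) (h2 : Cyc E p₂)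
    (hc : IsCoprime p₁ p₂) : Cyc (fromBlocks D 0 0 E) (p₁ * p₂) := by
  have a1 := h1.aeval
  have a2 := h2.aeval
  obtain ⟨m1, d1, v1, -, c1⟩ := h1
  obtain ⟨m2, d2, v2, -, c2⟩ := h2
  obtain ⟨u, v, huv⟩ := hc
  refine ⟨m1.mul m2, by rw [m1.natDegree_mul m2, d1, d2, Fintype.card_sum], Sum.elim v1 v2, ?_, ?_⟩
  · rw [aeval_diag]; simp [a1, a2]
  · intro w
    obtain ⟨r1, hr1⟩ := c1 (w ∘ Sum.inl)
    obtain ⟨r2, hr2⟩ := c2 (w ∘ Sum.inr)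
    refine ⟨r1 * (v * p₂) + r2 * (u * p₁), ?_⟩
    have e1 : aeval D v * aeval D p₂ = 1 := by
      have := congrArg (aeval D) huv
      simpa [a1] using this
    have e2 : aeval E u * aeval E p₁ = 1 := by
      have := congrArg (aeval E) huv
      simpa [a2] using this
    rw [aeval_diag]
    simp only [map_add, map_mul, e1, e2, a1, a2, mul_zero, mul_one, add_zero, zero_add,
      Matrix.fromBlocks_mulVec, Matrix.zero_mulVec, Sum.elim_comp_inl, Sum.elim_comp_inr, hr1, hr2]
    exact Sum.elim_comp_inl_inr w

lemma upper_conj {Y W T : Matrix (Fin n) (Fin n) K} {p₁ p₂ : K[X]} (hY : Cyc Y p₁) (hT : Cyc T p₂)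
    (hc : IsCoprime p₁ p₂) (hS : IsSymplectic (fromBlocks Y W 0 T)) :
    Y * Tᵀ = 1 ∧ SC (dg Y T) (fromBlocks Y W 0 T) := by
  obtain ⟨h1, h2, -⟩ := (symp_blocks _ _ _ _).1 hS
  simp only [Matrix.transpose_zero, Matrix.mul_zero, sub_zero] at h2
  refine ⟨h2, ?_⟩
  have h2' : T * Yᵀ = 1 := by
    have := congrArg Matrix.transpose h2
    simpa using this
  have h2'' : Yᵀ * T = 1 := mul_eq_one_comm.1 h2'
  let Φ : Matrix (Fin n) (Fin n) K →ₗ[K] Matrix (Fin n) (Fin n) K :=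
    LinearMap.mulRight K T - LinearMap.mulLeft K Y
  have hΦ : ∀ X, Φ X = X * T - Y * X := fun X => by simp [Φ]
  have key : ∀ X, X * T = Y * X → X = 0 := by
    intro X hX
    have e1 := aeval_intertwine hX p₁
    rw [hY.aeval, Matrix.zero_mul] at e1
    obtain ⟨u, v, huv⟩ := hc
    have : aeval T p₁ * aeval T u = 1 := by
      rw [← map_mul, mul_comm]
      have := congrArg (aeval T) huv
      rw [map_add, map_mul _ v, hT.aeval, mul_zero, add_zero, map_one] at this
      exact this
    calc X = X * (aeval T p₁ * aeval T u) := by rw [this, Matrix.mul_one]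
      _ = 0 := by rw [← Matrix.mul_assoc, e1, Matrix.zero_mul]
  have inj : Function.Injective Φ := by
    rw [← LinearMap.ker_eq_bot, LinearMap.ker_eq_bot']
    intro X hX
    rw [hΦ, sub_eq_zero] at hX
    exact key X hX
  obtain ⟨X, hX⟩ := LinearMap.injective_iff_surjective.1 inj W
  rw [hΦ] at hX
  have hWY : W * Yᵀ = X - Y * X * Yᵀ := by
    rw [← hX, Matrix.sub_mul, Matrix.mul_assoc X, h2', Matrix.mul_one]
  have hsym : X - Xᵀ = 0 := by
    apply key
    have e2 : (W * Yᵀ)ᵀ = W * Yᵀ := by rw [Matrix.transpose_mul, Matrix.transpose_transpose, h1]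
    rw [hWY] at e2
    have e3 : Xᵀ - Y * Xᵀ * Yᵀ = X - Y * X * Yᵀ := by
      rw [← e2]; simp [Matrix.mul_assoc]
    have e4 : (X - Xᵀ) = Y * (X - Xᵀ) * Yᵀ := by
      rw [Matrix.mul_sub, Matrix.sub_mul]
      have : X - Xᵀ - (Y * X * Yᵀ - Y * Xᵀ * Yᵀ) = (X - Y * X * Yᵀ) - (Xᵀ - Y * Xᵀ * Yᵀ) := by abel
      rw [← sub_eq_zero, this, e3, sub_self]
    calc (X - Xᵀ) * T = Y * (X - Xᵀ) * Yᵀ * T := by rw [← e4]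
      _ = _ := by rw [Matrix.mul_assoc, h2'', Matrix.mul_one]
  have hX' : Xᵀ = X := (sub_eq_zero.1 hsym).symm
  apply sc_of_intertwine (S := fromBlocks 1 X 0 1)
  · rw [symp_blocks]; simp [hX']
  · simp only [dg, Matrix.fromBlocks_multiply]
    simp [← hX]

variable {q : K[X]}

lemma sc_class {C0 Y T : Matrix (Fin n) (Fin n) K} (hq0 : q.coeff 0 ≠ 0)
    (h0 : Cyc C0 q) (hYT : Y * Tᵀ = 1)
    (h : Cyc Y q ∨ Cyc T q) : SC (dg C0 (C0⁻¹)ᵀ) (dg Y T) := by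
  have hd := isUnit_of_cyc h0 hq0
  have hC : C0 * ((C0⁻¹)ᵀ)ᵀ = 1 := by simp [Matrix.mul_nonsing_inv _ hd]
  rcases h with h | h
  · obtain ⟨P, Q, h1, -, h3⟩ := h0.similar h
    exact sc_dg_similar h1 hC hYT h3
  · obtain ⟨P, Q, h1, -, h3⟩ := h0.similar h
    refine (sc_dg_similar h1 hC ?_ h3).trans (sc_swap T Y)
    have := congrArg Matrix.transpose hYT
    simpa using this

lemma upper_class {C0 Y W T : Matrix (Fin n) (Fin n) K} (hq0 : q.coeff 0 ≠ 0)
    (hc : IsCoprime q (recipPoly q)) (h0 : Cyc C0 q)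
    (hS : IsSymplectic (fromBlocks Y W 0 T))
    (h : (Cyc Y q ∧ Cyc T (recipPoly q)) ∨ (Cyc Y (recipPoly q) ∧ Cyc T q)) :
    SC (dg C0 (C0⁻¹)ᵀ) (fromBlocks Y W 0 T) := by
  rcases h with ⟨h1, h2⟩ | ⟨h1, h2⟩
  · obtain ⟨e, hs⟩ := upper_conj h1 h2 hc hS
    exact (sc_class hq0 h0 e (Or.inl h1)).trans hs
  · obtain ⟨e, hs⟩ := upper_conj h1 h2 hc.symm hS
    exact (sc_class hq0 h0 e (Or.inr h2)).trans hs

lemma factor {C0 a b c d A C : Matrix (Fin n) (Fin n) K} (hq0 : q.coeff 0 ≠ 0)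
    (hc : IsCoprime q (recipPoly q)) (h0 : Cyc C0 q)
    (hN : IsSymplectic (fromBlocks a b c d)) (hA : A = C * a) (cA : Cyc A q)
    (cC : Cyc C q ∨ Cyc C (recipPoly q)) :
    ∃ L U : SM n K, fromBlocks a b c d = L * U ∧ SC (dg C0 (C0⁻¹)ᵀ) L ∧
      SC (dg C0 (C0⁻¹)ᵀ) U := by
  have dA := isUnit_of_cyc cA hq0
  have d0 := isUnit_of_cyc h0 hq0
  have hq0' : (recipPoly q).coeff 0 ≠ 0 := by
    have h1 : q ≠ 0 := by rintro rfl; simp at hq0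
    simp [recipPoly, hq0, h1]
  have dC : IsUnit C.det := by
    rcases cC with h | h
    · exact isUnit_of_cyc h hq0
    · exact isUnit_of_cyc h hq0'
  have IC : C⁻¹ * C = 1 := Matrix.nonsing_inv_mul _ dC
  have CI : C * C⁻¹ = 1 := Matrix.mul_nonsing_inv _ dC
  have IA : A⁻¹ * A = 1 := Matrix.nonsing_inv_mul _ dA
  have AI : A * A⁻¹ = 1 := Matrix.mul_nonsing_inv _ dA
  have cCI : (Cyc C q ∧ Cyc C⁻¹ (recipPoly q)) ∨ (Cyc C (recipPoly q) ∧ Cyc C⁻¹ q) := by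
    rcases cC with h | h
    · exact Or.inl ⟨h, h.inv hq0⟩
    · right
      refine ⟨h, ?_⟩
      obtain ⟨P, Q, h1, h2, h3⟩ := (h0.inv hq0).similar h
      have : C⁻¹ = P * C0 * Q := by
        apply Matrix.inv_eq_right_inv
        rw [← h3]
        calc P * C0⁻¹ * Q * (P * C0 * Q) = P * C0⁻¹ * (Q * P) * C0 * Q := by
              simp only [Matrix.mul_assoc]
          _ = P * (C0⁻¹ * C0) * Q := by rw [h2]; simp only [Matrix.mul_assoc, Matrix.one_mul]
          _ = 1 := by rw [Matrix.nonsing_inv_mul _ d0, Matrix.mul_one, h1]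
      rw [this]; exact h0.conj h1 h2
  obtain ⟨e1, -, -⟩ := (symp_blocks _ _ _ _).1 hN
  let U : SM n K := fromBlocks A (C * b) 0 (A⁻¹)ᵀ
  have hU : IsSymplectic U := by
    rw [symp_blocks]
    refine ⟨?_, by simp [AI], by simp⟩
    rw [hA]
    calc C * a * (C * b)ᵀ = C * (a * bᵀ) * Cᵀ := by
          rw [Matrix.transpose_mul]; simp only [Matrix.mul_assoc]
      _ = _ := by rw [e1, Matrix.transpose_mul]; simp only [Matrix.mul_assoc]
  obtain ⟨L, hL⟩ : ∃ L, L = fromBlocks a b c d * U⁻¹ := ⟨_, rfl⟩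
  have hLs : IsSymplectic L := by rw [hL]; exact symp_mul hN (symp_inv hU)
  have hLU : L * U = fromBlocks a b c d := by
    rw [hL, Matrix.mul_assoc, Matrix.nonsing_inv_mul _ (symp_det hU), Matrix.mul_one]
  refine ⟨L, U, hLU.symm, ?_, ?_⟩
  · rw [← Matrix.fromBlocks_toBlocks L] at hLU hLs ⊢
    generalize L.toBlocks₁₁ = X at *
    generalize L.toBlocks₁₂ = Z at *
    generalize L.toBlocks₂₁ = R at *
    generalize L.toBlocks₂₂ = T at *
    simp only [U, Matrix.fromBlocks_multiply, Matrix.fromBlocks_inj, Matrix.mul_zero,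
      add_zero] at hLU
    obtain ⟨h1, h2, -, -⟩ := hLU
    have hX : X = C⁻¹ := by
      calc X = X * A * A⁻¹ := by rw [Matrix.mul_assoc, AI, Matrix.mul_one]
        _ = C⁻¹ * C * a * A⁻¹ := by rw [h1, IC, Matrix.one_mul]
        _ = C⁻¹ * (A * A⁻¹) := by rw [hA]; simp only [Matrix.mul_assoc]
        _ = _ := by rw [AI, Matrix.mul_one]
    have hZ : Z = 0 := by
      rw [hX, ← Matrix.mul_assoc, IC, Matrix.one_mul, add_eq_left] at h2
      have : A⁻¹ᵀ * Aᵀ = 1 := by rw [← Matrix.transpose_mul, AI, Matrix.transpose_one]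
      calc Z = Z * A⁻¹ᵀ * Aᵀ := by rw [Matrix.mul_assoc, this, Matrix.mul_one]
        _ = 0 := by rw [h2, Matrix.zero_mul]
    subst hX hZ
    obtain ⟨-, g2, -⟩ := (symp_blocks _ _ _ _).1 hLs
    simp only [Matrix.zero_mul, sub_zero] at g2
    have hT : T = Cᵀ := by
      have : Tᵀ = C := by
        calc Tᵀ = C * (C⁻¹ * Tᵀ) := by rw [← Matrix.mul_assoc, CI, Matrix.one_mul]
          _ = C := by rw [g2, Matrix.mul_one]
      rw [← this, Matrix.transpose_transpose]
    have hc2 : SC (fromBlocks T (-R) 0 C⁻¹) (fromBlocks C⁻¹ 0 R T) := by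
      have hJ : IsSymplectic (-sympJ n K) := by
        have := symp_J (n := n) (K := K)
        unfold IsSymplectic at *; simpa using this
      apply sc_of_intertwine hJ
      simp [sympJ, Matrix.fromBlocks_multiply, Matrix.fromBlocks_neg]
    refine SC.trans ?_ hc2
    refine upper_class hq0 hc h0 ?_ ?_
    · obtain ⟨S, hS, h⟩ := hc2
      have : fromBlocks T (-R) 0 C⁻¹ = S⁻¹ * fromBlocks C⁻¹ 0 R T * S := by
        have hd := symp_det hS
        have hI := Matrix.nonsing_inv_mul _ hd
        rw [h]
        calc _ = (S⁻¹ * S) * fromBlocks T (-R) 0 C⁻¹ * (S⁻¹ * S) := by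
              rw [hI, Matrix.one_mul, Matrix.mul_one]
          _ = _ := by simp only [Matrix.mul_assoc]
      rw [this]
      exact symp_mul (symp_mul (symp_inv hS) hLs) hS
    · rw [hT]
      rcases cCI with ⟨h, h'⟩ | ⟨h, h'⟩
      · exact Or.inl ⟨h.transpose, h'⟩
      · exact Or.inr ⟨h.transpose, h'⟩
  · exact upper_class hq0 hc h0 hU (Or.inl ⟨cA, (cA.inv hq0).transpose⟩)

/-- the standard form -/
def stdω (n : ℕ) (K : Type u) [Field K] :
    (Fin n ⊕ Fin n → K) →ₗ[K] (Fin n ⊕ Fin n → K) →ₗ[K] K :=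
  Matrix.toLinearMap₂' K (sympJ n K)

lemma stdω_apply (x y : Fin n ⊕ Fin n → K) : stdω n K x y = x ⬝ᵥ sympJ n K *ᵥ y := by
  rw [stdω, Matrix.toLinearMap₂'_apply']

lemma std_iso {M : SM n K} (hM : IsSymplectic M) : Iso (stdω n K) (Matrix.toLin' Mᵀ) := by
  refine ⟨fun x => ?_, fun x h => ?_, fun x y => ?_⟩
  · rw [stdω_apply, sympJ, Matrix.fromBlocks_mulVec]
    simp only [dotProduct, Fintype.sum_sum_type, Sum.elim_inl, Sum.elim_inr, Function.comp,
      Matrix.zero_mulVec, Matrix.one_mulVec, Matrix.neg_mulVec, Pi.add_apply, Pi.neg_apply,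
      Pi.zero_apply]
    rw [← Finset.sum_add_distrib]
    exact Finset.sum_eq_zero fun i _ => by ring
  · have h2 : x ᵥ* sympJ n K = 0 := by
      funext j
      have := h (Pi.single j 1)
      rw [stdω_apply, Matrix.dotProduct_mulVec] at this
      simpa using this
    have h3 := symp_det (symp_J (n := n) (K := K))
    have : x ᵥ* sympJ n K ᵥ* (sympJ n K)⁻¹ = x := by
      rw [Matrix.vecMul_vecMul, Matrix.mul_nonsing_inv _ h3, Matrix.vecMul_one]
    rw [← this, h2, Matrix.zero_vecMul]
  · rw [stdω_apply, stdω_apply, Matrix.toLin'_apply, Matrix.toLin'_apply, Matrix.mulVec_transpose,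
      ← Matrix.dotProduct_mulVec, Matrix.mulVec_mulVec, Matrix.mulVec_transpose,
      ← Matrix.mulVec_transpose, Matrix.mulVec_mulVec, hM]

lemma from_frame {M : SM n K} {a : Matrix (Fin n) (Fin n) K}
    (h : FrameMat (stdω n K) (Matrix.toLin' Mᵀ) a) (hM : IsSymplectic M) :
    ∃ R b c d, IsSymplectic R ∧ R * M * R⁻¹ = fromBlocks aᵀ b c d := by
  obtain ⟨e, f, hF, ha⟩ := h
  have H := std_iso hM
  let R : SM n K := Matrix.of (Sum.elim e f)
  have hent : ∀ (N : SM n K) i j, (R * N * sympJ n K * Rᵀ) i j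
      = stdω n K (Matrix.toLin' Nᵀ (Sum.elim e f i)) (Sum.elim e f j) := by
    intro N i j
    rw [stdω_apply, Matrix.toLin'_apply, Matrix.mulVec_transpose, ← Matrix.dotProduct_mulVec,
      Matrix.mulVec_mulVec, Matrix.mul_assoc R, Matrix.mul_apply', Matrix.dotProduct_mulVec]
    congr 1
  have hR : IsSymplectic R := by
    unfold IsSymplectic
    have h1 := hent 1
    rw [Matrix.mul_one, Matrix.transpose_one, Matrix.toLin'_one] at h1
    ext i j
    rw [h1, sympJ]
    rcases i with i | i <;> rcases j with j | j
    · simp [hF.ee]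
    · simp [hF.ef, Matrix.one_apply]
    · simp [H.skew (e j) (f i), hF.ef, Matrix.one_apply, eq_comm]
    · simp [hF.ff]
  refine ⟨R, (R * M * R⁻¹).toBlocks₁₂, (R * M * R⁻¹).toBlocks₂₁, (R * M * R⁻¹).toBlocks₂₂, hR, ?_⟩
  have : (R * M * R⁻¹).toBlocks₁₁ = aᵀ := by
    have e1 : R * M * sympJ n K * Rᵀ = (R * M * R⁻¹) * sympJ n K := by
      conv_rhs => rw [← hR]
      have hI := Matrix.nonsing_inv_mul _ (symp_det hR)
      calc _ = R * M * (R⁻¹ * R) * sympJ n K * Rᵀ := by rw [hI, Matrix.mul_one]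
        _ = _ := by simp only [Matrix.mul_assoc]
    ext k i
    have h2 := hent M (Sum.inl k) (Sum.inr i)
    rw [e1] at h2
    simp only [Sum.elim_inl, Sum.elim_inr, ha] at h2
    rw [Matrix.transpose_apply, ← h2]
    rw [← Matrix.fromBlocks_toBlocks (R * M * R⁻¹), sympJ, Matrix.fromBlocks_multiply]
    simp
  rw [← this, Matrix.fromBlocks_toBlocks]

theorem assemble (hq : q.Monic) (hqd : q.natDegree = n) (hq0 : q.coeff 0 ≠ 0)
    (hc : IsCoprime q (recipPoly q))
    (hall : ∀ (V : Type u) [AddCommGroup V] [Module K V] [FiniteDimensional K V]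
      (ω : V →ₗ[K] V →ₗ[K] K) (M : V →ₗ[K] V), Iso ω M → Module.finrank K V = 2 * n →
      ¬ (∀ x, M x = - x) → HasGood ω M q q ∨ HasGood ω M q (recipPoly q)) :
    ∃ P : Matrix (Fin n ⊕ Fin n) (Fin n ⊕ Fin n) K,
      IsSymplectic P ∧ IsCyclicMat P ∧ IsStrictlyHyperbolic P ∧
      ∀ M : Matrix (Fin n ⊕ Fin n) (Fin n ⊕ Fin n) K,
        IsSymplectic M → M ≠ -(1 : Matrix (Fin n ⊕ Fin n) (Fin n ⊕ Fin n) K) →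
        ∃ S₁ S₂ : Matrix (Fin n ⊕ Fin n) (Fin n ⊕ Fin n) K,
          IsSymplectic S₁ ∧ IsSymplectic S₂ ∧
          M = (S₁ * P * S₁⁻¹) * (S₂ * P * S₂⁻¹) := by
  obtain ⟨C0, h0⟩ := exists_cyc (ι := Fin n) q hq (by simpa using hqd)
  have d0 := isUnit_of_cyc h0 hq0
  have hP : Cyc (dg C0 (C0⁻¹)ᵀ) (q * recipPoly q) :=
    cyc_diag h0 (h0.inv hq0).transpose hc
  refine ⟨dg C0 (C0⁻¹)ᵀ, symp_dg (by simp [Matrix.mul_nonsing_inv _ d0]), ?_, ?_, ?_⟩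
  · rw [IsCyclicMat, hP.charpoly, hP.minpoly]
  · exact ⟨q, hq, hqd, hq0, hc, hP.minpoly⟩
  · intro M hM hne
    have hr : Module.finrank K (Fin n ⊕ Fin n → K) = 2 * n := by simp [two_mul]
    have hg : ∃ a : Matrix (Fin n) (Fin n) K, FrameMat (stdω n K) (Matrix.toLin' Mᵀ) a ∧
        (Good q q a ∨ Good q (recipPoly q) a) := by
      have red : ∀ p, HasGood (stdω n K) (Matrix.toLin' Mᵀ) q p → ∃ a : Matrix (Fin n) (Fin n) K,
          FrameMat (stdω n K) (Matrix.toLin' Mᵀ) a ∧ Good q p a := by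
        rintro p ⟨ι, _, _, a, hf, hg⟩
        have hcard : Fintype.card (Fin n) = Fintype.card ι := by
          obtain ⟨e, f, hF, -⟩ := hf
          have := hF.finrank (std_iso hM)
          simp at *; omega
        let s := Fintype.equivOfCardEq hcard
        exact ⟨_, hf.reindex s, hg.reindex s⟩
      rcases hall _ (stdω n K) _ (std_iso hM) hr (by
        intro h
        apply hne
        have : Matrix.toLin' Mᵀ = Matrix.toLin' (-1) := by
          ext1 j; ext1; simp only [LinearMap.comp_apply]; rw [h]; simp [Matrix.neg_mulVec]
        have := Matrix.toLin'.injective this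
        rw [← Matrix.transpose_transpose M, this]; simp) with h | h
      · obtain ⟨a, h1, h2⟩ := red _ h
        exact ⟨a, h1, Or.inl h2⟩
      · obtain ⟨a, h1, h2⟩ := red _ h
        exact ⟨a, h1, Or.inr h2⟩
    obtain ⟨a, hf, hg⟩ := hg
    obtain ⟨R, b, c, d, hR, hRM⟩ := from_frame hf hM
    obtain ⟨A, C, hA, cA, cC⟩ : ∃ A C, A = a * C ∧ Cyc A q ∧ (Cyc C q ∨ Cyc C (recipPoly q)) := by
      rcases hg with ⟨A, C, hA, cA, cC⟩ | ⟨A, C, hA, cA, cC⟩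
      · exact ⟨A, C, hA, cA, Or.inl cC⟩
      · exact ⟨A, C, hA, cA, Or.inr cC⟩
    have hN : IsSymplectic (fromBlocks aᵀ b c d) := by
      rw [← hRM]; exact symp_mul (symp_mul hR hM) (symp_inv hR)
    obtain ⟨L, U, hLU, hL, hU⟩ := factor hq0 hc h0 hN (A := Aᵀ) (C := Cᵀ)
      (by rw [hA, Matrix.transpose_mul]) cA.transpose
      (cC.imp Cyc.transpose Cyc.transpose)
    have I1 := Matrix.nonsing_inv_mul _ (symp_det hR)
    have I2 := Matrix.mul_nonsing_inv _ (symp_det hR)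
    obtain ⟨S₁, s1, e1⟩ := hL.conj (symp_inv hR)
    obtain ⟨S₂, s2, e2⟩ := hU.conj (symp_inv hR)
    refine ⟨S₁, S₂, s1, s2, ?_⟩
    rw [← e1, ← e2, Matrix.nonsing_inv_nonsing_inv _ (symp_det hR)]
    rw [← hRM] at hLU
    calc M = (R⁻¹ * R) * M * (R⁻¹ * R) := by rw [I1, Matrix.one_mul, Matrix.mul_one]
      _ = R⁻¹ * (R * M * R⁻¹) * R := by simp only [Matrix.mul_assoc]
      _ = R⁻¹ * L * 1 * U * R := by rw [hLU]; simp only [Matrix.mul_assoc, Matrix.one_mul]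
      _ = _ := by rw [← I2]; simp only [Matrix.mul_assoc]

end Assembly


section Steps
variable {K : Type u} [Field K] {V : Type u} [AddCommGroup V] [Module K V] [FiniteDimensional K V]
variable {κ : Type} [Fintype κ] [DecidableEq κ]

/-- `(W, ω₁, M₁)` is a peeling of `(V, ω, M)` with Gram matrix `F`. -/
structure Peeled (ω : V →ₗ[K] V →ₗ[K] K) (M : V →ₗ[K] V) (e : κ → V) (F : Matrix κ κ K)
    (W : Submodule K V) (ω₁ : W →ₗ[K] W →ₗ[K] K) (M₁ : W →ₗ[K] W) (ψ : κ → W →ₗ[K] K) : Prop where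
  iso : Iso ω₁ M₁
  rank : Module.finrank K V = 2 * Fintype.card κ + Module.finrank K W
  form : ∀ x y : W, ω₁ x y = ω x y
  formM : ∀ x y : W, ω₁ (M₁ x) y = ω (M x) y
  perp : ∀ x : W, ∀ i, ω (e i) x = 0 ∧ ω (M (e i)) x = 0
  psi : ∀ (x : W) j, ∑ i, ψ i x * F i j = ω (M x) (e j)
  frame : ∀ (ι : Type) [Fintype ι] [DecidableEq ι] (e' f' : ι → W), Frame ω₁ e' f' →
        ∀ a₁ : Matrix ι ι K, (∀ i k, ω₁ (M₁ (e' k)) (f' i) = a₁ i k) →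
        ∀ a₀ : Matrix κ κ K, (F * a₀)ᵀ = F * a₀ →
        FrameMat ω M (fromBlocks a₀ (a₀ * Matrix.of fun j k => ψ j (e' k)) 0 a₁)

lemma exists_peeled {ω : V →ₗ[K] V →ₗ[K] K} {M : V →ₗ[K] V} (H : Iso ω M)
    (e : κ → V) (he : ∀ i j, ω (e i) (e j) = 0) (F : Matrix κ κ K)
    (hF : ∀ i j, ω (M (e i)) (e j) = F i j) (hdet : IsUnit F.det) :
    ∃ W ω₁ M₁ ψ, Peeled ω M e F W ω₁ M₁ ψ := by
  obtain ⟨W, ω₁, M₁, ψ, h1, h2, h3, h4, h5, h6, h7⟩ := peel H e he F hF hdet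
  refine ⟨W, ω₁, M₁, ψ, h1, h2, h3, h4, h5, h6, ?_⟩
  intro ι _ _ e' f' hf a₁ ha a₀ hs
  obtain ⟨f, hf', ha'⟩ := h7 ι e' f' hf a₁ ha a₀ hs
  exact ⟨_, f, hf', ha'⟩

lemma Peeled.lift {ω : V →ₗ[K] V →ₗ[K] K} {M : V →ₗ[K] V} {e : κ → V} {F : Matrix κ κ K}
    {W : Submodule K V} {ω₁ : W →ₗ[K] W →ₗ[K] K} {M₁ : W →ₗ[K] W} {ψ : κ → W →ₗ[K] K}
    (P : Peeled ω M e F W ω₁ M₁ ψ) {ι : Type} [Fintype ι] [DecidableEq ι] {a₁ : Matrix ι ι K}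
    (h : FrameMat ω₁ M₁ a₁) {a₀ : Matrix κ κ K} (hs : (F * a₀)ᵀ = F * a₀) :
    ∃ b, FrameMat ω M (fromBlocks a₀ b 0 a₁) := by
  obtain ⟨e', f', hf, ha⟩ := h
  exact ⟨_, P.frame ι e' f' hf a₁ ha a₀ hs⟩

lemma Peeled.link {ω : V →ₗ[K] V →ₗ[K] K} {M : V →ₗ[K] V} {e : κ → V} {F : Matrix κ κ K}
    {W : Submodule K V} {ω₁ : W →ₗ[K] W →ₗ[K] K} {M₁ : W →ₗ[K] W} {ψ : κ → W →ₗ[K] K}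
    (P : Peeled ω M e F W ω₁ M₁ ψ) {p₁ p₂ f₁ f₂ : K[X]}
    (h : HasGood ω₁ M₁ p₁ p₂) {a₀ : Matrix κ κ K} (hs : (F * a₀)ᵀ = F * a₀)
    (hc : Cell f₁ f₂ a₀) : HasGood ω M (f₁ * p₁) (f₂ * p₂) := by
  obtain ⟨ι, _, _, a, hf, hg⟩ := h
  obtain ⟨b, hb⟩ := P.lift hf hs
  exact ⟨κ ⊕ ι, inferInstance, inferInstance, _, hb, hc.link hg b⟩

lemma peel_one {ω : V →ₗ[K] V →ₗ[K] K} {M : V →ₗ[K] V} (H : Iso ω M) {x : V}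
    (hx : ω (M x) x ≠ 0) : ∃ W ω₁ M₁ ψ,
      Peeled ω M (fun _ : Unit => x) (Matrix.of fun _ _ => ω (M x) x) W ω₁ M₁ ψ := by
  refine exists_peeled H _ (fun _ _ => H.alt _) _ (fun _ _ => rfl) ?_
  rw [isUnit_iff_ne_zero]; simpa using hx

lemma symm_unit (F a : Matrix Unit Unit K) : (F * a)ᵀ = F * a := by
  ext i j; rfl

lemma peel_two {ω : V →ₗ[K] V →ₗ[K] K} {M : V →ₗ[K] V} (H : Iso ω M) {x y : V} {p q r s : K}
    (hxy : ω x y = 0) (hp : ω (M x) x = p) (hq : ω (M x) y = q) (hr : ω (M y) x = r)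
    (hs : ω (M y) y = s) (hd : p * s - q * r ≠ 0) : ∃ W ω₁ M₁ ψ,
      Peeled ω M ![x, y] !![p, q; r, s] W ω₁ M₁ ψ := by
  refine exists_peeled H _ ?_ _ ?_ ?_
  · intro i j; fin_cases i <;> fin_cases j <;> simp [H.alt, hxy, H.skew x y]
  · intro i j; fin_cases i <;> fin_cases j <;> simp [hp, hq, hr, hs]
  · rw [isUnit_iff_ne_zero, Matrix.det_fin_two_of]; exact hd

lemma symm_alt (t p q r : K) : (!![0, t; -t, 0] * !![p, q; r, -p])ᵀ
    = !![0, t; -t, 0] * !![p, q; r, -p] := by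
  ext i j; fin_cases i <;> fin_cases j <;> simp [Matrix.mul_apply, Fin.sum_univ_two]

/-- Explicit equivalence. -/
def e2 : Unit ⊕ Unit ≃ Fin 2 where
  toFun := Sum.elim (fun _ => 0) (fun _ => 1)
  invFun := ![Sum.inl (), Sum.inr ()]
  left_inv := by rintro (_ | _) <;> rfl
  right_inv := by intro i; fin_cases i <;> rfl

lemma split2 {ω : V →ₗ[K] V →ₗ[K] K} {M : V →ₗ[K] V} {ι : Type} [Fintype ι] [DecidableEq ι]
    {p x r : K} {b : Matrix (Fin 2) ι K} {a : Matrix ι ι K}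
    (h : FrameMat ω M (fromBlocks !![p, x; 0, r] b 0 a)) :
    ∃ b₁ b₂, FrameMat ω M (fromBlocks (p • (1 : Matrix Unit Unit K)) b₁ 0
      (fromBlocks (r • (1 : Matrix Unit Unit K)) b₂ 0 a)) := by
  have h' := h.reindex ((Equiv.sumAssoc Unit Unit ι).symm.trans (Equiv.sumCongr e2 (Equiv.refl ι)))
  refine ⟨Matrix.of fun _ => Sum.elim (fun _ => x) (fun j => b 0 j), Matrix.of fun _ j => b 1 j, ?_⟩
  convert h' using 1
  ext i j
  rcases i with i | i | i <;> rcases j with j | j | j <;> simp [e2]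

lemma cv_unit {A : Matrix Unit Unit K} {z : Unit → K} (hz : z () ≠ 0) : Cv A z := by
  intro w
  refine ⟨C (w () / z ()), ?_⟩
  rw [aeval_C, Algebra.algebraMap_eq_smul_one, Matrix.smul_mulVec, Matrix.one_mulVec]
  funext i
  simp [hz]

lemma cv_two {A : Matrix (Fin 2) (Fin 2) K} {z : Fin 2 → K}
    (hz : z 0 * (A 1 0 * z 0 + A 1 1 * z 1) - z 1 * (A 0 0 * z 0 + A 0 1 * z 1) ≠ 0) : Cv A z := by
  intro w
  set d := z 0 * (A 1 0 * z 0 + A 1 1 * z 1) - z 1 * (A 0 0 * z 0 + A 0 1 * z 1) with hd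
  refine ⟨C ((w 0 * (A 1 0 * z 0 + A 1 1 * z 1) - w 1 * (A 0 0 * z 0 + A 0 1 * z 1)) / d) +
    C ((z 0 * w 1 - z 1 * w 0) / d) * X, ?_⟩
  rw [map_add, map_mul, aeval_C, aeval_C, aeval_X, Algebra.algebraMap_eq_smul_one,
    Algebra.algebraMap_eq_smul_one, Matrix.smul_mul, Matrix.one_mul, Matrix.add_mulVec,
    Matrix.smul_mulVec, Matrix.smul_mulVec, Matrix.one_mulVec]
  funext i
  fin_cases i
  · simp only [Pi.add_apply, Pi.smul_apply, smul_eq_mul, Matrix.mulVec, dotProduct,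
      Fin.sum_univ_two, Fin.zero_eta, Fin.mk_one]
    field_simp
    rw [hd]; ring
  · simp only [Pi.add_apply, Pi.smul_apply, smul_eq_mul, Matrix.mulVec, dotProduct,
      Fin.sum_univ_two, Fin.zero_eta, Fin.mk_one]
    field_simp
    rw [hd]; ring

lemma cell_unit {β γ c : K} (hc : c ≠ 0) (h : β = c * γ) (T : Finset K) (hT : 2 < T.card) :
    Cell (X - C β) (X - C γ) (c • (1 : Matrix Unit Unit K)) := by
  refine cell_of_functionals (monic_X_sub_C _) (monic_X_sub_C _) (by simp) (by simp)
    (by rw [isUnit_iff_ne_zero]; simpa using hc)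
    (A := β • 1) (C := γ • 1) ?_ ?_ ?_ (N₁ := 1) (N₂ := 1)
    (fun _ => LinearMap.proj ()) (fun _ => LinearMap.proj ()) ?_ ?_ ?_ ?_ T hT
  · rw [h]; simp [smul_smul, mul_comm]
  · simp [Algebra.algebraMap_eq_smul_one]
  · simp [Algebra.algebraMap_eq_smul_one]
  · intro _ h; have := LinearMap.congr_fun h (fun _ => 1); simp at this
  · intro _ h; have := LinearMap.congr_fun h (fun _ => 1); simp at this
  · intro z hz; exact cv_unit (hz 0)
  · intro z hz; exact cv_unit (hz 0)

end Steps

section Recip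
variable {K : Type u} [Field K]

lemma recip_X_sub_C {α : K} (h : α ≠ 0) : recipPoly (X - C α) = X - C α⁻¹ := by
  have hr : (X - C α).reverse = 1 - C α * X := by
    have h1 : reflect 1 (X : K[X]) = 1 := by
      have := reflect_monomial (R := K) 1 1
      simpa [revAt_le] using this
    rw [reverse, natDegree_X_sub_C, reflect_sub, reflect_C, h1, pow_one]
  rw [recipPoly, hr]
  have : (X - C α).coeff 0 = -α := by simp
  rw [this, mul_sub, ← mul_assoc, ← C_mul, inv_neg, neg_mul, inv_mul_cancel₀ h]
  simp
  ring

lemma cop_X_sub {α β : K} (h : α ≠ β) : IsCoprime (X - C α : K[X]) (X - C β) :=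
  isCoprime_X_sub_C_of_isUnit_sub (sub_ne_zero.2 h).isUnit

end Recip


section RB
variable {K : Type u} [Field K]

/-- The `T` predicate. -/
def TT (α : K) (N l : ℕ) {ι : Type} [Fintype ι] [DecidableEq ι] (a : Matrix ι ι K) : Prop :=
  ∀ k m i j, k + m = l → k + i + m + j = N →
    Good ((X - C α) ^ (k + i) * (X - C (-α)) ^ (m + j))
      ((X - C α) ^ (i + m) * (X - C (-α)) ^ (k + j)) a

lemma TT.plus {α : K} {N l : ℕ} {ι : Type} [Fintype ι] [DecidableEq ι] {a : Matrix ι ι K}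
    (h : TT α N l a) (hl : l ≤ N) {T : Finset K} (hT : 2 < T.card) (b : Matrix Unit ι K) :
    TT α (N + 1) l (fromBlocks ((1 : K) • (1 : Matrix Unit Unit K)) b 0 a) := by
  intro k m i j h1 h2
  rcases i with _ | i
  · rcases j with _ | j
    · omega
    · have := (cell_unit (β := -α) (γ := -α) (c := (1 : K)) one_ne_zero (by ring) T hT).link
        (h k m 0 j h1 (by omega)) b
      convert this using 1 <;> ring
  · have := (cell_unit (β := α) (γ := α) (c := (1 : K)) one_ne_zero (by ring) T hT).link
        (h k m i j h1 (by omega)) b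
    convert this using 1 <;> ring

lemma TT.minus {α : K} {N l : ℕ} {ι : Type} [Fintype ι] [DecidableEq ι] {a : Matrix ι ι K}
    (h : TT α N l a) {T : Finset K} (hT : 2 < T.card) (b : Matrix Unit ι K) :
    TT α (N + 1) (l + 1) (fromBlocks ((-1 : K) • (1 : Matrix Unit Unit K)) b 0 a) := by
  intro k m i j h1 h2
  have hn : (-1 : K) ≠ 0 := neg_ne_zero.2 one_ne_zero
  rcases k with _ | k
  · rcases m with _ | m
    · omega
    · have := (cell_unit (β := -α) (γ := α) (c := (-1 : K)) hn (by ring) T hT).link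
        (h 0 m i j (by omega) (by omega)) b
      convert this using 1 <;> ring
  · have := (cell_unit (β := α) (γ := -α) (c := (-1 : K)) hn (by ring) T hT).link
        (h k m i j (by omega) (by omega)) b
    convert this using 1 <;> ring

lemma TT.one {α : K} {N : ℕ} : TT α N 0 (1 : Matrix (Fin N) (Fin N) K) := by
  intro k m i j h1 h2
  obtain ⟨rfl, rfl⟩ : k = 0 ∧ m = 0 := by omega
  have hm : ((X - C α) ^ i * (X - C (-α)) ^ j : K[X]).Monic :=
    ((monic_X_sub_C _).pow _).mul ((monic_X_sub_C _).pow _)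
  have := good_one (ι := Fin N) hm (by
    rw [((monic_X_sub_C _).pow _).natDegree_mul ((monic_X_sub_C _).pow _),
      (monic_X_sub_C _).natDegree_pow, (monic_X_sub_C _).natDegree_pow, natDegree_X_sub_C,
      natDegree_X_sub_C, Fintype.card_fin]; omega)
  simpa using this

lemma TT.neg_one {α : K} {N : ℕ} : TT α N N (-1 : Matrix (Fin N) (Fin N) K) := by
  intro k m i j h1 h2
  obtain ⟨rfl, rfl⟩ : i = 0 ∧ j = 0 := by omega
  have hm : ((X - C α) ^ m * (X - C (-α)) ^ k : K[X]).Monic :=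
    ((monic_X_sub_C _).pow _).mul ((monic_X_sub_C _).pow _)
  have hd : ((X - C α) ^ m * (X - C (-α)) ^ k : K[X]).natDegree = m + k := by
    rw [((monic_X_sub_C _).pow _).natDegree_mul ((monic_X_sub_C _).pow _),
      (monic_X_sub_C _).natDegree_pow, (monic_X_sub_C _).natDegree_pow, natDegree_X_sub_C,
      natDegree_X_sub_C]; omega
  have := good_neg_one (ι := Fin N) (p' := (X - C α) ^ k * (X - C (-α)) ^ m) hm
    (by rw [hd, Fintype.card_fin]; omega) (by
      rw [hd]
      simp only [mul_comp, pow_comp, sub_comp, neg_comp, X_comp, C_comp, map_neg, map_pow, map_one]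
      have e1 : (-X - C α : K[X]) = (-1) * (X - -C α) := by ring
      have e2 : (-X - -C α : K[X]) = (-1) * (X - C α) := by ring
      rw [e1, e2, mul_pow, mul_pow, pow_add]
      have s1 : ((-1 : K[X]) ^ m) * (-1) ^ m = 1 := by rw [← mul_pow]; simp
      have s2 : ((-1 : K[X]) ^ k) * (-1) ^ k = 1 := by rw [← mul_pow]; simp
      generalize (X - C α) ^ k = A at *
      linear_combination (-(-1 : K[X]) ^ k * (-1) ^ k * (A * (X - -C α) ^ m)) * s1
        - (A * (X - -C α) ^ m) * s2)
  simpa using this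

/-- Existence of frames with property `TT`. -/
def HasT {V : Type u} [AddCommGroup V] [Module K V] (α : K) (N l : ℕ)
    (ω : V →ₗ[K] V →ₗ[K] K) (M : V →ₗ[K] V) : Prop :=
  ∃ (ι : Type) (_ : Fintype ι) (_ : DecidableEq ι) (a : Matrix ι ι K), FrameMat ω M a ∧ TT α N l a

section
variable {V : Type u} [AddCommGroup V] [Module K V] [FiniteDimensional K V]
  {ω : V →ₗ[K] V →ₗ[K] K} {M : V →ₗ[K] V} 

lemma hasT_scalar (α : K) (H : Iso ω M) {N : ℕ} (hr : Module.finrank K V = 2 * N)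
    {ε : K} (he : ε = 1 ∨ ε = -1) (hM : ∀ x, M x = ε • x) :
    ∃ l ≤ N, (ε = 1 → l = 0) ∧ HasT α N l ω M := by
  obtain ⟨e, f, hF, ha, -⟩ := frameMat_scalar H hr hM 0
  rcases he with rfl | rfl
  · refine ⟨0, by omega, fun _ => rfl, Fin N, inferInstance, inferInstance, _, ⟨e, f, hF, ha⟩, ?_⟩
    rw [one_smul]; exact TT.one
  · by_cases h : (-1 : K) = 1
    · refine ⟨0, by omega, fun _ => rfl, Fin N, inferInstance, inferInstance, _, ⟨e, f, hF, ha⟩, ?_⟩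
      rw [h, one_smul]; exact TT.one
    · refine ⟨N, le_rfl, fun h' => absurd h' h, Fin N, inferInstance, inferInstance, _,
        ⟨e, f, hF, ha⟩, ?_⟩
      rw [neg_smul, one_smul]; exact TT.neg_one

lemma hasT_one {α : K} {N l : ℕ} (hl : l ≤ N) {T : Finset K} (hT : 2 < T.card)
    {e : Unit → V} {F : Matrix Unit Unit K}
    {W : Submodule K V} {ω₁ : W →ₗ[K] W →ₗ[K] K} {M₁ : W →ₗ[K] W} {ψ : Unit → W →ₗ[K] K}
    (P : Peeled ω M e F W ω₁ M₁ ψ) (h : HasT α N l ω₁ M₁) :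
    HasT α (N + 1) l ω M ∧ HasT α (N + 1) (l + 1) ω M := by
  obtain ⟨ι, _, _, a, hf, ht⟩ := h
  constructor
  · obtain ⟨b, hb⟩ := P.lift hf (symm_unit _ ((1 : K) • 1))
    exact ⟨_, inferInstance, inferInstance, _, hb, ht.plus hl hT b⟩
  · obtain ⟨b, hb⟩ := P.lift hf (symm_unit _ ((-1 : K) • 1))
    exact ⟨_, inferInstance, inferInstance, _, hb, ht.minus hT b⟩

lemma hasT_two {α : K} {N l : ℕ} (hl : l ≤ N) {T : Finset K} (hT : 2 < T.card)
    {e : Fin 2 → V} {t : K}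
    {W : Submodule K V} {ω₁ : W →ₗ[K] W →ₗ[K] K} {M₁ : W →ₗ[K] W} {ψ : Fin 2 → W →ₗ[K] K}
    (P : Peeled ω M e !![0, t; -t, 0] W ω₁ M₁ ψ) (h : HasT α N l ω₁ M₁) :
    HasT α (N + 2) (l + 1) ω M := by
  obtain ⟨ι, _, _, a, hf, ht⟩ := h
  obtain ⟨b, hb⟩ := P.lift hf (symm_alt t 1 0 0)
  obtain ⟨b₁, b₂, hb⟩ := split2 hb
  exact ⟨_, inferInstance, inferInstance, _, hb, (ht.minus hT b₂).plus (by omega) hT b₁⟩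
end

lemma hasT_exists (α : K) {T : Finset K} (hT : 2 < T.card) (N : ℕ) :
    ∀ (V : Type u) [AddCommGroup V] [Module K V] [FiniteDimensional K V]
      (ω : V →ₗ[K] V →ₗ[K] K) (M : V →ₗ[K] V), Iso ω M → Module.finrank K V = 2 * N →
      ∃ l ≤ N, HasT α N l ω M := by
  induction N using Nat.strong_induction_on with
  | _ N ih =>
  intro V _ _ _ ω M H hr
  rcases trichotomy H with ⟨x, hx⟩ | ⟨-, ⟨x, y, t, hxy, h1, h2, h3, h4, ht⟩ | ⟨ε, he, hM⟩⟩
  · obtain ⟨W, ω₁, M₁, ψ, P⟩ := peel_one H hx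
    have hrk := P.rank
    simp only [Fintype.card_unit, mul_one] at hrk
    obtain ⟨l, hl, h⟩ := ih (N - 1) (by omega) W ω₁ M₁ P.iso (by omega)
    have := (hasT_one hl hT P h).1
    rw [show N - 1 + 1 = N by omega] at this
    exact ⟨l, by omega, this⟩
  · obtain ⟨W, ω₁, M₁, ψ, P⟩ := peel_two H hxy h1 h3 h4 h2 (by simpa using ht)
    have hrk := P.rank
    simp only [Fintype.card_fin] at hrk
    obtain ⟨l, hl, h⟩ := ih (N - 2) (by omega) W ω₁ M₁ P.iso (by omega)
    have := hasT_two hl hT P h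
    rw [show N - 2 + 2 = N by omega] at this
    exact ⟨l + 1, by omega, this⟩
  · obtain ⟨l, hl, -, h⟩ := hasT_scalar α H hr he hM
    exact ⟨l, hl, h⟩

/-- conclusion of the main theorem -/
def Concl (n : ℕ) (K : Type u) [Field K] : Prop :=
    ∃ P : Matrix (Fin n ⊕ Fin n) (Fin n ⊕ Fin n) K,
      IsSymplectic P ∧ IsCyclicMat P ∧ IsStrictlyHyperbolic P ∧
      ∀ M : Matrix (Fin n ⊕ Fin n) (Fin n ⊕ Fin n) K,
        IsSymplectic M → M ≠ -(1 : Matrix (Fin n ⊕ Fin n) (Fin n ⊕ Fin n) K) →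
        ∃ S₁ S₂ : Matrix (Fin n ⊕ Fin n) (Fin n ⊕ Fin n) K,
          IsSymplectic S₁ ∧ IsSymplectic S₂ ∧
          M = (S₁ * P * S₁⁻¹) * (S₂ * P * S₂⁻¹)

lemma coeff_zero_pow_ne {p : K[X]} (h : p.coeff 0 ≠ 0) (n : ℕ) : (p ^ n).coeff 0 ≠ 0 := by
  rw [coeff_zero_eq_eval_zero] at *
  rw [eval_pow]; exact pow_ne_zero _ h

lemma coeff_zero_mul_ne {p q : K[X]} (h : p.coeff 0 ≠ 0) (h' : q.coeff 0 ≠ 0) :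
    (p * q).coeff 0 ≠ 0 := by
  rw [mul_coeff_zero]; exact mul_ne_zero h h'

lemma coeff_lin {α : K} (h : α ≠ 0) : (X - C α).coeff 0 ≠ 0 := by simpa using h

/-- characteristic two, at least four elements -/
theorem concl_char_two {n : ℕ} (h2 : (2 : K) = 0) {α : K} (h0 : α ≠ 0) (h1 : α ≠ 1) :
    Concl n K := by
  classical
  refine assemble (q := (X - C α) ^ n) ((monic_X_sub_C _).pow _)
    (by rw [(monic_X_sub_C _).natDegree_pow]; simp) (coeff_zero_pow_ne (coeff_lin h0) _) ?_ ?_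
  · rw [recip_pow, recip_X_sub_C h0]
    refine (cop_X_sub ?_).pow
    intro h
    have : α * α = 1 := by nth_rw 2 [h]; exact mul_inv_cancel₀ h0
    have h3 : (α - 1) * (α - 1) = 0 := by linear_combination this + (1 - α) * h2
    exact h1 (sub_eq_zero.1 (mul_self_eq_zero.1 h3))
  · intro V _ _ _ ω M H hr _
    left
    have hT : 2 < ({0, 1, α} : Finset K).card := by
      rw [Finset.card_eq_three.2 ⟨0, 1, α, zero_ne_one, h0.symm, h1.symm, rfl⟩]; norm_num
    obtain ⟨l, hl, ι, _, _, a, hf, ht⟩ := hasT_exists α hT n V ω M H hr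
    refine ⟨ι, inferInstance, inferInstance, a, hf, ?_⟩
    have := ht l 0 (n - l) 0 (by omega) (by omega)
    have hα : -α = α := by linear_combination -α * h2
    rw [hα] at this
    simp only [← pow_add] at this
    convert this using 2 <;> omega

lemma cell_Q {α : K} (h2 : (2 : K) ≠ 0) (h0 : α ≠ 0) {T : Finset K} (hT : 4 < T.card) :
    Cell ((X - C α) * (X - C (-α))) ((X - C α) * (X - C (-α))) (!![0, -1; 1, -0] : Matrix _ _ K) := by
  have hm : ((X - C α) * (X - C (-α)) : K[X]).Monic := (monic_X_sub_C _).mul (monic_X_sub_C _)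
  have hd : ((X - C α) * (X - C (-α)) : K[X]).natDegree = Fintype.card (Fin 2) := by
    rw [(monic_X_sub_C _).natDegree_mul (monic_X_sub_C _)]; simp
  refine cell_of_functionals hm hm hd hd (by rw [isUnit_iff_ne_zero]; simp)
    (A := !![0, α; α, 0]) (C := !![α, 0; 0, -α]) ?_ ?_ ?_ (N₁ := 2) (N₂ := 2)
    ![(LinearMap.proj 0 : (Fin 2 → K) →ₗ[K] K) + (LinearMap.proj 1 : (Fin 2 → K) →ₗ[K] K), (LinearMap.proj 0 : (Fin 2 → K) →ₗ[K] K) - (LinearMap.proj 1 : (Fin 2 → K) →ₗ[K] K)]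
    ![(LinearMap.proj 0 : (Fin 2 → K) →ₗ[K] K), (LinearMap.proj 1 : (Fin 2 → K) →ₗ[K] K)] ?_ ?_ ?_ ?_ T hT
  · ext i j; fin_cases i <;> fin_cases j <;> simp [Matrix.mul_apply, Fin.sum_univ_two]
  · rw [map_mul, map_sub, map_sub, aeval_X, aeval_C, aeval_C, Algebra.algebraMap_eq_smul_one,
      Algebra.algebraMap_eq_smul_one]
    ext i j; fin_cases i <;> fin_cases j <;> simp [Matrix.mul_apply, Fin.sum_univ_two] 
  · rw [map_mul, map_sub, map_sub, aeval_X, aeval_C, aeval_C, Algebra.algebraMap_eq_smul_one,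
      Algebra.algebraMap_eq_smul_one]
    ext i j; fin_cases i <;> fin_cases j <;> simp [Matrix.mul_apply, Fin.sum_univ_two] 
  · intro i h
    have := LinearMap.congr_fun h ![1, 0]
    fin_cases i <;> simp at this
  · intro i h
    have := LinearMap.congr_fun h ![1, 1]
    fin_cases i <;> simp at this
  · intro z hz
    have z0 := hz 0
    have z1 := hz 1
    simp at z0 z1
    apply cv_two
    simp only [Matrix.of_apply, Matrix.cons_val', Matrix.cons_val_zero, Matrix.cons_val_one,
      Matrix.cons_val_fin_one]
    intro h
    have : α * ((z 0 + z 1) * (z 0 - z 1)) = 0 := by linear_combination h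
    exact (mul_ne_zero h0 (mul_ne_zero z0 z1)) this
  · intro z hz
    have z0 := hz 0
    have z1 := hz 1
    simp at z0 z1
    apply cv_two
    simp only [Matrix.of_apply, Matrix.cons_val', Matrix.cons_val_zero, Matrix.cons_val_one,
      Matrix.cons_val_fin_one]
    intro h
    have : 2 * (α * (z 0 * z 1)) = 0 := by linear_combination -h
    exact (mul_ne_zero h2 (mul_ne_zero h0 (mul_ne_zero z0 z1))) this

theorem concl_generic {n : ℕ} (h2 : (2 : K) ≠ 0) {α : K} (h0 : α ≠ 0) (h4 : α ^ 4 ≠ 1) :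
    Concl n K := by
  classical
  have m1 := monic_X_sub_C α
  have m2 := monic_X_sub_C (-α)
  have h0' : -α ≠ 0 := neg_ne_zero.2 h0
  have i1 : α ≠ α⁻¹ := fun h => h4 (by
    have : α * α = 1 := by nth_rw 2 [h]; exact mul_inv_cancel₀ h0
    linear_combination (α * α + 1) * this)
  have i2 : α ≠ -α⁻¹ := fun h => h4 (by
    have : α * α = -1 := by nth_rw 2 [h]; rw [mul_neg, mul_inv_cancel₀ h0]
    linear_combination (α * α - 1) * this)
  have hT4 : 4 < ({0, 1, -1, α, -α} : Finset K).card := by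
    have a1 : α ≠ 1 := by rintro rfl; simp at h4
    have a2 : α ≠ -1 := by rintro rfl; exact h4 (by ring)
    have a3 : (1 : K) ≠ -1 := fun h => h2 (by linear_combination h)
    have a4 : α ≠ -α := fun h => (mul_ne_zero h2 h0) (by linear_combination h)
    have a5 : -1 ≠ α := a2.symm
    have a6 : 1 ≠ -α := fun h => a2 (by linear_combination h)
    rw [Finset.card_insert_of_notMem, Finset.card_insert_of_notMem, Finset.card_insert_of_notMem,
      Finset.card_insert_of_notMem, Finset.card_singleton]
    · norm_num
    · simpa using a4
    · simp only [Finset.mem_insert, Finset.mem_singleton, not_or]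
      exact ⟨a5, fun h => a1 (by linear_combination h)⟩
    · simp only [Finset.mem_insert, Finset.mem_singleton, not_or]
      exact ⟨a3, a1.symm, a6⟩
    · simp only [Finset.mem_insert, Finset.mem_singleton, not_or]
      exact ⟨zero_ne_one, fun h => one_ne_zero (α := K) (by linear_combination h), h0.symm, h0'.symm⟩
  have hT : 2 < ({0, 1, -1, α, -α} : Finset K).card := by omega
  have conv : ∀ (V : Type u) [AddCommGroup V] [Module K V] (ω : V →ₗ[K] V →ₗ[K] K)
      (M : V →ₗ[K] V) (N l : ℕ), l ≤ N → Even l → HasT α N l ω M →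
      HasGood ω M ((X - C α) ^ (N - N / 2) * (X - C (-α)) ^ (N / 2))
        ((X - C α) ^ (N - N / 2) * (X - C (-α)) ^ (N / 2)) := by
    intro V _ _ ω M N l hl he h
    obtain ⟨ι, _, _, a, hf, ht⟩ := h
    obtain ⟨k, rfl⟩ := he
    refine ⟨ι, inferInstance, inferInstance, a, hf, ?_⟩
    have := ht k k (N - N / 2 - k) (N / 2 - k) rfl (by omega)
    convert this using 3 <;> congr 1 <;> omega
  refine assemble (q := (X - C α) ^ (n - n / 2) * (X - C (-α)) ^ (n / 2))
    ((m1.pow _).mul (m2.pow _)) ?_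
    (coeff_zero_mul_ne (coeff_zero_pow_ne (coeff_lin h0) _) (coeff_zero_pow_ne (coeff_lin h0') _))
    ?_ ?_
  · rw [(m1.pow _).natDegree_mul (m2.pow _), m1.natDegree_pow, m2.natDegree_pow]; simp; omega
  · rw [recip_mul, recip_pow, recip_pow, recip_X_sub_C h0, recip_X_sub_C h0', inv_neg]
    refine IsCoprime.mul_left (IsCoprime.mul_right ?_ ?_) (IsCoprime.mul_right ?_ ?_) <;>
      refine IsCoprime.pow (cop_X_sub ?_)
    · exact i1
    · exact i2
    · exact fun h => i2 (by linear_combination -h)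
    · exact fun h => i1 (by linear_combination -h)
  · intro V _ _ _ ω M H hr hne
    left
    rcases trichotomy H with ⟨x, hx⟩ | ⟨-, ⟨x, y, t, hxy, h1, h2, h3, h4, ht⟩ | ⟨ε, he, hM⟩⟩
    · obtain ⟨W, ω₁, M₁, ψ, P⟩ := peel_one H hx
      have hrk := P.rank
      simp only [Fintype.card_unit, mul_one] at hrk
      obtain ⟨l, hl, h⟩ := hasT_exists α hT (n - 1) W ω₁ M₁ P.iso (by omega)
      have := hasT_one hl hT P h
      rw [show n - 1 + 1 = n by omega] at this
      rcases Nat.even_or_odd l with he | he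
      · exact conv _ _ _ _ _ (by omega) he this.1
      · exact conv _ _ _ _ (l + 1) (by omega) he.add_one this.2
    · obtain ⟨W, ω₁, M₁, ψ, P⟩ := peel_two H hxy h1 h3 h4 h2 (by simpa using ht)
      have hrk := P.rank
      simp only [Fintype.card_fin] at hrk
      obtain ⟨l, hl, h⟩ := hasT_exists α hT (n - 2) W ω₁ M₁ P.iso (by omega)
      rcases Nat.even_or_odd l with he | he
      · have g := conv _ _ _ _ _ hl he h
        have := P.link g (symm_alt t 0 (-1) 1) (cell_Q ‹_› h0 hT4)
        obtain ⟨k, rfl⟩ : ∃ k, n = k + 2 := ⟨n - 2, by omega⟩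
        have e1 : k + 2 - (k + 2) / 2 = (k + 2 - 2 - (k + 2 - 2) / 2) + 1 := by omega
        have e2 : (k + 2) / 2 = (k + 2 - 2) / 2 + 1 := by omega
        rw [e1, e2]
        convert this using 1 <;> ring
      · have := hasT_two hl hT P h
        rw [show n - 2 + 2 = n by omega] at this
        exact conv _ _ _ _ (l + 1) (by omega) he.add_one this
    · obtain ⟨l, hl, hl0, h⟩ := hasT_scalar α H hr he hM
      rcases he with rfl | rfl
      · rw [hl0 rfl] at h
        exact conv _ _ _ _ 0 (by omega) (by simp) h
      · exact absurd (fun x => by rw [hM]; simp) hne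

end RB

section RA
variable {K : Type u} [Field K]

lemma cell_LU {α ε : K} (h2 : (2 : K) ≠ 0) (h0 : α ≠ 0) (he : ε * ε = 1) {T : Finset K}
    (hT : 2 < T.card) :
    Cell ((X - C α) ^ 2) ((X - C (ε * α)) ^ 2) (!![ε, -2 * ε; ε, -ε] : Matrix _ _ K) := by
  have he0 : ε ≠ 0 := by rintro rfl; simp at he
  refine cell_of_functionals ((monic_X_sub_C _).pow _) ((monic_X_sub_C _).pow _)
    (by rw [(monic_X_sub_C _).natDegree_pow, natDegree_X_sub_C]; simp)
    (by rw [(monic_X_sub_C _).natDegree_pow, natDegree_X_sub_C]; simp)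
    (by rw [isUnit_iff_ne_zero, Matrix.det_fin_two_of]
        intro h; exact one_ne_zero (α := K) (by linear_combination h - he))
    (A := !![α, 0; α, α]) (C := !![ε * α, 2 * (ε * α); 0, ε * α]) ?_ ?_ ?_ (N₁ := 1) (N₂ := 1)
    (fun _ => LinearMap.proj 0) (fun _ => LinearMap.proj 1) ?_ ?_ ?_ ?_ T hT
  · ext i j; fin_cases i <;> fin_cases j <;> simp [Matrix.mul_apply, Fin.sum_univ_two] <;>
      first | ring1 | linear_combination (-α) * he | linear_combination α * he
  · rw [pow_two, map_mul, map_sub, aeval_X, aeval_C, Algebra.algebraMap_eq_smul_one]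
    ext i j; fin_cases i <;> fin_cases j <;> simp [Matrix.mul_apply, Fin.sum_univ_two] 
  · rw [pow_two, map_mul, map_sub, aeval_X, aeval_C, Algebra.algebraMap_eq_smul_one]
    ext i j; fin_cases i <;> fin_cases j <;> simp [Matrix.mul_apply, Fin.sum_univ_two] 
  · intro i h
    have := LinearMap.congr_fun h ![1, 1]
    simp at this
  · intro i h
    have := LinearMap.congr_fun h ![1, 1]
    simp at this
  · intro z hz
    have z0 := hz 0
    simp at z0
    apply cv_two
    simp only [Matrix.of_apply, Matrix.cons_val', Matrix.cons_val_zero, Matrix.cons_val_one,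
      Matrix.cons_val_fin_one]
    intro h
    have : α * (z 0 * z 0) = 0 := by linear_combination h
    exact (mul_ne_zero h0 (mul_ne_zero z0 z0)) this
  · intro z hz
    have z0 := hz 0
    simp at z0
    apply cv_two
    simp only [Matrix.of_apply, Matrix.cons_val', Matrix.cons_val_zero, Matrix.cons_val_one,
      Matrix.cons_val_fin_one]
    intro h
    have : 2 * (ε * α * (z 1 * z 1)) = 0 := by linear_combination -h
    exact (mul_ne_zero h2 (mul_ne_zero (mul_ne_zero he0 h0) (mul_ne_zero z0 z0))) this

lemma ra_exists (h2 : (2 : K) ≠ 0) {α : K} (h0 : α ≠ 0) {T : Finset K} (hT : 2 < T.card) (N : ℕ) :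
    ∀ (V : Type u) [AddCommGroup V] [Module K V] [FiniteDimensional K V]
      (ω : V →ₗ[K] V →ₗ[K] K) (M : V →ₗ[K] V), Iso ω M → Module.finrank K V = 2 * N →
      ∃ ε : K, (ε = 1 ∨ ε = -1) ∧ HasGood ω M ((X - C α) ^ N) ((X - C (ε * α)) ^ N) := by
  induction N using Nat.strong_induction_on with
  | _ N ih =>
  intro V _ _ _ ω M H hr
  rcases trichotomy H with ⟨x, hx⟩ | ⟨-, ⟨x, y, t, hxy, h1, h2, h3, h4, ht⟩ | ⟨ε, he, hM⟩⟩
  · obtain ⟨W, ω₁, M₁, ψ, P⟩ := peel_one H hx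
    have hrk := P.rank
    simp only [Fintype.card_unit, mul_one] at hrk
    obtain ⟨ε, he, h⟩ := ih (N - 1) (by omega) W ω₁ M₁ P.iso (by omega)
    have hee : ε * ε = 1 := by rcases he with rfl | rfl <;> ring
    have he0 : ε ≠ 0 := by rintro rfl; simp at hee
    have := P.link h (symm_unit _ (ε • 1)) (cell_unit (β := α) (γ := ε * α) he0
      (by linear_combination -α * hee) T hT)
    refine ⟨ε, he, ?_⟩
    rw [← pow_succ', ← pow_succ', show N - 1 + 1 = N by omega] at this
    exact this
  · obtain ⟨W, ω₁, M₁, ψ, P⟩ := peel_two H hxy h1 h3 h4 h2 (by simpa using ht)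
    have hrk := P.rank
    simp only [Fintype.card_fin] at hrk
    obtain ⟨ε, he, h⟩ := ih (N - 2) (by omega) W ω₁ M₁ P.iso (by omega)
    have hee : ε * ε = 1 := by rcases he with rfl | rfl <;> ring
    have := P.link h (symm_alt t ε (-2 * ε) ε) (cell_LU ‹_› h0 hee hT)
    refine ⟨ε, he, ?_⟩
    rw [← pow_add, ← pow_add, show 2 + (N - 2) = N by omega] at this
    exact this
  · refine ⟨ε, he, ?_⟩
    obtain ⟨l, hl, hl0, h⟩ := hasT_scalar α H hr he hM
    obtain ⟨e, f, hF, ha, -⟩ := frameMat_scalar H hr hM 0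
    refine ⟨Fin N, inferInstance, inferInstance, _, ⟨e, f, hF, ha⟩, ?_⟩
    rcases he with rfl | rfl
    · have := TT.one (α := α) (N := N) 0 0 N 0 rfl (by omega)
      simpa using this
    · have := TT.neg_one (α := α) (N := N) N 0 0 0 rfl (by omega)
      simpa using this

theorem concl_RA {n : ℕ} (h2 : (2 : K) ≠ 0) {α : K} (hα : α * α = -1) : Concl n K := by
  classical
  have h0 : α ≠ 0 := by rintro rfl; simp at hα
  have hinv : α⁻¹ = -α := by
    rw [inv_eq_iff_eq_inv, eq_comm, inv_eq_of_mul_eq_one_right]; linear_combination -hα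
  have hrec : recipPoly ((X - C α) ^ n) = (X - C (-α)) ^ n := by
    rw [recip_pow, recip_X_sub_C h0, hinv]
  refine assemble (q := (X - C α) ^ n) ((monic_X_sub_C _).pow _)
    (by rw [(monic_X_sub_C _).natDegree_pow]; simp) (coeff_zero_pow_ne (coeff_lin h0) _) ?_ ?_
  · rw [hrec]
    refine (cop_X_sub ?_).pow
    intro h
    exact (mul_ne_zero h2 h0) (by linear_combination h)
  · intro V _ _ _ ω M H hr _
    have hT : 2 < ({0, 1, -1} : Finset K).card := by
      rw [Finset.card_eq_three.2 ⟨0, 1, -1, zero_ne_one,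
        fun h => one_ne_zero (α := K) (by linear_combination h),
        fun h => h2 (by linear_combination h), rfl⟩]; norm_num
    obtain ⟨ε, he, h⟩ := ra_exists h2 h0 hT n V ω M H hr
    rw [hrec]
    rcases he with rfl | rfl
    · left; simpa using h
    · right; simpa using h

end RA


section Small
variable {K : Type u} [Field K]

lemma cop_of_irred {p q : K[X]} (hp : Irreducible p) (hq : Irreducible q) (mp : p.Monic)
    (mq : q.Monic) (h : p ≠ q) : IsCoprime p q := by
  rcases hp.isCoprime_or_dvd q with h1 | h1
  · exact h1
  · exact absurd (eq_of_monic_of_associated mp mq (hp.associated_of_dvd hq h1)) h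

lemma irred_small {p : K[X]} (hp : p.Monic) (h2 : 2 ≤ p.natDegree) (h3 : p.natDegree ≤ 3)
    (h : ∀ x, p.eval x ≠ 0) : Irreducible p := by
  rw [hp.irreducible_iff_roots_eq_zero_of_degree_le_three h2 h3]
  refine Multiset.eq_zero_of_forall_notMem fun x hx => ?_
  rw [mem_roots hp.ne_zero] at hx
  exact h x hx

lemma cell_of_good {ι : Type} [Fintype ι] [DecidableEq ι] {p₁ p₂ : K[X]} {a : Matrix ι ι K}
    (i1 : Irreducible p₁) (i2 : Irreducible p₂) (hcard : 2 ≤ Fintype.card ι) (ha : IsUnit a.det)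
    (h : Good p₁ p₂ a) : Cell p₁ p₂ a := by
  obtain ⟨A, C, hA, c1, c2⟩ := h
  exact cell_of_irred i1 i2 c1.1 c2.1 c1.2.1 c2.2.1 hcard ha hA c1.aeval c2.aeval

lemma cyc_of_irred {ι : Type} [Fintype ι] [DecidableEq ι] [Nonempty ι] {p : K[X]} {A : Matrix ι ι K}
    (i : Irreducible p) (m : p.Monic) (d : p.natDegree = Fintype.card ι) (h : aeval A p = 0) :
    Cyc A p := by
  obtain ⟨j⟩ := (inferInstance : Nonempty ι)
  refine ⟨m, d, Pi.single j 1, by rw [h, Matrix.zero_mulVec], cv_of_irred i d h ?_⟩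
  intro h'; have := congrFun h' j; simp at this

variable {V : Type u} [AddCommGroup V] [Module K V] [FiniteDimensional K V]
  {ω : V →ₗ[K] V →ₗ[K] K} {M : V →ₗ[K] V}

/-- Gram matrices of two-dimensional cells. -/
def Two (F : Matrix (Fin 2) (Fin 2) K) : Prop :=
  (∃ t, t ≠ 0 ∧ F = !![0, t; -t, 0]) ∨ (∃ c g d, c ≠ 0 ∧ d ≠ 0 ∧ F = !![c, 0; g, d])

lemma quad (H : Iso ω M) :
    (∃ e F W ω₁ M₁ ψ, Two F ∧ Peeled ω M (e : Fin 2 → V) F W ω₁ M₁ ψ) ∨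
    (∃ ε : K, (ε = 1 ∨ ε = -1) ∧ ∀ x, M x = ε • x) ∨
    (∃ e F W ω₁ M₁ ψ, Peeled ω M (e : Unit → V) F W ω₁ M₁ ψ ∧
      ∃ ε : K, (ε = 1 ∨ ε = -1) ∧ ∀ x, M₁ x = ε • x) := by
  rcases trichotomy H with ⟨x, hx⟩ | ⟨-, ⟨x, y, t, hxy, h1, h2, h3, h4, ht⟩ | h⟩
  · obtain ⟨W, ω₁, M₁, ψ, P⟩ := peel_one H hx
    rcases trichotomy P.iso with ⟨y, hy⟩ | ⟨-, ⟨y, z, t, hxy, h1, h2, h3, h4, ht⟩ | h⟩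
    · left
      rw [P.formM] at hy
      obtain ⟨W', ω', M', ψ', P'⟩ := peel_two H (x := x) (y := y) (P.perp y ()).1 rfl
        (P.perp y ()).2 rfl rfl (by simpa using ⟨hx, hy⟩)
      exact ⟨_, _, W', ω', M', ψ', Or.inr ⟨_, _, _, hx, hy, rfl⟩, P'⟩
    · left
      rw [P.formM] at h1 h2 h3 h4
      rw [P.form] at hxy
      obtain ⟨W', ω', M', ψ', P'⟩ := peel_two H hxy h1 h3 h4 h2 (by simpa using ht)
      exact ⟨_, _, W', ω', M', ψ', Or.inl ⟨_, ht, rfl⟩, P'⟩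
    · right; right
      exact ⟨_, _, W, ω₁, M₁, ψ, P, h⟩
  · left
    obtain ⟨W', ω', M', ψ', P'⟩ := peel_two H hxy h1 h3 h4 h2 (by simpa using ht)
    exact ⟨_, _, W', ω', M', ψ', Or.inl ⟨_, ht, rfl⟩, P'⟩
  · exact Or.inr (Or.inl h)

/-- One-dimensional cell plus scalar with the same scalar. -/
lemma one_scalar {e : Unit → V} {F : Matrix Unit Unit K} {W : Submodule K V}
    {ω₁ : W →ₗ[K] W →ₗ[K] K} {M₁ : W →ₗ[K] W} {ψ : Unit → W →ₗ[K] K}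
    (P : Peeled ω M e F W ω₁ M₁ ψ) {m : ℕ} (hr : Module.finrank K V = 2 * (m + 1)) {ε : K}
    (hε : ∀ x, M₁ x = ε • x) (c : K) :
    FrameMat ω M (fromBlocks (c • (1 : Matrix Unit Unit K)) 0 0
      (ε • (1 : Matrix (Fin m) (Fin m) K))) := by
  have hrk := P.rank
  simp only [Fintype.card_unit, mul_one] at hrk
  obtain ⟨e', f', hF, ha, hψ⟩ := frameMat_scalar P.iso (m := m) (by omega) hε (ψ ())
  have := P.frame _ e' f' hF _ ha (c • 1) (symm_unit _ _)
  convert this using 1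
  congr 1
  ext i j; simp [hψ]

lemma frameMat_smul (H : Iso ω M) {m : ℕ} (hr : Module.finrank K V = 2 * m) {ε : K}
    (hε : ∀ x, M x = ε • x) : FrameMat ω M (ε • (1 : Matrix (Fin m) (Fin m) K)) := by
  obtain ⟨e, f, hF, ha, -⟩ := frameMat_scalar H hr hε 0
  exact ⟨e, f, hF, ha⟩

lemma rank_one (H : Iso ω M) (hr : Module.finrank K V = 2) {c : K} :
    FrameMat ω M (c • (1 : Matrix (Fin 1) (Fin 1) K)) ∨
      ∃ ε : K, (ε = 1 ∨ ε = -1) ∧ ∀ x, M x = ε • x := by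
  rcases trichotomy H with ⟨x, hx⟩ | ⟨-, ⟨x, y, t, hxy, h1, h2, h3, h4, ht⟩ | h⟩
  · left
    obtain ⟨W, ω₁, M₁, ψ, P⟩ := peel_one H hx
    have hrk := P.rank
    simp only [Fintype.card_unit, mul_one] at hrk
    have : Subsingleton W := Module.finrank_zero_iff.1 (by omega : Module.finrank K W = 0)
    have := one_scalar P (m := 0) (by omega) (ε := 1) (fun x => Subsingleton.elim _ _) c
    have h' := this.reindex (κ := Fin 1) ⟨fun _ => Sum.inl (), fun _ => 0, fun i => Subsingleton.elim _ _,
      by rintro (i | i); rfl; exact i.elim0⟩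
    convert h' using 1
    ext i j; fin_cases i; fin_cases j; simp
  · obtain ⟨W', ω', M', ψ', P'⟩ := peel_two H hxy h1 h3 h4 h2 (by simpa using ht)
    have := P'.rank
    simp at this; omega
  · exact Or.inr h
end Small

section RC
variable {K : Type u} [Field K]

variable (K) in
/-- f -/
def c3f : K[X] := X ^ 2 + X - 1
variable (K) in
/-- reciprocal of f -/
def c3f' : K[X] := X ^ 2 - X - 1
variable (K) in
/-- g -/
def c3g : K[X] := X ^ 3 - X + 1
variable (K) in
/-- reciprocal of g -/
def c3g' : K[X] := X ^ 3 - X ^ 2 + 1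

variable (K) in
/-- `K` has three elements -/
def Three : Prop := (3 : K) = 0 ∧ ∀ x : K, x = 0 ∨ x = 1 ∨ x = -1

lemma Three.one_ne (h : Three K) : (1 : K) ≠ -1 := fun h' =>
  one_ne_zero (α := K) (by linear_combination h.1 - h')

lemma c3f_monic : (c3f K).Monic := by unfold c3f; monicity!
lemma c3f'_monic : (c3f' K).Monic := by unfold c3f'; monicity!
lemma c3g_monic : (c3g K).Monic := by unfold c3g; monicity!
lemma c3g'_monic : (c3g' K).Monic := by unfold c3g'; monicity!
lemma c3f_deg : (c3f K).natDegree = 2 := by unfold c3f; compute_degree!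
lemma c3f'_deg : (c3f' K).natDegree = 2 := by unfold c3f'; compute_degree!
lemma c3g_deg : (c3g K).natDegree = 3 := by unfold c3g; compute_degree!
lemma c3g'_deg : (c3g' K).natDegree = 3 := by unfold c3g'; compute_degree!

lemma c3f_irred (h : Three K) : Irreducible (c3f K) := by
  refine irred_small c3f_monic (by rw [c3f_deg]) (by rw [c3f_deg]; norm_num) fun x => ?_
  have h3 := h.1
  have h1 := one_ne_zero (α := K)
  simp only [c3f, eval_sub, eval_add, eval_pow, eval_X, eval_one]
  rcases h.2 x with rfl | rfl | rfl <;> grind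
lemma c3f'_irred (h : Three K) : Irreducible (c3f' K) := by
  refine irred_small c3f'_monic (by rw [c3f'_deg]) (by rw [c3f'_deg]; norm_num) fun x => ?_
  have h3 := h.1
  have h1 := one_ne_zero (α := K)
  simp only [c3f', eval_sub, eval_add, eval_pow, eval_X, eval_one]
  rcases h.2 x with rfl | rfl | rfl <;> grind
lemma c3g_irred (h : Three K) : Irreducible (c3g K) := by
  refine irred_small c3g_monic (by rw [c3g_deg]; norm_num) (by rw [c3g_deg]) fun x => ?_
  have h3 := h.1
  have h1 := one_ne_zero (α := K)
  simp only [c3g, eval_sub, eval_add, eval_pow, eval_X, eval_one]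
  rcases h.2 x with rfl | rfl | rfl <;> grind
lemma c3g'_irred (h : Three K) : Irreducible (c3g' K) := by
  refine irred_small c3g'_monic (by rw [c3g'_deg]; norm_num) (by rw [c3g'_deg]) fun x => ?_
  have h3 := h.1
  have h1 := one_ne_zero (α := K)
  simp only [c3g', eval_sub, eval_add, eval_pow, eval_X, eval_one]
  rcases h.2 x with rfl | rfl | rfl <;> grind

lemma reflect_X_pow (N k : ℕ) (h : k ≤ N) : reflect N (X ^ k : K[X]) = X ^ (N - k) := by
  have := reflect_monomial (R := K) N k
  rw [revAt_le h] at this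
  simpa using this

lemma recip_c3f : recipPoly (c3f K) = c3f' K := by
  have h0 : (c3f K).coeff 0 = -1 := by simp [c3f, coeff_zero_eq_eval_zero]
  rw [recipPoly, h0, reverse, c3f_deg, c3f, reflect_sub, reflect_add, reflect_X_pow _ _ le_rfl]
  have h1 := reflect_X_pow (K := K) 2 1 (by norm_num)
  have h2 := reflect_X_pow (K := K) 2 0 (by norm_num)
  rw [pow_one] at h1; rw [pow_zero] at h2
  rw [h1, h2, c3f']
  simp [inv_neg]; ring

lemma recip_c3g : recipPoly (c3g K) = c3g' K := by
  have h0 : (c3g K).coeff 0 = 1 := by simp [c3g, coeff_zero_eq_eval_zero]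
  rw [recipPoly, h0, reverse, c3g_deg, c3g, reflect_add, reflect_sub, reflect_X_pow _ _ le_rfl]
  have h1 := reflect_X_pow (K := K) 3 1 (by norm_num)
  have h2 := reflect_X_pow (K := K) 3 0 (by norm_num)
  rw [pow_one] at h1; rw [pow_zero] at h2
  rw [h1, h2, c3g']
  simp; ring

lemma c3_cop (h : Three K) (m k : ℕ) :
    IsCoprime (c3f K ^ m * c3g K ^ k) (c3f' K ^ m * c3g' K ^ k) := by
  have h1 := h.one_ne
  refine IsCoprime.mul_left (IsCoprime.mul_right ?_ ?_) (IsCoprime.mul_right ?_ ?_) <;>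
    refine IsCoprime.pow ?_
  · refine cop_of_irred (c3f_irred h) (c3f'_irred h) c3f_monic c3f'_monic fun e => h1 ?_
    simpa [c3f, c3f'] using congrArg (eval 1) e
  · refine cop_of_irred (c3f_irred h) (c3g'_irred h) c3f_monic c3g'_monic fun e => ?_
    have := congrArg natDegree e
    rw [c3f_deg, c3g'_deg] at this; omega
  · refine cop_of_irred (c3g_irred h) (c3f'_irred h) c3g_monic c3f'_monic fun e => ?_
    have := congrArg natDegree e
    rw [c3g_deg, c3f'_deg] at this; omega
  · refine cop_of_irred (c3g_irred h) (c3g'_irred h) c3g_monic c3g'_monic fun e => ?_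
    have := congrArg (eval (-1)) e
    simp only [c3g, c3g', eval_sub, eval_add, eval_pow, eval_X, eval_one] at this
    have h3 := h.1
    grind

lemma cell_ff (h : Three K) {a A C : Matrix (Fin 2) (Fin 2) K} (ha : a.det ≠ 0) (hA : A = a * C)
    (h1 : A * A + A - 1 = 0) (h2 : C * C + C - 1 = 0) : Cell (c3f K) (c3f K) a := by
  refine cell_of_irred (c3f_irred h) (c3f_irred h) c3f_monic c3f_monic c3f_deg c3f_deg (by simp)
    (isUnit_iff_ne_zero.2 ha) hA ?_ ?_ <;> simpa [c3f, pow_two]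

lemma cell_ff' (h : Three K) {a A C : Matrix (Fin 2) (Fin 2) K} (ha : a.det ≠ 0) (hA : A = a * C)
    (h1 : A * A + A - 1 = 0) (h2 : C * C - C - 1 = 0) : Cell (c3f K) (c3f' K) a := by
  refine cell_of_irred (c3f_irred h) (c3f'_irred h) c3f_monic c3f'_monic c3f_deg c3f'_deg (by simp)
    (isUnit_iff_ne_zero.2 ha) hA ?_ ?_
  · simpa [c3f, pow_two]
  · simpa [c3f', pow_two]

lemma cell_gg' (h : Three K) {a A C : Matrix (Fin 3) (Fin 3) K} (ha : a.det ≠ 0) (hA : A = a * C)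
    (h1 : A * A * A - A + 1 = 0) (h2 : C * C * C - C * C + 1 = 0) : Cell (c3g K) (c3g' K) a := by
  refine cell_of_irred (c3g_irred h) (c3g'_irred h) c3g_monic c3g'_monic c3g_deg c3g'_deg (by simp)
    (isUnit_iff_ne_zero.2 ha) hA ?_ ?_
  · simpa [c3g, pow_succ]
  · simpa [c3g', pow_succ]

lemma two_ext {A B : Matrix (Fin 2) (Fin 2) K} (h1 : A 0 0 = B 0 0) (h2 : A 0 1 = B 0 1)
    (h3 : A 1 0 = B 1 0) (h4 : A 1 1 = B 1 1) : A = B := by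
  ext i j; fin_cases i <;> fin_cases j <;> assumption

lemma two_cell_ff (h : Three K) {F : Matrix (Fin 2) (Fin 2) K} (hF : Two F) :
    ∃ a, (F * a)ᵀ = F * a ∧ Cell (c3f K) (c3f K) a := by
  have h3 := h.1
  have hone := one_ne_zero (α := K)
  have Q1 : Cell (c3f K) (c3f K) !![1, 1; 1, -1] := by
    refine cell_ff h (A := !![-1, 1; 1, 0]) (C := !![0, -1; -1, -1]) ?_ ?_ ?_ ?_
    · rw [Matrix.det_fin_two_of]; grind
    all_goals apply two_ext <;> simp [Matrix.mul_apply, Fin.sum_univ_two] <;> grind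
  have Q2 : Cell (c3f K) (c3f K) !![0, -1; 1, 0] := by
    refine cell_ff h (A := !![1, -1; 1, 1]) (C := !![1, 1; -1, 1]) ?_ ?_ ?_ ?_
    · rw [Matrix.det_fin_two_of]; grind
    all_goals apply two_ext <;> simp [Matrix.mul_apply, Fin.sum_univ_two] <;> grind
  have J1 : Cell (c3f K) (c3f K) !![-1, 1; 0, -1] := by
    refine cell_ff h (A := !![1, 1; -1, 1]) (C := !![0, 1; 1, -1]) ?_ ?_ ?_ ?_
    · rw [Matrix.det_fin_two_of]; grind
    all_goals apply two_ext <;> simp [Matrix.mul_apply, Fin.sum_univ_two] <;> grind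
  have J2 : Cell (c3f K) (c3f K) !![-1, -1; 0, -1] := by
    refine cell_ff h (A := !![1, -1; 1, 1]) (C := !![0, -1; -1, -1]) ?_ ?_ ?_ ?_
    · rw [Matrix.det_fin_two_of]; grind
    all_goals apply two_ext <;> simp [Matrix.mul_apply, Fin.sum_univ_two] <;> grind
  rcases hF with ⟨t, ht, rfl⟩ | ⟨c, g, d, hc, hd, rfl⟩
  · exact ⟨_, symm_alt t 1 1 1, Q1⟩
  · have hc := (h.2 c).resolve_left hc
    have hd := (h.2 d).resolve_left hd
    rcases hc with rfl | rfl <;> rcases hd with rfl | rfl <;> rcases h.2 g with rfl | rfl | rfl <;>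
    first
    | refine ⟨_, ?_, Q2⟩; apply two_ext <;> simp [Matrix.mul_apply, Fin.sum_univ_two]; done
    | refine ⟨_, ?_, Q1⟩; apply two_ext <;> simp [Matrix.mul_apply, Fin.sum_univ_two]; done
    | refine ⟨_, ?_, J1⟩; apply two_ext <;> simp [Matrix.mul_apply, Fin.sum_univ_two]; done
    | refine ⟨_, ?_, J2⟩; apply two_ext <;> simp [Matrix.mul_apply, Fin.sum_univ_two]; done

lemma two_cell_ff' (h : Three K) {F : Matrix (Fin 2) (Fin 2) K} (hF : Two F) :
    ∃ a, (F * a)ᵀ = F * a ∧ Cell (c3f K) (c3f' K) a := by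
  have h3 := h.1
  have hone := one_ne_zero (α := K)
  have Q1 : Cell (c3f K) (c3f' K) !![1, 1; 1, -1] := by
    refine cell_ff' h (A := !![0, -1; -1, -1]) (C := !![1, -1; -1, 0]) ?_ ?_ ?_ ?_
    · rw [Matrix.det_fin_two_of]; grind
    all_goals apply two_ext <;> simp [Matrix.mul_apply, Fin.sum_univ_two] <;> grind
  have Q2 : Cell (c3f K) (c3f' K) !![0, -1; 1, 0] := by
    refine cell_ff' h (A := !![1, 1; -1, 1]) (C := !![-1, 1; -1, -1]) ?_ ?_ ?_ ?_
    · rw [Matrix.det_fin_two_of]; grind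
    all_goals apply two_ext <;> simp [Matrix.mul_apply, Fin.sum_univ_two] <;> grind
  have J1 : Cell (c3f K) (c3f' K) !![1, 1; 0, 1] := by
    refine cell_ff' h (A := !![1, -1; 1, 1]) (C := !![0, 1; 1, 1]) ?_ ?_ ?_ ?_
    · rw [Matrix.det_fin_two_of]; grind
    all_goals apply two_ext <;> simp [Matrix.mul_apply, Fin.sum_univ_two] <;> grind
  have J2 : Cell (c3f K) (c3f' K) !![1, -1; 0, 1] := by
    refine cell_ff' h (A := !![1, 1; -1, 1]) (C := !![0, -1; -1, 1]) ?_ ?_ ?_ ?_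
    · rw [Matrix.det_fin_two_of]; grind
    all_goals apply two_ext <;> simp [Matrix.mul_apply, Fin.sum_univ_two] <;> grind
  rcases hF with ⟨t, ht, rfl⟩ | ⟨c, g, d, hc, hd, rfl⟩
  · exact ⟨_, symm_alt t 1 1 1, Q1⟩
  · have hc := (h.2 c).resolve_left hc
    have hd := (h.2 d).resolve_left hd
    rcases hc with rfl | rfl <;> rcases hd with rfl | rfl <;> rcases h.2 g with rfl | rfl | rfl <;>
    first
    | refine ⟨_, ?_, Q2⟩; apply two_ext <;> simp [Matrix.mul_apply, Fin.sum_univ_two]; done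
    | refine ⟨_, ?_, Q1⟩; apply two_ext <;> simp [Matrix.mul_apply, Fin.sum_univ_two]; done
    | refine ⟨_, ?_, J1⟩; apply two_ext <;> simp [Matrix.mul_apply, Fin.sum_univ_two]; done
    | refine ⟨_, ?_, J2⟩; apply two_ext <;> simp [Matrix.mul_apply, Fin.sum_univ_two]; done

/-- upper triangular solutions -/
lemma two_tri {F : Matrix (Fin 2) (Fin 2) K} (hF : Two F) :
    ∃ x, (F * !![1, x; 0, -1])ᵀ = F * !![1, x; 0, -1] := by
  rcases hF with ⟨t, ht, rfl⟩ | ⟨c, g, d, hc, hd, rfl⟩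
  · exact ⟨0, symm_alt t 1 0 0⟩
  · refine ⟨g / c, ?_⟩
    apply two_ext <;> simp [Matrix.mul_apply, Fin.sum_univ_two] <;> field_simp

lemma two_neg {F : Matrix (Fin 2) (Fin 2) K} (hF : Two F) :
    (F * !![0, -1; 1, 0])ᵀ = F * !![0, -1; 1, 0] ∨
      ∃ x, (F * !![-1, x; 0, -1])ᵀ = F * !![-1, x; 0, -1] := by
  rcases hF with ⟨t, ht, rfl⟩ | ⟨c, g, d, hc, hd, rfl⟩
  · left; simpa using symm_alt t 0 (-1) 1
  · right
    refine ⟨-g / c, ?_⟩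
    apply two_ext <;> simp [Matrix.mul_apply, Fin.sum_univ_two] <;> field_simp

end RC


section RC2
variable {K : Type u} [Field K]

lemma three_ext {A B : Matrix (Fin 3) (Fin 3) K} (h00 : A 0 0 = B 0 0) (h01 : A 0 1 = B 0 1)
    (h02 : A 0 2 = B 0 2) (h10 : A 1 0 = B 1 0) (h11 : A 1 1 = B 1 1) (h12 : A 1 2 = B 1 2)
    (h20 : A 2 0 = B 2 0) (h21 : A 2 1 = B 2 1) (h22 : A 2 2 = B 2 2) : A = B := by
  ext i j; fin_cases i <;> fin_cases j <;> assumption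

lemma good_D (h : Three K) (z : K) :
    Good (c3g K) (c3g' K) !![1, 0, 0; 0, -1, z; 0, 0, -1] := by
  have h3 := h.1
  have hone := one_ne_zero (α := K)
  rcases h.2 z with rfl | rfl | rfl
  · refine (cell_gg' h (A := !![-1, 0, 1; 0, 0, -1; 1, 1, 1])
      (C := !![-1, 0, 1; 0, 0, 1; -1, -1, -1]) ?_ ?_ ?_ ?_).good
    · rw [Matrix.det_fin_three]; simp
    all_goals apply three_ext <;> simp [Matrix.mul_apply, Fin.sum_univ_three] <;> grind
  · refine (cell_gg' h (A := !![0, 0, 1; 1, 0, 1; -1, -1, 0])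
      (C := !![0, 0, 1; 0, 1, -1; 1, 1, 0]) ?_ ?_ ?_ ?_).good
    · rw [Matrix.det_fin_three]; simp
    all_goals apply three_ext <;> simp [Matrix.mul_apply, Fin.sum_univ_three] <;> grind
  · refine (cell_gg' h (A := !![0, 0, 1; -1, 0, -1; -1, 1, 0])
      (C := !![0, 0, 1; 0, 1, 1; 1, -1, 0]) ?_ ?_ ?_ ?_).good
    · rw [Matrix.det_fin_three]; simp
    all_goals apply three_ext <;> simp [Matrix.mul_apply, Fin.sum_univ_three] <;> grind

lemma good_Q3 (h : Three K) :
    Good (c3g K) (c3g' K) !![0, -1, 0; 1, 0, 0; 0, 0, 1] := by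
  have h3 := h.1
  have hone := one_ne_zero (α := K)
  refine (cell_gg' h (A := !![0, -1, -1; 0, 0, 1; 1, -1, 0])
      (C := !![0, 0, 1; 0, 1, 1; 1, -1, 0]) ?_ ?_ ?_ ?_).good
  · rw [Matrix.det_fin_three]; simp
  all_goals apply three_ext <;> simp [Matrix.mul_apply, Fin.sum_univ_three] <;> grind

lemma cell_tri (h : Three K) (x y z : K) :
    Cell (c3g K) (c3g' K) !![1, x, y; 0, -1, z; 0, 0, -1] := by
  have h3 := h.1
  refine cell_of_good (c3g_irred h) (c3g'_irred h) (by simp) ?_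
    ((good_D h z).conj (P := !![1, x, y - x * z; 0, 1, 0; 0, 0, 1])
      (Q := !![1, -x, -(y - x * z); 0, 1, 0; 0, 0, 1]) ?_ ?_ ?_)
  · rw [isUnit_iff_ne_zero, Matrix.det_fin_three]; simp
  all_goals apply three_ext <;> simp [Matrix.mul_apply, Fin.sum_univ_three] <;> grind

lemma good_tri' (h : Three K) (x y z : K) :
    Good (c3g K) (c3g' K) !![-1, x, y; 0, -1, z; 0, 0, 1] := by
  have h3 := h.1
  have h1 : Good (c3g K) (c3g' K) !![-1, x, 0; 0, -1, 0; 0, 0, 1] := by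
    refine (good_D h x).conj (P := !![0, 1, 0; 0, 0, 1; 1, 0, 0])
      (Q := !![0, 0, 1; 1, 0, 0; 0, 1, 0]) ?_ ?_ ?_
    all_goals apply three_ext <;> simp [Matrix.mul_apply, Fin.sum_univ_three]
  refine h1.conj (P := !![1, 0, x * z - y; 0, 1, -z; 0, 0, 1])
      (Q := !![1, 0, -(x * z - y); 0, 1, z; 0, 0, 1]) ?_ ?_ ?_
  all_goals apply three_ext <;> simp [Matrix.mul_apply, Fin.sum_univ_three] <;> grind

lemma good_Q3' (h : Three K) (y z : K) :
    Good (c3g K) (c3g' K) !![0, -1, y; 1, 0, z; 0, 0, 1] := by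
  have h3 := h.1
  refine (good_Q3 h).conj (P := !![1, 0, z - y; 0, 1, -(y + z); 0, 0, 1])
      (Q := !![1, 0, -(z - y); 0, 1, y + z; 0, 0, 1]) ?_ ?_ ?_
  all_goals apply three_ext <;> simp [Matrix.mul_apply, Fin.sum_univ_three] <;> grind

/-- regrouping -/
def eqA (k : ℕ) : Fin 3 ⊕ Fin k ≃ Fin 2 ⊕ Fin (k + 1) where
  toFun := Sum.elim ![Sum.inl 0, Sum.inl 1, Sum.inr 0] (fun j => Sum.inr j.succ)
  invFun := Sum.elim ![Sum.inl 0, Sum.inl 1] (Fin.cases (Sum.inl 2) Sum.inr)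
  left_inv := by
    rintro (i | i)
    · fin_cases i <;> rfl
    · rfl
  right_inv := by
    rintro (i | i)
    · fin_cases i <;> rfl
    · refine Fin.cases ?_ (fun j => ?_) i <;> rfl

/-- regrouping -/
def eqB (k : ℕ) : Fin 3 ⊕ Fin k ≃ Unit ⊕ Fin (k + 2) where
  toFun := Sum.elim ![Sum.inl (), Sum.inr 0, Sum.inr 1] (fun j => Sum.inr j.succ.succ)
  invFun := Sum.elim (fun _ => Sum.inl 0)
    (Fin.cases (Sum.inl 1) (Fin.cases (Sum.inl 2) Sum.inr))
  left_inv := by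
    rintro (i | i)
    · fin_cases i <;> rfl
    · rfl
  right_inv := by
    rintro (i | i)
    · rfl
    · refine Fin.cases ?_ (fun j => ?_) i
      · rfl
      · refine Fin.cases ?_ (fun j => ?_) j <;> rfl

/-- no remainder -/
def eqC : Fin 3 ≃ Fin 2 ⊕ Fin 1 where
  toFun := ![Sum.inl 0, Sum.inl 1, Sum.inr 0]
  invFun := Sum.elim ![0, 1] (fun _ => 2)
  left_inv := by intro i; fin_cases i <;> rfl
  right_inv := by
    rintro (i | i)
    · fin_cases i <;> rfl
    · fin_cases i; rfl

lemma good_neg_f (m : ℕ) : Good (c3f K ^ m) (c3f' K ^ m) (-1 : Matrix (Fin (2 * m)) (Fin (2 * m)) K) := by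
  refine good_neg_one (c3f'_monic.pow _) (by
    rw [c3f'_monic.natDegree_pow, c3f'_deg, Fintype.card_fin]; ring) ?_
  rw [c3f'_monic.natDegree_pow, c3f'_deg, pow_comp]
  have : (c3f' K).comp (-X) = c3f K := by simp [c3f, c3f']
  rw [this, mul_comm m 2, pow_mul]; simp

section
variable {V : Type u} [AddCommGroup V] [Module K V] [FiniteDimensional K V]
  {ω : V →ₗ[K] V →ₗ[K] K} {M : V →ₗ[K] V}

lemma regroupA (h : Three K) {m : ℕ} {x : K} {b : Matrix (Fin 2) (Fin (2 * m + 1)) K}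
    (hf : FrameMat ω M (fromBlocks !![1, x; 0, -1] b 0 (-1))) :
    HasGood ω M (c3f K ^ m * c3g K) (c3f' K ^ m * c3g' K) := by
  have h1 := hf.reindex (eqA (2 * m))
  refine ⟨_, inferInstance, inferInstance, _, h1, ?_⟩
  have h2 := (cell_tri h x (b 0 0) (b 1 0)).link (good_neg_f m) (Matrix.of fun i j =>
    (![b 0 j.succ, b 1 j.succ, 0] : Fin 3 → K) i)
  rw [mul_comm (c3f K ^ m), mul_comm (c3f' K ^ m)]
  convert h2 using 1
  ext i j
  rcases i with i | i <;> rcases j with j | j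
  · fin_cases i <;> fin_cases j <;> simp [eqA]
  · fin_cases i <;> simp [eqA, Matrix.one_apply, (Fin.succ_ne_zero j).symm]
  · fin_cases j <;> simp [eqA, Matrix.one_apply, Fin.succ_ne_zero]
  · simp [eqA, Matrix.one_apply]

lemma regroupB (h : Three K) {m : ℕ}
    (hf : FrameMat ω M (fromBlocks ((1 : K) • (1 : Matrix Unit Unit K)) 0 0
      ((-1 : K) • (1 : Matrix (Fin (2 * m + 2)) (Fin (2 * m + 2)) K)))) :
    HasGood ω M (c3f K ^ m * c3g K) (c3f' K ^ m * c3g' K) := by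
  have h1 := hf.reindex (eqB (2 * m))
  refine ⟨_, inferInstance, inferInstance, _, h1, ?_⟩
  have h2 := (cell_tri h 0 0 0).link (good_neg_f m) 0
  rw [mul_comm (c3f K ^ m), mul_comm (c3f' K ^ m)]
  convert h2 using 1
  ext i j
  rcases i with i | i <;> rcases j with j | j
  · fin_cases i <;> fin_cases j <;> simp [eqB]
  · fin_cases i <;> simp [eqB, Matrix.one_apply, (Fin.succ_ne_zero j).symm, Fin.ext_iff]
  · fin_cases j <;> simp [eqB, Matrix.one_apply, Fin.succ_ne_zero, Fin.ext_iff]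
  · simp [eqB, Matrix.one_apply]

end

lemma c3_even (h : Three K) (m : ℕ) : ∀ (V : Type u) [AddCommGroup V] [Module K V]
    [FiniteDimensional K V] (ω : V →ₗ[K] V →ₗ[K] K) (M : V →ₗ[K] V), Iso ω M →
    Module.finrank K V = 2 * (2 * m) →
    HasGood ω M (c3f K ^ m) (c3f K ^ m) ∨ HasGood ω M (c3f K ^ m) (c3f' K ^ m) := by
  induction m with
  | zero =>
    intro V _ _ _ ω M H hr
    have : Subsingleton V := Module.finrank_zero_iff.1 (by omega : Module.finrank K V = 0)
    have hF := frameMat_smul H (m := 0) (by omega) (ε := 1) (fun x => Subsingleton.elim _ _)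
    rw [one_smul] at hF
    exact Or.inl ⟨_, inferInstance, inferInstance, _, hF, good_one (by simpa using monic_one) (by simp)⟩
  | succ m ih =>
    intro V _ _ _ ω M H hr
    have hdeg : (c3f K ^ (m + 1)).natDegree = 2 * (m + 1) := by
      rw [c3f_monic.natDegree_pow, c3f_deg]; ring
    rcases quad H with ⟨e, F, W, ω₁, M₁, ψ, hF, P⟩ | ⟨ε, he, hM⟩ | ⟨e, F, W, ω₁, M₁, ψ, P, ε, he, hM⟩
    · have hrk := P.rank
      simp only [Fintype.card_fin] at hrk
      rw [pow_succ', pow_succ']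
      rcases ih W ω₁ M₁ P.iso (by omega) with h1 | h1
      · obtain ⟨a, ha, hc⟩ := two_cell_ff h hF
        exact Or.inl (P.link h1 ha hc)
      · obtain ⟨a, ha, hc⟩ := two_cell_ff' h hF
        exact Or.inr (P.link h1 ha hc)
    · have hF := frameMat_smul H (m := 2 * (m + 1)) (by omega) hM
      rcases he with rfl | rfl
      · rw [one_smul] at hF
        exact Or.inl ⟨_, inferInstance, inferInstance, _, hF, good_one (c3f_monic.pow _) (by
          rw [hdeg]; simp)⟩
      · rw [neg_smul, one_smul] at hF
        exact Or.inr ⟨_, inferInstance, inferInstance, _, hF, good_neg_f _⟩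
    · have hF := one_scalar P (m := 2 * m + 1) (by omega) hM ε
      have hF : FrameMat ω M (ε • (1 : Matrix (Unit ⊕ Fin (2 * m + 1)) (Unit ⊕ Fin (2 * m + 1)) K)) := by
        rw [← fromBlocks_one, fromBlocks_smul, smul_zero, smul_zero]; exact hF
      have e : Fin (2 * (m + 1)) ≃ Unit ⊕ Fin (2 * m + 1) := Fintype.equivOfCardEq (by simp; ring)
      have hF := hF.reindex e
      have hs : (ε • (1 : Matrix (Unit ⊕ Fin (2 * m + 1)) (Unit ⊕ Fin (2 * m + 1)) K)).submatrix e e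
        = ε • 1 := by ext i j; simp [Matrix.one_apply]
      rw [hs] at hF
      rcases he with rfl | rfl
      · rw [one_smul] at hF
        exact Or.inl ⟨_, inferInstance, inferInstance, _, hF, good_one (c3f_monic.pow _) (by
          rw [hdeg]; simp)⟩
      · rw [neg_smul, one_smul] at hF
        exact Or.inr ⟨_, inferInstance, inferInstance, _, hF, good_neg_f _⟩

lemma c3_odd (h : Three K) (m : ℕ) : ∀ (V : Type u) [AddCommGroup V] [Module K V]
    [FiniteDimensional K V] (ω : V →ₗ[K] V →ₗ[K] K) (M : V →ₗ[K] V), Iso ω M →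
    Module.finrank K V = 2 * (2 * m + 3) → ¬ (∀ x, M x = -x) →
    HasGood ω M (c3f K ^ m * c3g K) (c3f K ^ m * c3g K) ∨
      HasGood ω M (c3f K ^ m * c3g K) (c3f' K ^ m * c3g' K) := by
  induction m with
  | zero =>
    intro V _ _ _ ω M H hr hne
    rcases quad H with ⟨e, F, W, ω₁, M₁, ψ, hF, P⟩ | ⟨ε, he, hM⟩ | ⟨e, F, W, ω₁, M₁, ψ, P, ε, he, hM⟩
    · have hrk := P.rank
      simp only [Fintype.card_fin] at hrk
      right
      obtain ⟨x, hx⟩ := two_tri hF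
      rcases rank_one P.iso (by omega) (c := -1) with h1 | ⟨ε, rfl | rfl, hM⟩
      · rw [neg_smul, one_smul] at h1
        obtain ⟨b, hb⟩ := P.lift h1 hx
        exact regroupA h (m := 0) hb
      · have h1 := frameMat_smul P.iso (m := 1) (by omega) hM
        rcases two_neg hF with hs | ⟨x, hs⟩
        · obtain ⟨b, hb⟩ := P.lift h1 hs
          refine ⟨_, inferInstance, inferInstance, _, hb.reindex eqC, ?_⟩
          have := good_Q3' h (b 0 0) (b 1 0)
          rw [pow_zero, pow_zero, one_mul, one_mul]
          convert this using 1
          apply three_ext <;> simp [eqC]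
        · obtain ⟨b, hb⟩ := P.lift h1 hs
          refine ⟨_, inferInstance, inferInstance, _, hb.reindex eqC, ?_⟩
          have := good_tri' h x (b 0 0) (b 1 0)
          rw [pow_zero, pow_zero, one_mul, one_mul]
          convert this using 1
          apply three_ext <;> simp [eqC]
      · have h1 := frameMat_smul P.iso (m := 1) (by omega) hM
        rw [neg_smul, one_smul] at h1
        obtain ⟨b, hb⟩ := P.lift h1 hx
        exact regroupA h (m := 0) hb
    · rcases he with rfl | rfl
      · have hF := frameMat_smul H (m := 3) (by omega) hM
        rw [one_smul] at hF
        left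
        refine ⟨_, inferInstance, inferInstance, _, hF, good_one ((c3f_monic.pow _).mul c3g_monic) ?_⟩
        rw [pow_zero, one_mul, c3g_deg]; simp
      · exact absurd (fun x => by rw [hM]; simp) hne
    · rcases he with rfl | rfl
      · have hF := one_scalar P (m := 2) (by omega) hM 1
        rw [one_smul, one_smul, fromBlocks_one] at hF
        left
        refine ⟨_, inferInstance, inferInstance, _, hF, good_one ((c3f_monic.pow _).mul c3g_monic) ?_⟩
        rw [pow_zero, one_mul, c3g_deg]; simp
      · right
        exact regroupB h (m := 0) (one_scalar P (m := 2) (by omega) hM 1)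
  | succ m ih =>
    intro V _ _ _ ω M H hr hne
    have hdeg : (c3f K ^ (m + 1) * c3g K).natDegree = 2 * (m + 1) + 3 := by
      rw [(c3f_monic.pow _).natDegree_mul c3g_monic, c3f_monic.natDegree_pow, c3f_deg, c3g_deg]; ring
    rcases quad H with ⟨e, F, W, ω₁, M₁, ψ, hF, P⟩ | ⟨ε, he, hM⟩ | ⟨e, F, W, ω₁, M₁, ψ, P, ε, he, hM⟩
    · have hrk := P.rank
      simp only [Fintype.card_fin] at hrk
      by_cases hM1 : ∀ x, M₁ x = -x
      · right
        have h1 := frameMat_smul P.iso (m := 2 * (m + 1) + 1) (by omega) (ε := -1)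
          (fun x => by rw [hM1]; simp)
        rw [neg_smul, one_smul] at h1
        obtain ⟨x, hx⟩ := two_tri hF
        obtain ⟨b, hb⟩ := P.lift h1 hx
        exact regroupA h hb
      · rw [pow_succ', pow_succ', mul_assoc, mul_assoc]
        rcases ih W ω₁ M₁ P.iso (by omega) hM1 with h1 | h1
        · obtain ⟨a, ha, hc⟩ := two_cell_ff h hF
          exact Or.inl (P.link h1 ha hc)
        · obtain ⟨a, ha, hc⟩ := two_cell_ff' h hF
          exact Or.inr (P.link h1 ha hc)
    · rcases he with rfl | rfl
      · have hF := frameMat_smul H (m := 2 * (m + 1) + 3) (by omega) hM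
        rw [one_smul] at hF
        left
        refine ⟨_, inferInstance, inferInstance, _, hF, good_one ((c3f_monic.pow _).mul c3g_monic) ?_⟩
        rw [hdeg]; simp
      · exact absurd (fun x => by rw [hM]; simp) hne
    · rcases he with rfl | rfl
      · have hF := one_scalar P (m := 2 * (m + 1) + 2) (by omega) hM 1
        rw [one_smul, one_smul, fromBlocks_one] at hF
        left
        refine ⟨_, inferInstance, inferInstance, _, hF, good_one ((c3f_monic.pow _).mul c3g_monic) ?_⟩
        rw [hdeg]; simp; ring
      · right
        exact regroupB h (one_scalar P (m := 2 * (m + 1) + 2) (by omega) hM 1)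

theorem concl_RC (h : Three K) {n : ℕ} (hn : 2 ≤ n) : Concl n K := by
  have f0 : (c3f K).coeff 0 ≠ 0 := by simp [c3f, coeff_zero_eq_eval_zero]
  have g0 : (c3g K).coeff 0 ≠ 0 := by simp [c3g, coeff_zero_eq_eval_zero]
  rcases Nat.even_or_odd' n with ⟨m, rfl | rfl⟩
  · have hrec : recipPoly (c3f K ^ m) = c3f' K ^ m := by rw [recip_pow, recip_c3f]
    refine assemble (q := c3f K ^ m) (c3f_monic.pow _) ?_ (coeff_zero_pow_ne f0 _) ?_ ?_
    · rw [c3f_monic.natDegree_pow, c3f_deg]; ring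
    · rw [hrec]; simpa using c3_cop h m 0
    · intro V _ _ _ ω M H hr _
      rw [hrec]
      exact c3_even h m V ω M H hr
  · obtain ⟨m, rfl⟩ : ∃ k, m = k + 1 := ⟨m - 1, by omega⟩
    have hrec : recipPoly (c3f K ^ m * c3g K) = c3f' K ^ m * c3g' K := by
      rw [recip_mul, recip_pow, recip_c3f, recip_c3g]
    refine assemble (q := c3f K ^ m * c3g K) ((c3f_monic.pow _).mul c3g_monic) ?_
      (coeff_zero_mul_ne (coeff_zero_pow_ne f0 _) g0) ?_ ?_
    · rw [(c3f_monic.pow _).natDegree_mul c3g_monic, c3f_monic.natDegree_pow, c3f_deg, c3g_deg]; ring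
    · rw [hrec]; simpa using c3_cop h m 1
    · intro V _ _ _ ω M H hr hne
      rw [hrec]
      exact c3_odd h m V ω M H (by omega) hne

end RC2


section RD
variable {K : Type u} [Field K]

/-- polynomial of degree three -/
def d2f (K : Type u) [Field K] : K[X] := X ^ 3 + X + 1
/-- its reciprocal -/
def d2f' (K : Type u) [Field K] : K[X] := X ^ 3 + X ^ 2 + 1
/-- polynomial of degree four -/
def d2g4 (K : Type u) [Field K] : K[X] := X ^ 4 + X + 1
/-- its reciprocal -/
def d2g4' (K : Type u) [Field K] : K[X] := X ^ 4 + X ^ 3 + 1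
/-- polynomial of degree five -/
def d2g5 (K : Type u) [Field K] : K[X] := X ^ 5 + X ^ 2 + 1
/-- its reciprocal -/
def d2g5' (K : Type u) [Field K] : K[X] := X ^ 5 + X ^ 3 + 1

lemma d2f_monic : (d2f K).Monic := by unfold d2f; monicity!
lemma d2g4_monic : (d2g4 K).Monic := by unfold d2g4; monicity!
lemma d2g5_monic : (d2g5 K).Monic := by unfold d2g5; monicity!
lemma d2f_deg : (d2f K).natDegree = 3 := by unfold d2f; compute_degree!
lemma d2g4_deg : (d2g4 K).natDegree = 4 := by unfold d2g4; compute_degree!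
lemma d2g5_deg : (d2g5 K).natDegree = 5 := by unfold d2g5; compute_degree!

lemma d2f_irred (h : ∀ x : K, x = 0 ∨ x = 1) (h2 : (2 : K) = 0) : Irreducible (d2f K) := by
  refine irred_small d2f_monic (by rw [d2f_deg]; norm_num) (by rw [d2f_deg]) ?_
  intro x
  have := one_ne_zero (α := K)
  rcases h x with rfl | rfl <;> simp [d2f] <;> grind

lemma recip_d2f : recipPoly (d2f K) = d2f' K := by
  have h0 : (d2f K).coeff 0 = 1 := by simp [d2f, coeff_zero_eq_eval_zero]
  rw [recipPoly, h0, reverse, d2f_deg, d2f, reflect_add, reflect_add, reflect_X_pow _ _ le_rfl]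
  have h1 := reflect_X_pow (K := K) 3 1 (by norm_num)
  have h2 := reflect_X_pow (K := K) 3 0 (by norm_num)
  rw [pow_one] at h1; rw [pow_zero] at h2
  rw [h1, h2, d2f']
  simp; ring

lemma recip_d2g4 : recipPoly (d2g4 K) = d2g4' K := by
  have h0 : (d2g4 K).coeff 0 = 1 := by simp [d2g4, coeff_zero_eq_eval_zero]
  rw [recipPoly, h0, reverse, d2g4_deg, d2g4, reflect_add, reflect_add, reflect_X_pow _ _ le_rfl]
  have h1 := reflect_X_pow (K := K) 4 1 (by norm_num)
  have h2 := reflect_X_pow (K := K) 4 0 (by norm_num)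
  rw [pow_one] at h1; rw [pow_zero] at h2
  rw [h1, h2, d2g4']
  simp; ring

lemma recip_d2g5 : recipPoly (d2g5 K) = d2g5' K := by
  have h0 : (d2g5 K).coeff 0 = 1 := by simp [d2g5, coeff_zero_eq_eval_zero]
  rw [recipPoly, h0, reverse, d2g5_deg, d2g5, reflect_add, reflect_add, reflect_X_pow _ _ le_rfl]
  have h1 := reflect_X_pow (K := K) 5 2 (by norm_num)
  have h2 := reflect_X_pow (K := K) 5 0 (by norm_num)
  rw [pow_zero] at h2
  rw [h1, h2, d2g5']
  simp; ring

section cop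
lemma two_poly (h2 : (2 : K) = 0) : (2 : K[X]) = 0 := by
  rw [← C_ofNat, h2, C_0]

lemma cop_ff (h2 : (2 : K) = 0) : IsCoprime (d2f K) (d2f' K) := by
  have h := two_poly h2
  unfold d2f d2f'
  exact ⟨X, X + 1, by linear_combination (X + X^2 + X^3 + X^4) * h⟩
lemma cop_f4 (h2 : (2 : K) = 0) : IsCoprime (d2f K) (d2g4' K) := by
  have h := two_poly h2
  unfold d2f d2g4'
  exact ⟨X^3 + X, X^2 + X + 1, by linear_combination (X + X^2 + X^3 + 2*X^4 + X^5 + X^6) * h⟩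
lemma cop_4f (h2 : (2 : K) = 0) : IsCoprime (d2g4 K) (d2f' K) := by
  have h := two_poly h2
  unfold d2g4 d2f'
  exact ⟨X + 1, X^2, by linear_combination (X + X^2 + X^4 + X^5) * h⟩
lemma cop_44 (h2 : (2 : K) = 0) : IsCoprime (d2g4 K) (d2g4' K) := by
  have h := two_poly h2
  unfold d2g4 d2g4'
  exact ⟨X^3 + X + 1, X^3 + X^2, by
    linear_combination (X + X^2 + X^3 + X^4 + X^5 + X^6 + X^7) * h⟩
lemma cop_f5 (h2 : (2 : K) = 0) : IsCoprime (d2f K) (d2g5' K) := by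
  have h := two_poly h2
  unfold d2f d2g5'
  exact ⟨X^3 + 1, X, by linear_combination (X + X^3 + X^4 + X^6) * h⟩
lemma cop_5f (h2 : (2 : K) = 0) : IsCoprime (d2g5 K) (d2f' K) := by
  have h := two_poly h2
  unfold d2g5 d2f'
  exact ⟨X, X^3 + X^2 + X + 1, by linear_combination (X + X^2 + 2*X^3 + X^4 + X^5 + X^6) * h⟩
lemma cop_55 (h2 : (2 : K) = 0) : IsCoprime (d2g5 K) (d2g5' K) := by
  have h := two_poly h2
  unfold d2g5 d2g5'
  exact ⟨X^2 + X, X^2 + X + 1, by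
    linear_combination (X + X^2 + X^3 + X^4 + X^5 + X^6 + X^7) * h⟩
end cop

lemma cyc_shift {d : ℕ} {A : Matrix (Fin d) (Fin d) K} {p : K[X]} (hm : p.Monic)
    (hd : p.natDegree = d) (v : Fin d → K)
    (hp : aeval A p *ᵥ v = 0) (hj : ∀ j : Fin d, A ^ (j : ℕ) *ᵥ v = Pi.single j 1) : Cyc A p := by
  refine ⟨hm, by simpa using hd, v, hp, fun w => ⟨∑ j : Fin d, C (w j) * X ^ (j : ℕ), ?_⟩⟩
  rw [map_sum, Matrix.sum_mulVec]
  have : ∀ j : Fin d, aeval A (C (w j) * X ^ (j : ℕ)) *ᵥ v = w j • Pi.single j 1 := by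
    intro j
    rw [map_mul, aeval_C, map_pow, aeval_X, Algebra.algebraMap_eq_smul_one, Matrix.smul_mul,
      Matrix.one_mul, Matrix.smul_mulVec, hj]
  rw [Finset.sum_congr rfl fun j _ => this j]
  ext i
  simp [Finset.sum_apply, Pi.single_apply]

lemma cyc_f (h : (2 : K) = 0) : Cyc (!![0, 0, 1; 1, 0, 1; 0, 1, 0] : Matrix (Fin 3) (Fin 3) K) (d2f K) := by
  have h0 : ∀ x : K, x + x = 0 := fun x => by linear_combination x * h
  have hp : ∀ k (v : Fin 3 → K), (!![0, 0, 1; 1, 0, 1; 0, 1, 0] : Matrix (Fin 3) (Fin 3) K) ^ (k + 1) *ᵥ v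
      = (!![0, 0, 1; 1, 0, 1; 0, 1, 0] : Matrix (Fin 3) (Fin 3) K) ^ k *ᵥ ![v 2, v 0 + v 2, v 1] := by
    intro k v
    rw [pow_succ, ← Matrix.mulVec_mulVec]
    congr 1
    ext i; fin_cases i <;> simp [Matrix.mulVec, dotProduct, Fin.sum_univ_succ]
  refine cyc_shift d2f_monic d2f_deg ![1, 0, 0] ?_ ?_
  · rw [d2f, map_add, map_add, map_pow, aeval_X, map_one, Matrix.add_mulVec, Matrix.add_mulVec]
    have h1 := hp 0
    rw [zero_add, pow_one] at h1
    rw [hp 2, hp 1, hp 0, h1, pow_zero, Matrix.one_mulVec, Matrix.one_mulVec, Matrix.one_mulVec]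
    ext i; fin_cases i <;> simp [h0]
  · intro j
    fin_cases j
    · simp only [pow_zero, Matrix.one_mulVec]; ext i; fin_cases i <;> simp
    · refine (hp 0 _).trans ?_; rw [pow_zero, Matrix.one_mulVec]; ext i; fin_cases i <;> simp
    · simp only []; rw [hp 1, hp 0, pow_zero, Matrix.one_mulVec]; ext i; fin_cases i <;> simp

lemma cyc_g4 (h : (2 : K) = 0) : Cyc (!![0, 0, 0, 1; 1, 0, 0, 1; 0, 1, 0, 0; 0, 0, 1, 0] : Matrix (Fin 4) (Fin 4) K) (d2g4 K) := by
  have h0 : ∀ x : K, x + x = 0 := fun x => by linear_combination x * h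
  set A := (!![0, 0, 0, 1; 1, 0, 0, 1; 0, 1, 0, 0; 0, 0, 1, 0] : Matrix (Fin 4) (Fin 4) K) with hA
  have hp : ∀ k (v : Fin 4 → K), A ^ (k + 1) *ᵥ v
      = A ^ k *ᵥ ![v 3, v 0 + v 3, v 1, v 2] := by
    intro k v
    rw [pow_succ, ← Matrix.mulVec_mulVec]
    congr 1
    ext i; fin_cases i <;> simp [hA, Matrix.mulVec, dotProduct, Fin.sum_univ_succ]
  refine cyc_shift d2g4_monic d2g4_deg ![1, 0, 0, 0] ?_ ?_
  · rw [d2g4, map_add, map_add, map_pow, aeval_X, map_one, Matrix.add_mulVec, Matrix.add_mulVec]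
    have h1 := hp 0
    rw [zero_add, pow_one] at h1
    rw [hp 3, hp 2, hp 1, hp 0, h1, pow_zero, Matrix.one_mulVec, Matrix.one_mulVec, Matrix.one_mulVec]
    ext i; fin_cases i <;> simp [h0]
  · intro j
    fin_cases j
    · simp only [pow_zero, Matrix.one_mulVec]; ext i; fin_cases i <;> simp
    · refine (hp 0 _).trans ?_; rw [pow_zero, Matrix.one_mulVec]; ext i; fin_cases i <;> simp
    · simp only []; rw [hp 1, hp 0, pow_zero, Matrix.one_mulVec]; ext i; fin_cases i <;> simp
    · simp only []; rw [hp 2, hp 1, hp 0, pow_zero, Matrix.one_mulVec]; ext i; fin_cases i <;> simp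

lemma cyc_g5 (h : (2 : K) = 0) : Cyc (!![0, 0, 0, 0, 1; 1, 0, 0, 0, 0; 0, 1, 0, 0, 1; 0, 0, 1, 0, 0; 0, 0, 0, 1, 0] : Matrix (Fin 5) (Fin 5) K) (d2g5 K) := by
  have h0 : ∀ x : K, x + x = 0 := fun x => by linear_combination x * h
  set A := (!![0, 0, 0, 0, 1; 1, 0, 0, 0, 0; 0, 1, 0, 0, 1; 0, 0, 1, 0, 0; 0, 0, 0, 1, 0] : Matrix (Fin 5) (Fin 5) K) with hA
  have hp : ∀ k (v : Fin 5 → K), A ^ (k + 1) *ᵥ v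
      = A ^ k *ᵥ ![v 4, v 0, v 1 + v 4, v 2, v 3] := by
    intro k v
    rw [pow_succ, ← Matrix.mulVec_mulVec]
    congr 1
    ext i; fin_cases i <;> simp [hA, Matrix.mulVec, dotProduct, Fin.sum_univ_succ]
  refine cyc_shift d2g5_monic d2g5_deg ![1, 0, 0, 0, 0] ?_ ?_
  · rw [d2g5, map_add, map_add, map_pow, map_pow, aeval_X, map_one, Matrix.add_mulVec, Matrix.add_mulVec]
    rw [hp 4, hp 3, hp 2, hp 1, hp 1, hp 0, hp 0, pow_zero, Matrix.one_mulVec, Matrix.one_mulVec, Matrix.one_mulVec]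
    ext i; fin_cases i <;> simp [h0]
  · intro j
    fin_cases j
    · simp only [pow_zero, Matrix.one_mulVec]; ext i; fin_cases i <;> simp
    · refine (hp 0 _).trans ?_; rw [pow_zero, Matrix.one_mulVec]; ext i; fin_cases i <;> simp
    · simp only []; rw [hp 1, hp 0, pow_zero, Matrix.one_mulVec]; ext i; fin_cases i <;> simp
    · simp only []; rw [hp 2, hp 1, hp 0, pow_zero, Matrix.one_mulVec]; ext i; fin_cases i <;> simp
    · simp only []; rw [hp 3, hp 2, hp 1, hp 0, pow_zero, Matrix.one_mulVec]; ext i; fin_cases i <;> simp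

lemma good_of_zmod (h : (2 : K) = 0) {d : ℕ} {CK aK : Matrix (Fin d) (Fin d) K} {p : K[X]}
    (hc : Cyc CK p) {a U L U' L' Cp : Matrix (Fin d) (Fin d) (ZMod 2)}
    (hC : ∀ φ : ZMod 2 →+* K, Cp.map φ = CK) (ha : ∀ φ : ZMod 2 →+* K, a.map φ = aK)
    (h1 : U * L = 1) (h2 : L * U = 1) (h3 : U' * L' = 1) (h4 : L' * U' = 1)
    (h5 : U * Cp * L = a * (U' * Cp * L')) : Good p p aK := by
  have : CharP K 2 := CharTwo.of_one_ne_zero_of_two_eq_zero one_ne_zero h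
  let φ : ZMod 2 →+* K := ZMod.castHom (dvd_refl 2) K
  have m1 : ∀ {A B : Matrix (Fin d) (Fin d) (ZMod 2)}, A * B = 1 → A.map φ * B.map φ = 1 := by
    intro A B hAB
    rw [← Matrix.map_mul, hAB, Matrix.map_one _ φ.map_zero φ.map_one]
  refine ⟨U.map φ * CK * L.map φ, U'.map φ * CK * L'.map φ, ?_, hc.conj (m1 h1) (m1 h2),
    hc.conj (m1 h3) (m1 h4)⟩
  rw [← hC φ, ← ha φ]
  simp only [← Matrix.map_mul]
  rw [h5]


lemma good_cf (h : (2 : K) = 0) : Good (d2f K) (d2f K) (!![0, 0, 1; 1, 0, 1; 0, 1, 0] : Matrix (Fin 3) (Fin 3) K) := by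
  refine good_of_zmod h (cyc_f h)
    (a := !![0, 0, 1; 1, 0, 1; 0, 1, 0])
    (U := !![0, 0, 1; 0, 1, 0; 1, 1, 1])
    (L := !![1, 1, 1; 0, 1, 0; 1, 0, 0])
    (U' := !![0, 1, 0; 0, 1, 1; 1, 0, 1])
    (L' := !![1, 1, 1; 1, 0, 0; 1, 1, 0])
    (Cp := !![0, 0, 1; 1, 0, 1; 0, 1, 0])
    (fun φ => by ext i j; fin_cases i <;> fin_cases j <;> simp)
    (fun φ => by ext i j; fin_cases i <;> fin_cases j <;> simp)
    (by decide +kernel) (by decide +kernel) (by decide +kernel) (by decide +kernel) (by decide +kernel)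

lemma good_om1 (h : (2 : K) = 0) : Good (d2f K) (d2f K) (!![0, 1, 0; 1, 1, 0; 0, 0, 1] : Matrix (Fin 3) (Fin 3) K) := by
  refine good_of_zmod h (cyc_f h)
    (a := !![0, 1, 0; 1, 1, 0; 0, 0, 1])
    (U := !![0, 1, 0; 0, 0, 1; 1, 1, 0])
    (L := !![1, 0, 1; 1, 0, 0; 0, 1, 0])
    (U' := !![0, 1, 0; 0, 1, 1; 1, 1, 0])
    (L' := !![1, 0, 1; 1, 0, 0; 1, 1, 0])
    (Cp := !![0, 0, 1; 1, 0, 1; 0, 1, 0])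
    (fun φ => by ext i j; fin_cases i <;> fin_cases j <;> simp)
    (fun φ => by ext i j; fin_cases i <;> fin_cases j <;> simp)
    (by decide +kernel) (by decide +kernel) (by decide +kernel) (by decide +kernel) (by decide +kernel)

lemma good_om2 (h : (2 : K) = 0) : Good (d2g4 K) (d2g4 K) (!![0, 1, 0, 0; 1, 1, 0, 0; 0, 0, 1, 0; 0, 0, 0, 1] : Matrix (Fin 4) (Fin 4) K) := by
  refine good_of_zmod h (cyc_g4 h)
    (a := !![0, 1, 0, 0; 1, 1, 0, 0; 0, 0, 1, 0; 0, 0, 0, 1])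
    (U := !![0, 1, 0, 0; 0, 1, 1, 1; 0, 1, 1, 0; 1, 1, 1, 1])
    (L := !![0, 1, 0, 1; 1, 0, 0, 0; 1, 0, 1, 0; 0, 1, 1, 0])
    (U' := !![0, 0, 1, 0; 0, 1, 0, 1; 0, 1, 0, 0; 1, 1, 1, 1])
    (L' := !![1, 1, 0, 1; 0, 0, 1, 0; 1, 0, 0, 0; 0, 1, 1, 0])
    (Cp := !![0, 0, 0, 1; 1, 0, 0, 1; 0, 1, 0, 0; 0, 0, 1, 0])
    (fun φ => by ext i j; fin_cases i <;> fin_cases j <;> simp)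
    (fun φ => by ext i j; fin_cases i <;> fin_cases j <;> simp)
    (by decide +kernel) (by decide +kernel) (by decide +kernel) (by decide +kernel) (by decide +kernel)

lemma good_cf1 (h : (2 : K) = 0) : Good (d2g4 K) (d2g4 K) (!![0, 0, 1, 0; 1, 0, 1, 0; 0, 1, 0, 0; 0, 0, 0, 1] : Matrix (Fin 4) (Fin 4) K) := by
  refine good_of_zmod h (cyc_g4 h)
    (a := !![0, 0, 1, 0; 1, 0, 1, 0; 0, 1, 0, 0; 0, 0, 0, 1])
    (U := !![0, 1, 1, 1; 0, 1, 0, 0; 0, 0, 0, 1; 1, 0, 1, 1])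
    (L := !![1, 1, 0, 1; 0, 1, 0, 0; 1, 1, 1, 0; 0, 0, 1, 0])
    (U' := !![0, 0, 1, 1; 0, 0, 1, 0; 0, 1, 0, 1; 1, 0, 0, 1])
    (L' := !![1, 1, 0, 1; 1, 1, 1, 0; 0, 1, 0, 0; 1, 1, 0, 0])
    (Cp := !![0, 0, 0, 1; 1, 0, 0, 1; 0, 1, 0, 0; 0, 0, 1, 0])
    (fun φ => by ext i j; fin_cases i <;> fin_cases j <;> simp)
    (fun φ => by ext i j; fin_cases i <;> fin_cases j <;> simp)
    (by decide +kernel) (by decide +kernel) (by decide +kernel) (by decide +kernel) (by decide +kernel)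

lemma good_om3 (h : (2 : K) = 0) : Good (d2g5 K) (d2g5 K) (!![0, 1, 0, 0, 0; 1, 1, 0, 0, 0; 0, 0, 1, 0, 0; 0, 0, 0, 1, 0; 0, 0, 0, 0, 1] : Matrix (Fin 5) (Fin 5) K) := by
  refine good_of_zmod h (cyc_g5 h)
    (a := !![0, 1, 0, 0, 0; 1, 1, 0, 0, 0; 0, 0, 1, 0, 0; 0, 0, 0, 1, 0; 0, 0, 0, 0, 1])
    (U := !![0, 1, 1, 0, 1; 0, 1, 1, 0, 0; 0, 1, 0, 1, 0; 0, 0, 0, 1, 1; 1, 0, 1, 0, 0])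
    (L := !![1, 0, 1, 1, 1; 1, 1, 1, 1, 0; 1, 0, 1, 1, 0; 1, 1, 0, 1, 0; 1, 1, 0, 0, 0])
    (U' := !![0, 0, 1, 0, 0; 0, 1, 1, 1, 0; 0, 1, 0, 0, 0; 0, 0, 0, 1, 1; 1, 0, 0, 0, 0])
    (L' := !![0, 0, 0, 0, 1; 0, 0, 1, 0, 0; 1, 0, 0, 0, 0; 1, 1, 1, 0, 0; 1, 1, 1, 1, 0])
    (Cp := !![0, 0, 0, 0, 1; 1, 0, 0, 0, 0; 0, 1, 0, 0, 1; 0, 0, 1, 0, 0; 0, 0, 0, 1, 0])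
    (fun φ => by ext i j; fin_cases i <;> fin_cases j <;> simp)
    (fun φ => by ext i j; fin_cases i <;> fin_cases j <;> simp)
    (by decide +kernel) (by decide +kernel) (by decide +kernel) (by decide +kernel) (by decide +kernel)

lemma good_cf2 (h : (2 : K) = 0) : Good (d2g5 K) (d2g5 K) (!![0, 0, 1, 0, 0; 1, 0, 1, 0, 0; 0, 1, 0, 0, 0; 0, 0, 0, 1, 0; 0, 0, 0, 0, 1] : Matrix (Fin 5) (Fin 5) K) := by
  refine good_of_zmod h (cyc_g5 h)
    (a := !![0, 0, 1, 0, 0; 1, 0, 1, 0, 0; 0, 1, 0, 0, 0; 0, 0, 0, 1, 0; 0, 0, 0, 0, 1])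
    (U := !![0, 1, 0, 0, 1; 0, 0, 1, 0, 1; 0, 1, 0, 0, 0; 0, 1, 0, 1, 0; 1, 0, 0, 1, 0])
    (L := !![0, 0, 1, 1, 1; 0, 0, 1, 0, 0; 1, 1, 1, 0, 0; 0, 0, 1, 1, 0; 1, 0, 1, 0, 0])
    (U' := !![0, 1, 1, 1, 1; 0, 1, 0, 0, 0; 0, 1, 0, 1, 0; 0, 1, 1, 1, 0; 1, 0, 1, 0, 0])
    (L' := !![0, 0, 1, 1, 1; 0, 1, 0, 0, 0; 0, 0, 1, 1, 0; 0, 1, 1, 0, 0; 1, 0, 0, 1, 0])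
    (Cp := !![0, 0, 0, 0, 1; 1, 0, 0, 0, 0; 0, 1, 0, 0, 1; 0, 0, 1, 0, 0; 0, 0, 0, 1, 0])
    (fun φ => by ext i j; fin_cases i <;> fin_cases j <;> simp)
    (fun φ => by ext i j; fin_cases i <;> fin_cases j <;> simp)
    (by decide +kernel) (by decide +kernel) (by decide +kernel) (by decide +kernel) (by decide +kernel)

lemma good_cfJ (h : (2 : K) = 0) : Good (d2g5 K) (d2g5 K) (!![0, 0, 1, 0, 0; 1, 0, 1, 0, 0; 0, 1, 0, 0, 0; 0, 0, 0, 1, 1; 0, 0, 0, 0, 1] : Matrix (Fin 5) (Fin 5) K) := by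
  refine good_of_zmod h (cyc_g5 h)
    (a := !![0, 0, 1, 0, 0; 1, 0, 1, 0, 0; 0, 1, 0, 0, 0; 0, 0, 0, 1, 1; 0, 0, 0, 0, 1])
    (U := !![0, 0, 1, 0, 1; 0, 0, 0, 1, 0; 0, 1, 1, 1, 1; 0, 1, 0, 1, 1; 1, 0, 1, 1, 0])
    (L := !![0, 1, 1, 1, 1; 1, 1, 1, 0, 0; 0, 0, 1, 1, 0; 0, 1, 0, 0, 0; 1, 0, 1, 1, 0])
    (U' := !![0, 0, 0, 1, 0; 0, 1, 0, 0, 0; 0, 0, 1, 0, 0; 0, 1, 0, 0, 1; 1, 0, 0, 0, 1])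
    (L' := !![0, 1, 0, 1, 1; 0, 1, 0, 0, 0; 0, 0, 1, 0, 0; 1, 0, 0, 0, 0; 0, 1, 0, 1, 0])
    (Cp := !![0, 0, 0, 0, 1; 1, 0, 0, 0, 0; 0, 1, 0, 0, 1; 0, 0, 1, 0, 0; 0, 0, 0, 1, 0])
    (fun φ => by ext i j; fin_cases i <;> fin_cases j <;> simp)
    (fun φ => by ext i j; fin_cases i <;> fin_cases j <;> simp)
    (by decide +kernel) (by decide +kernel) (by decide +kernel) (by decide +kernel) (by decide +kernel)

end RD


section RD2
variable {K : Type u} [Field K]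

lemma clear_block {ι κ : Type} [Fintype ι] [DecidableEq ι] [Fintype κ] [DecidableEq κ]
    {a R : Matrix ι ι K} {N : Matrix κ κ K} {p q : K[X]} (hR : (1 - a) * R = 1) (hN : N * N = 0)
    (h : Good p q (fromBlocks a 0 0 (1 + N))) (b : Matrix ι κ K) :
    Good p q (fromBlocks a b 0 (1 + N)) := by
  have key : (R * b - R * (R * b) * N) * (1 + N) - a * (R * b - R * (R * b) * N) = b := by
    have e1 : (1 - a) * (R * b - R * (R * b) * N) = b - R * b * N := by
      rw [Matrix.mul_sub, ← Matrix.mul_assoc, hR, Matrix.one_mul, ← Matrix.mul_assoc,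
        ← Matrix.mul_assoc (1 - a) R, hR, Matrix.one_mul]
    have e2 : (R * b - R * (R * b) * N) * N = R * b * N := by
      rw [Matrix.sub_mul, Matrix.mul_assoc _ N N, hN, Matrix.mul_zero, sub_zero]
    rw [Matrix.mul_add, e2, Matrix.mul_one]
    rw [Matrix.sub_mul, Matrix.one_mul] at e1
    rw [add_sub_right_comm, e1, sub_add_cancel]
  generalize R * b - R * (R * b) * N = Y at key
  refine h.conj (P := fromBlocks 1 Y 0 1) (Q := fromBlocks 1 (-Y) 0 1) ?_ ?_ ?_
  · simp [fromBlocks_multiply, ← fromBlocks_one]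
  · simp [fromBlocks_multiply, ← fromBlocks_one]
  · simp only [fromBlocks_multiply, Matrix.one_mul, Matrix.mul_zero, Matrix.zero_mul, add_zero,
      zero_add, Matrix.mul_one]
    congr 1
    rw [← key, Matrix.mul_neg]; abel

lemma conj_block {ι κ : Type} [Fintype ι] [DecidableEq ι] [Fintype κ] [DecidableEq κ]
    {a a' P Q : Matrix ι ι K} {D : Matrix κ κ K} {p q : K[X]} (h1 : P * Q = 1) (h2 : Q * P = 1)
    (ha : P * a * Q = a') (h : Good p q (fromBlocks a 0 0 D)) :
    Good p q (fromBlocks a' 0 0 D) := by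
  refine h.conj (P := fromBlocks P 0 0 1) (Q := fromBlocks Q 0 0 1) ?_ ?_ ?_
  · simp [fromBlocks_multiply, h1]
  · simp [fromBlocks_multiply, h2]
  · simp [fromBlocks_multiply, ha]

lemma aeval_d2f {ι : Type} [Fintype ι] [DecidableEq ι] (a : Matrix ι ι K) :
    aeval a (d2f K) = a * a * a + a + 1 := by
  simp [d2f, pow_succ]

lemma simil_f (hall : ∀ x : K, x = 0 ∨ x = 1) (h2 : (2 : K) = 0) {a : Matrix (Fin 3) (Fin 3) K}
    (ha : a * a * a + a + 1 = 0) :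
    ∃ P Q : Matrix (Fin 3) (Fin 3) K, P * Q = 1 ∧ Q * P = 1 ∧ P * !![0, 0, 1; 1, 0, 1; 0, 1, 0] * Q = a :=
  (cyc_f h2).similar (cyc_of_irred (d2f_irred hall h2) d2f_monic (by rw [d2f_deg]; simp)
    (by rw [aeval_d2f, ha]))

lemma two_mat (h2 : (2 : K) = 0) {ι κ : Type} (a : Matrix ι κ K) : a + a = 0 := by
  ext i j; simp only [Matrix.add_apply, Matrix.zero_apply]; linear_combination a i j * h2

lemma good_f_block (hall : ∀ x : K, x = 0 ∨ x = 1) (h2 : (2 : K) = 0)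
    {a : Matrix (Fin 3) (Fin 3) K} (ha : a * a * a + a + 1 = 0) {κ : Type} [Fintype κ]
    [DecidableEq κ] {N : Matrix κ κ K} (hN : N * N = 0) {p q : K[X]}
    (h : Good p q (fromBlocks !![0, 0, 1; 1, 0, 1; 0, 1, 0] 0 0 (1 + N))) (b : Matrix (Fin 3) κ K) :
    Good p q (fromBlocks a b 0 (1 + N)) := by
  obtain ⟨P, Q, h1, h1', h3⟩ := simil_f hall h2 ha
  refine clear_block (R := a + a * a) ?_ hN (conj_block h1 h1' h3 h) b
  have e2 : (1 - a) * (a + a * a) = (a * a * a + a + 1) - (a * a * a + a * a * a) + (-1 : Matrix (Fin 3) (Fin 3) K) := by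
    noncomm_ring
  rw [e2, ha, two_mat h2, sub_zero, zero_add]
  have := two_mat h2 (1 : Matrix (Fin 3) (Fin 3) K)
  exact neg_eq_of_add_eq_zero_left this

lemma cell_f (hall : ∀ x : K, x = 0 ∨ x = 1) (h2 : (2 : K) = 0) {a : Matrix (Fin 3) (Fin 3) K}
    (ha : a * a * a + a + 1 = 0) : Cell (d2f K) (d2f K) a := by
  obtain ⟨P, Q, h1, h1', h3⟩ := simil_f hall h2 ha
  have hi := d2f_irred hall h2
  have hc : Cyc a (d2f K) := cyc_of_irred hi d2f_monic (by rw [d2f_deg]; simp) (by rw [aeval_d2f, ha])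
  exact cell_of_good hi hi (by simp) (isUnit_of_cyc hc (by simp [d2f, coeff_zero_eq_eval_zero]))
    ((good_cf h2).conj h1 h1' h3)

variable {V : Type u} [AddCommGroup V] [Module K V] [FiniteDimensional K V]
  {ω : V →ₗ[K] V →ₗ[K] K} {M : V →ₗ[K] V}

lemma has_one (H : Iso ω M) {ι : Type} [Fintype ι] [DecidableEq ι]
    (h : FrameMat ω M (1 : Matrix ι ι K)) {p : K[X]} (hp : p.Monic)
    (hd : Module.finrank K V = 2 * p.natDegree) : HasGood ω M p p := by
  refine ⟨ι, inferInstance, inferInstance, 1, h, good_one hp ?_⟩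
  obtain ⟨e, f, hF, -⟩ := h
  have := hF.finrank H
  omega

lemma alt_frame (h2 : (2 : K) = 0) : ∀ (N : ℕ) (V : Type u) [AddCommGroup V] [Module K V]
    [FiniteDimensional K V] (ω : V →ₗ[K] V →ₗ[K] K) (M : V →ₗ[K] V), Iso ω M →
    Module.finrank K V = 2 * N → (∀ x, ω (M x) x = 0) →
    ∃ (ι : Type) (_ : Fintype ι) (_ : DecidableEq ι), FrameMat ω M (1 : Matrix ι ι K) := by
  intro N
  induction N using Nat.strong_induction_on with
  | _ N ih =>
    intro V _ _ _ ω M H hr halt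
    have hneg : (-1 : K) = 1 := by linear_combination - h2
    rcases trichotomy H with ⟨x, hx⟩ | ⟨-, ⟨x, y, t, hxy, h1, h2', h3, h4, ht⟩ | ⟨ε, he, hM⟩⟩
    · exact absurd (halt x) hx
    · obtain ⟨W, ω₁, M₁, ψ, P⟩ := peel_two H hxy h1 h3 h4 h2' (by simpa using ht)
      have hrk := P.rank
      simp only [Fintype.card_fin] at hrk
      obtain ⟨ι, _, _, e', f', hF, ha⟩ := ih (N - 2) (by omega) W ω₁ M₁ P.iso (by omega) (by
        intro z; rw [P.formM]; exact halt _)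
      refine ⟨Fin 2 ⊕ ι, inferInstance, inferInstance, ?_⟩
      have hs : (!![0, t; -t, 0] * (1 : Matrix (Fin 2) (Fin 2) K))ᵀ = !![0, t; -t, 0] * 1 := by
        apply two_ext <;> simp <;> grind
      have := P.frame ι e' f' hF 1 ha 1 hs
      have pol : ∀ u v : V, ω (M u) v = - ω (M v) u := by
        intro u v
        have := halt (u + v)
        simp only [map_add, LinearMap.add_apply, halt, zero_add, add_zero] at this
        linear_combination this
      have h0 : ∀ (z : W) i, ψ i z = 0 := by
        intro z i
        have p0 := P.psi z 0
        have p1 := P.psi z 1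
        rw [pol, (P.perp z 0).2, Fin.sum_univ_two] at p0
        rw [pol, (P.perp z 1).2, Fin.sum_univ_two] at p1
        simp [ht] at p0 p1
        fin_cases i
        · exact p1
        · exact p0
      have hz : (Matrix.of fun j k => ψ j (e' k)) = 0 := by ext i j; simp [h0]
      rw [hz, Matrix.mul_zero, fromBlocks_one] at this
      exact this
    · have he1 : ε = 1 := by rcases he with rfl | rfl; rfl; exact hneg
      subst he1
      have := frameMat_smul H hr hM
      rw [one_smul] at this
      exact ⟨_, inferInstance, inferInstance, this⟩

lemma peel_three {x y z : V} {F : Matrix (Fin 3) (Fin 3) K} (H : Iso ω M) 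
    (hxy : ω x y = 0) (hxz : ω x z = 0) (hyz : ω y z = 0)
    (hF : ∀ i j, ω (M (![x, y, z] i)) (![x, y, z] j) = F i j) (hd : F.det ≠ 0) : ∃ W ω₁ M₁ ψ,
      Peeled ω M ![x, y, z] F W ω₁ M₁ ψ := by
  refine exists_peeled H _ ?_ _ hF (isUnit_iff_ne_zero.2 hd)
  intro i j; fin_cases i <;> fin_cases j <;> simp [H.alt, hxy, hxz, hyz, H.skew x y, H.skew x z, H.skew y z]

/-- A three-dimensional cell can be split off. -/
def Has3 (ω : V →ₗ[K] V →ₗ[K] K) (M : V →ₗ[K] V) : Prop :=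
  ∃ e F W ω₁ M₁ ψ, Peeled ω M (e : Fin 3 → V) F W ω₁ M₁ ψ ∧
    ∃ a : Matrix (Fin 3) (Fin 3) K, (F * a)ᵀ = F * a ∧ a * a * a + a + 1 = 0

set_option maxHeartbeats 2000000 in
lemma kind1 (hall : ∀ x : K, x = 0 ∨ x = 1) (h2 : (2 : K) = 0) (g h i : K) :
    ∃ a : Matrix (Fin 3) (Fin 3) K, (!![1, 0, 0; g, 1, 0; h, i, 1] * a)ᵀ = !![1, 0, 0; g, 1, 0; h, i, 1] * a
      ∧ a * a * a + a + 1 = 0 := by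
  rcases hall g with rfl | rfl <;> rcases hall h with rfl | rfl <;> rcases hall i with rfl | rfl
  · refine ⟨!![0, 0, 1; 0, 1, 1; 1, 1, 1], ?_, ?_⟩ <;> apply three_ext <;> simp [Matrix.mul_apply, Fin.sum_univ_three] <;> grind
  · refine ⟨!![1, 0, 1; 0, 0, 1; 1, 1, 1], ?_, ?_⟩ <;> apply three_ext <;> simp [Matrix.mul_apply, Fin.sum_univ_three] <;> grind
  · refine ⟨!![0, 0, 1; 0, 1, 1; 1, 1, 1], ?_, ?_⟩ <;> apply three_ext <;> simp [Matrix.mul_apply, Fin.sum_univ_three] <;> grind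
  · refine ⟨!![0, 1, 0; 1, 0, 1; 1, 0, 0], ?_, ?_⟩ <;> apply three_ext <;> simp [Matrix.mul_apply, Fin.sum_univ_three] <;> grind
  · refine ⟨!![0, 1, 0; 1, 1, 1; 0, 1, 1], ?_, ?_⟩ <;> apply three_ext <;> simp [Matrix.mul_apply, Fin.sum_univ_three] <;> grind
  · refine ⟨!![0, 0, 1; 0, 1, 1; 1, 1, 1], ?_, ?_⟩ <;> apply three_ext <;> simp [Matrix.mul_apply, Fin.sum_univ_three] <;> grind
  · refine ⟨!![1, 0, 1; 1, 0, 0; 0, 1, 1], ?_, ?_⟩ <;> apply three_ext <;> simp [Matrix.mul_apply, Fin.sum_univ_three] <;> grind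
  · refine ⟨!![0, 0, 1; 0, 1, 1; 1, 1, 1], ?_, ?_⟩ <;> apply three_ext <;> simp [Matrix.mul_apply, Fin.sum_univ_three] <;> grind

set_option maxHeartbeats 2000000 in
lemma kind2 (hall : ∀ x : K, x = 0 ∨ x = 1) (h2 : (2 : K) = 0) (g h : K) :
    ∃ a : Matrix (Fin 3) (Fin 3) K, (!![1, 0, 0; g, 0, 1; h, 1, 0] * a)ᵀ = !![1, 0, 0; g, 0, 1; h, 1, 0] * a
      ∧ a * a * a + a + 1 = 0 := by
  rcases hall g with rfl | rfl <;> rcases hall h with rfl | rfl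
  · refine ⟨!![0, 0, 1; 1, 0, 1; 0, 1, 0], ?_, ?_⟩ <;> apply three_ext <;> simp [Matrix.mul_apply, Fin.sum_univ_three] <;> grind
  · refine ⟨!![0, 0, 1; 1, 0, 1; 0, 1, 0], ?_, ?_⟩ <;> apply three_ext <;> simp [Matrix.mul_apply, Fin.sum_univ_three] <;> grind
  · refine ⟨!![0, 1, 0; 0, 0, 1; 1, 1, 0], ?_, ?_⟩ <;> apply three_ext <;> simp [Matrix.mul_apply, Fin.sum_univ_three] <;> grind
  · refine ⟨!![0, 1, 1; 1, 1, 0; 1, 1, 1], ?_, ?_⟩ <;> apply three_ext <;> simp [Matrix.mul_apply, Fin.sum_univ_three] <;> grind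

lemma has3_kind1 (hall : ∀ x : K, x = 0 ∨ x = 1) (h2 : (2 : K) = 0) (H : Iso ω M) {x y z : V}
    (hxy : ω x y = 0) (hxz : ω x z = 0) (hyz : ω y z = 0) (xx : ω (M x) x = 1) (xy : ω (M x) y = 0)
    (xz : ω (M x) z = 0) (yy : ω (M y) y = 1) (yz : ω (M y) z = 0) (zz : ω (M z) z = 1) :
    Has3 ω M := by
  obtain ⟨W, ω₁, M₁, ψ, P⟩ := peel_three (F := !![1, 0, 0; ω (M y) x, 1, 0; ω (M z) x, ω (M z) y, 1])
    H hxy hxz hyz (by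
      intro i j; fin_cases i <;> fin_cases j <;> simp [xx, xy, xz, yy, yz, zz])
    (by rw [Matrix.det_fin_three]; simp)
  exact ⟨_, _, W, ω₁, M₁, ψ, P, kind1 hall h2 _ _ _⟩

lemma has3_kind2 (hall : ∀ x : K, x = 0 ∨ x = 1) (h2 : (2 : K) = 0) (H : Iso ω M) {x y z : V}
    (hxy : ω x y = 0) (hxz : ω x z = 0) (hyz : ω y z = 0) (xx : ω (M x) x = 1) (xy : ω (M x) y = 0)
    (xz : ω (M x) z = 0) (yy : ω (M y) y = 0) (yz : ω (M y) z = 1) (zy : ω (M z) y = 1)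
    (zz : ω (M z) z = 0) : Has3 ω M := by
  obtain ⟨W, ω₁, M₁, ψ, P⟩ := peel_three (F := !![1, 0, 0; ω (M y) x, 0, 1; ω (M z) x, 1, 0])
    H hxy hxz hyz (by
      intro i j; fin_cases i <;> fin_cases j <;> simp [xx, xy, xz, yy, yz, zz, zy])
    (by rw [Matrix.det_fin_three]; simp)
  exact ⟨_, _, W, ω₁, M₁, ψ, P, kind2 hall h2 _ _⟩

lemma tri3 (hall : ∀ x : K, x = 0 ∨ x = 1) (h2 : (2 : K) = 0) (H : Iso ω M) {n : ℕ}
    (hr : Module.finrank K V = 2 * n) :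
    Has3 ω M ∨ (∃ (ι : Type) (_ : Fintype ι) (_ : DecidableEq ι), FrameMat ω M (1 : Matrix ι ι K)) ∨
    ∃ m, n = m + 2 ∧ ∃ b, FrameMat ω M (fromBlocks !![0, 1; 1, 1] b 0 (1 : Matrix (Fin m) (Fin m) K)) := by
  have hneg : (-1 : K) = 1 := by linear_combination - h2
  have hone : ∀ x : K, x ≠ 0 → x = 1 := fun x hx => (hall x).resolve_left hx
  have heps : ∀ ε : K, ε = 1 ∨ ε = -1 → ε = 1 := by
    rintro ε (rfl | rfl); rfl; exact hneg
  by_cases halt : ∀ x, ω (M x) x = 0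
  · exact Or.inr (Or.inl (alt_frame h2 n V ω M H hr halt))
  push Not at halt
  obtain ⟨x, hx⟩ := halt
  obtain ⟨W, ω₁, M₁, ψ, P⟩ := peel_one H hx
  have hrk := P.rank
  simp only [Fintype.card_unit] at hrk
  have hx1 := hone _ hx
  rcases trichotomy P.iso with ⟨y, hy⟩ | ⟨-, ⟨y, z, t, hyz, h1, h3, h4, h5, ht⟩ | ⟨ε, he, hM⟩⟩
  · rw [P.formM] at hy
    have hy1 := hone _ hy
    obtain ⟨W', ω', M', ψ', P'⟩ := peel_two H (x := x) (y := y) (P.perp y ()).1 hx1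
        (P.perp y ()).2 rfl hy1 (by simp)
    have hrk' := P'.rank
    simp only [Fintype.card_fin] at hrk'
    rcases trichotomy P'.iso with ⟨z, hz⟩ | ⟨-, ⟨u, v, t, huv, h1, h3, h4, h5, ht⟩ | ⟨ε, he, hM⟩⟩
    · rw [P'.formM] at hz
      left
      exact has3_kind1 hall h2 H (P.perp y ()).1 (P'.perp z 0).1 (P'.perp z 1).1 hx1 (P.perp y ()).2
        (P'.perp z 0).2 hy1 (P'.perp z 1).2 (hone _ hz)
    · left
      have := hone _ ht
      subst this
      simp only [P'.formM, P'.form, hneg] at *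
      exact has3_kind2 hall h2 H (P'.perp u 0).1 (P'.perp v 0).1 huv hx1 (P'.perp u 0).2
        (P'.perp v 0).2 h1 h4 h5 h3
    · right; right
      have := heps _ he
      subst this
      obtain ⟨m, rfl⟩ : ∃ m, n = m + 2 := ⟨n - 2, by omega⟩
      have hF := frameMat_smul P'.iso (m := m) (by omega) hM
      rw [one_smul] at hF
      exact ⟨m, rfl, P'.lift hF (by
        rcases hall (ω (M y) x) with hg | hg <;> rw [hg] <;> apply two_ext <;>
          simp [Matrix.mul_apply, Fin.sum_univ_two])⟩
  · left
    have := hone _ ht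
    subst this
    simp only [P.formM, P.form, hneg] at *
    exact has3_kind2 hall h2 H (P.perp y ()).1 (P.perp z ()).1 hyz hx1 (P.perp y ()).2
        (P.perp z ()).2 h1 h4 h5 h3
  · right; left
    have := heps _ he
    subst this
    obtain ⟨m, rfl⟩ : ∃ m, n = m + 1 := ⟨n - 1, by omega⟩
    have hF := one_scalar P (m := m) (by omega) hM 1
    rw [one_smul, one_smul, fromBlocks_one] at hF
    exact ⟨_, inferInstance, inferInstance, hF⟩

end RD2


section RD3
variable {K : Type u} [Field K]

lemma om_inv (h2 : (2 : K) = 0) : (1 - !![0, 1; 1, 1]) * (!![0, 1; 1, 1] : Matrix (Fin 2) (Fin 2) K) = 1 := by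
  apply two_ext <;> simp [Matrix.mul_apply, Fin.sum_univ_two] <;> grind

lemma good_om_block (h2 : (2 : K) = 0) {κ : Type} [Fintype κ] [DecidableEq κ] {p q : K[X]}
    (h : Good p q (fromBlocks !![0, 1; 1, 1] 0 0 (1 : Matrix κ κ K))) (b : Matrix (Fin 2) κ K) :
    Good p q (fromBlocks !![0, 1; 1, 1] b 0 1) := by
  have := clear_block (N := (0 : Matrix κ κ K)) (om_inv h2) (by simp) (by rwa [add_zero]) b
  rwa [add_zero] at this

lemma om1_block (h2 : (2 : K) = 0) (b : Matrix (Fin 2) (Fin 1) K) :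
    Good (d2f K) (d2f K) (fromBlocks !![0, 1; 1, 1] b 0 1) := by
  refine good_om_block h2 ?_ b
  convert (good_om1 h2).reindex (finSumFinEquiv (m := 2) (n := 1)) using 1
  ext i j
  rcases i with i | i <;> rcases j with j | j <;> fin_cases i <;> fin_cases j <;> rfl

lemma om2_block (h2 : (2 : K) = 0) (b : Matrix (Fin 2) (Fin 2) K) :
    Good (d2g4 K) (d2g4 K) (fromBlocks !![0, 1; 1, 1] b 0 1) := by
  refine good_om_block h2 ?_ b
  convert (good_om2 h2).reindex (finSumFinEquiv (m := 2) (n := 2)) using 1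
  ext i j
  rcases i with i | i <;> rcases j with j | j <;> fin_cases i <;> fin_cases j <;> rfl

lemma om3_block (h2 : (2 : K) = 0) (b : Matrix (Fin 2) (Fin 3) K) :
    Good (d2g5 K) (d2g5 K) (fromBlocks !![0, 1; 1, 1] b 0 1) := by
  refine good_om_block h2 ?_ b
  convert (good_om3 h2).reindex (finSumFinEquiv (m := 2) (n := 3)) using 1
  ext i j
  rcases i with i | i <;> rcases j with j | j <;> fin_cases i <;> fin_cases j <;> rfl

lemma cf1_block (hall : ∀ x : K, x = 0 ∨ x = 1) (h2 : (2 : K) = 0)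
    {a : Matrix (Fin 3) (Fin 3) K} (ha : a * a * a + a + 1 = 0) (b : Matrix (Fin 3) (Fin 1) K) :
    Good (d2g4 K) (d2g4 K) (fromBlocks a b 0 1) := by
  have := good_f_block hall h2 ha (N := (0 : Matrix (Fin 1) (Fin 1) K)) (by simp) (p := d2g4 K)
    (q := d2g4 K) ?_ b
  · rwa [add_zero] at this
  rw [add_zero]
  convert (good_cf1 h2).reindex (finSumFinEquiv (m := 3) (n := 1)) using 1
  ext i j
  rcases i with i | i <;> rcases j with j | j <;> fin_cases i <;> fin_cases j <;> rfl

lemma cf2_block (hall : ∀ x : K, x = 0 ∨ x = 1) (h2 : (2 : K) = 0)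
    {a : Matrix (Fin 3) (Fin 3) K} (ha : a * a * a + a + 1 = 0) (b : Matrix (Fin 3) (Fin 2) K)
    (x : K) : Good (d2g5 K) (d2g5 K) (fromBlocks a b 0 !![1, x; 0, 1]) := by
  have hx : !![1, x; 0, 1] = 1 + !![0, x; 0, 0] := by
    apply two_ext <;> simp
  rw [hx]
  refine good_f_block hall h2 ha ?_ ?_ b
  · apply two_ext <;> simp [Matrix.mul_apply]
  rw [← hx]
  rcases hall x with rfl | rfl
  · convert (good_cf2 h2).reindex (finSumFinEquiv (m := 3) (n := 2)) using 1
    ext i j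
    rcases i with i | i <;> rcases j with j | j <;> fin_cases i <;> fin_cases j <;> rfl
  · convert (good_cfJ h2).reindex (finSumFinEquiv (m := 3) (n := 2)) using 1
    ext i j
    rcases i with i | i <;> rcases j with j | j <;> fin_cases i <;> fin_cases j <;> rfl

lemma cell_om (hall : ∀ x : K, x = 0 ∨ x = 1) (h2 : (2 : K) = 0) (x y : K) :
    Cell (d2f K) (d2f K) !![0, 1, x; 1, 1, y; 0, 0, 1] := by
  have hi := d2f_irred hall h2
  refine cell_of_good hi hi (by simp) ?_ ?_
  · rw [isUnit_iff_ne_zero, Matrix.det_fin_three]; simp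
  convert (om1_block h2 (Matrix.of fun i _ => ![x, y] i)).reindex eqC using 1
  ext i j
  fin_cases i <;> fin_cases j <;> rfl

variable {V : Type u} [AddCommGroup V] [Module K V] [FiniteDimensional K V]
  {ω : V →ₗ[K] V →ₗ[K] K} {M : V →ₗ[K] V}

lemma regroupD (hall : ∀ x : K, x = 0 ∨ x = 1) (h2 : (2 : K) = 0) {m : ℕ} {p : K[X]}
    (hp : p.Monic) (hd : p.natDegree = m) {b : Matrix (Fin 2) (Fin (m + 1)) K}
    (hf : FrameMat ω M (fromBlocks !![0, 1; 1, 1] b 0 1)) :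
    HasGood ω M (d2f K * p) (d2f K * p) := by
  have h1 := hf.reindex (eqA m)
  refine ⟨_, inferInstance, inferInstance, _, h1, ?_⟩
  have h3 := (cell_om hall h2 (b 0 0) (b 1 0)).link
    (good_one (ι := Fin m) hp (by simpa using hd)) (Matrix.of fun i j =>
    (![b 0 j.succ, b 1 j.succ, 0] : Fin 3 → K) i)
  convert h3 using 1
  ext i j
  rcases i with i | i <;> rcases j with j | j
  · fin_cases i <;> fin_cases j <;> simp [eqA]
  · fin_cases i <;> simp [eqA, Matrix.one_apply, (Fin.succ_ne_zero j).symm]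
  · fin_cases j <;> simp [eqA, Matrix.one_apply, Fin.succ_ne_zero]
  · simp [eqA, Matrix.one_apply]

lemma step_f (hall : ∀ x : K, x = 0 ∨ x = 1) (h2 : (2 : K) = 0) {p : K[X]} (hp : p.Monic)
    (ih : ∀ (V : Type u) [AddCommGroup V] [Module K V]
      [FiniteDimensional K V] (ω : V →ₗ[K] V →ₗ[K] K) (M : V →ₗ[K] V), Iso ω M →
      Module.finrank K V = 2 * p.natDegree → HasGood ω M p p)
    (H : Iso ω M) (hr : Module.finrank K V = 2 * (3 + p.natDegree)) :
    HasGood ω M (d2f K * p) (d2f K * p) := by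
  rcases tri3 hall h2 H hr with ⟨e, F, W, ω₁, M₁, ψ, P, a, hs, ha⟩ | ⟨ι, _, _, h⟩ | ⟨m, hm, b, hb⟩
  · have hrk := P.rank
    simp only [Fintype.card_fin] at hrk
    exact P.link (ih W ω₁ M₁ P.iso (by omega)) hs (cell_f hall h2 ha)
  · exact has_one H h (d2f_monic.mul hp) (by rw [d2f_monic.natDegree_mul hp, d2f_deg, hr])
  · obtain rfl : m = p.natDegree + 1 := by omega
    exact regroupD hall h2 hp rfl hb

lemma steps_f (hall : ∀ x : K, x = 0 ∨ x = 1) (h2 : (2 : K) = 0) {p : K[X]} (hp : p.Monic)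
    (ih : ∀ (V : Type u) [AddCommGroup V] [Module K V]
      [FiniteDimensional K V] (ω : V →ₗ[K] V →ₗ[K] K) (M : V →ₗ[K] V), Iso ω M →
      Module.finrank K V = 2 * p.natDegree → HasGood ω M p p) (t : ℕ) :
    ∀ (V : Type u) [AddCommGroup V] [Module K V]
      [FiniteDimensional K V] (ω : V →ₗ[K] V →ₗ[K] K) (M : V →ₗ[K] V), Iso ω M →
      Module.finrank K V = 2 * (3 * t + p.natDegree) → HasGood ω M (d2f K ^ t * p) (d2f K ^ t * p) := by
  induction t with
  | zero => simpa using ih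
  | succ t iht =>
    intro V _ _ _ ω M H hr
    have hd : (d2f K ^ t * p).natDegree = 3 * t + p.natDegree := by
      rw [(d2f_monic.pow _).natDegree_mul hp, d2f_monic.natDegree_pow, d2f_deg]; ring
    rw [pow_succ', mul_assoc]
    refine step_f hall h2 ((d2f_monic.pow _).mul hp) ?_ H ?_
    · rw [hd]; exact iht
    · rw [hd, hr]; ring

lemma rank_one_frame (h2 : (2 : K) = 0) (H : Iso ω M) (hr : Module.finrank K V = 2) :
    FrameMat ω M (1 : Matrix (Fin 1) (Fin 1) K) := by
  rcases rank_one H hr (c := 1) with h | ⟨ε, he, hM⟩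
  · rwa [one_smul] at h
  · have : ε = 1 := by
      rcases he with rfl | rfl
      · rfl
      · linear_combination - h2
    subst this
    have := frameMat_smul H (m := 1) (by omega) hM
    rwa [one_smul] at this

lemma rank_two_frame (hall : ∀ x : K, x = 0 ∨ x = 1) (h2 : (2 : K) = 0) (H : Iso ω M)
    (hr : Module.finrank K V = 4) :
    ∃ x : K, FrameMat ω M !![1, x; 0, 1] := by
  have hone : ∀ x : K, x ≠ 0 → x = 1 := fun x hx => (hall x).resolve_left hx
  have heps : ∀ ε : K, ε = 1 ∨ ε = -1 → ε = 1 := by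
    rintro ε (rfl | rfl)
    · rfl
    · linear_combination - h2
  rcases quad H with ⟨e, F, W, ω₁, M₁, ψ, hF, P⟩ | ⟨ε, he, hM⟩ | ⟨e, F, W, ω₁, M₁, ψ, P, ε, he, hM⟩
  · have hrk := P.rank
    simp only [Fintype.card_fin] at hrk
    have : Subsingleton W := Module.finrank_zero_iff.1 (by omega : Module.finrank K W = 0)
    have h0 := frameMat_smul P.iso (m := 0) (by omega) (ε := 1) (fun x => Subsingleton.elim _ _)
    have : ∃ x : K, (F * !![1, x; 0, 1])ᵀ = F * !![1, x; 0, 1] := by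
      rcases hF with ⟨t, ht, rfl⟩ | ⟨c, g, d, hc, hd, rfl⟩
      · refine ⟨0, ?_⟩
        apply two_ext <;> simp [Matrix.mul_apply, Fin.sum_univ_two] <;> grind
      · refine ⟨g, ?_⟩
        have := hone _ hc
        subst this
        apply two_ext <;> simp [Matrix.mul_apply, Fin.sum_univ_two]
    obtain ⟨x, hx⟩ := this
    obtain ⟨b, hb⟩ := P.lift h0 hx
    refine ⟨x, ?_⟩
    have := hb.reindex (Equiv.sumEmpty (Fin 2) (Fin 0)).symm
    convert this using 1
    ext i j; simp
  · have := heps _ he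
    subst this
    have := frameMat_smul H (m := 2) (by omega) hM
    refine ⟨0, ?_⟩
    convert this using 1
    apply two_ext <;> simp
  · have := heps _ he
    subst this
    have := one_scalar P (m := 1) (by omega) hM 1
    rw [one_smul, one_smul, fromBlocks_one] at this
    have := this.reindex (κ := Fin 2) ⟨![Sum.inl (), Sum.inr 0], Sum.elim (fun _ => 0) (fun _ => 1),
      by intro i; fin_cases i <;> rfl, by
        rintro (i | i)
        · rfl
        · fin_cases i; rfl⟩
    refine ⟨0, ?_⟩
    convert this using 1
    rw [Matrix.submatrix_one_equiv]
    apply two_ext <;> simp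

lemma base4 (hall : ∀ x : K, x = 0 ∨ x = 1) (h2 : (2 : K) = 0) (H : Iso ω M)
    (hr : Module.finrank K V = 2 * (d2g4 K).natDegree) : HasGood ω M (d2g4 K) (d2g4 K) := by
  rcases tri3 hall h2 H hr with ⟨e, F, W, ω₁, M₁, ψ, P, a, hs, ha⟩ | ⟨ι, _, _, h⟩ | ⟨m, hm, b, hb⟩
  · have hrk := P.rank
    simp only [Fintype.card_fin] at hrk
    rw [d2g4_deg] at hr
    obtain ⟨b, hb⟩ := P.lift (rank_one_frame h2 P.iso (by omega)) hs
    exact ⟨_, inferInstance, inferInstance, _, hb, cf1_block hall h2 ha b⟩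
  · exact has_one H h d2g4_monic hr
  · rw [d2g4_deg] at hm
    obtain rfl : m = 2 := by omega
    exact ⟨_, inferInstance, inferInstance, _, hb, om2_block h2 b⟩

lemma base5 (hall : ∀ x : K, x = 0 ∨ x = 1) (h2 : (2 : K) = 0) (H : Iso ω M)
    (hr : Module.finrank K V = 2 * (d2g5 K).natDegree) : HasGood ω M (d2g5 K) (d2g5 K) := by
  rcases tri3 hall h2 H hr with ⟨e, F, W, ω₁, M₁, ψ, P, a, hs, ha⟩ | ⟨ι, _, _, h⟩ | ⟨m, hm, b, hb⟩
  · have hrk := P.rank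
    simp only [Fintype.card_fin] at hrk
    rw [d2g5_deg] at hr
    obtain ⟨x, hx⟩ := rank_two_frame hall h2 P.iso (by omega)
    obtain ⟨b, hb⟩ := P.lift hx hs
    exact ⟨_, inferInstance, inferInstance, _, hb, cf2_block hall h2 ha b x⟩
  · exact has_one H h d2g5_monic hr
  · rw [d2g5_deg] at hm
    obtain rfl : m = 3 := by omega
    exact ⟨_, inferInstance, inferInstance, _, hb, om3_block h2 b⟩

lemma base0 (H : Iso ω M)
    (hr : Module.finrank K V = 2 * (1 : K[X]).natDegree) : HasGood ω M (1 : K[X]) 1 := by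
  have hr' : Module.finrank K V = 2 * 0 := by simpa using hr
  have : Subsingleton V := Module.finrank_zero_iff.1 (by omega)
  have h0 := frameMat_smul H hr' (ε := 1) (fun x => Subsingleton.elim _ _)
  rw [one_smul] at h0
  exact has_one H h0 monic_one hr

theorem concl_RD_aux (hall : ∀ x : K, x = 0 ∨ x = 1) (h2 : (2 : K) = 0) {p : K[X]} (hp : p.Monic)
    (p0 : p.coeff 0 ≠ 0) (c1 : IsCoprime (d2f K) (recipPoly p)) (c2 : IsCoprime p (d2f' K))
    (c3 : IsCoprime p (recipPoly p))
    (ih : ∀ (V : Type u) [AddCommGroup V] [Module K V]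
      [FiniteDimensional K V] (ω : V →ₗ[K] V →ₗ[K] K) (M : V →ₗ[K] V), Iso ω M →
      Module.finrank K V = 2 * p.natDegree → HasGood ω M p p) (t : ℕ) :
    Concl (3 * t + p.natDegree) K := by
  have f0 : (d2f K).coeff 0 ≠ 0 := by simp [d2f, coeff_zero_eq_eval_zero]
  refine assemble (q := d2f K ^ t * p) ((d2f_monic.pow _).mul hp) ?_
      (coeff_zero_mul_ne (coeff_zero_pow_ne f0 _) p0) ?_ ?_
  · rw [(d2f_monic.pow _).natDegree_mul hp, d2f_monic.natDegree_pow, d2f_deg]; ring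
  · rw [recip_mul, recip_pow, recip_d2f]
    exact IsCoprime.mul_left (IsCoprime.mul_right (cop_ff h2).pow c1.pow_left)
      (IsCoprime.mul_right c2.pow_right c3)
  · intro V _ _ _ ω M H hr _
    exact Or.inl (steps_f hall h2 hp ih t V ω M H hr)

theorem concl_RD (hall : ∀ x : K, x = 0 ∨ x = 1) (h2 : (2 : K) = 0) {n : ℕ} (hn : 3 ≤ n) :
    Concl n K := by
  have hn3 : n % 3 = 0 ∨ n % 3 = 1 ∨ n % 3 = 2 := by omega
  rcases hn3 with h | h | h
  · have := concl_RD_aux hall h2 (p := 1) monic_one (by simp) (by rw [recip_one]; exact isCoprime_one_right)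
      isCoprime_one_left isCoprime_one_left (fun V _ _ _ ω M H hr => base0 H hr) (n / 3)
    rw [natDegree_one] at this
    rwa [show 3 * (n / 3) + 0 = n by omega] at this
  · have := concl_RD_aux hall h2 (p := d2g4 K) d2g4_monic (by simp [d2g4, coeff_zero_eq_eval_zero])
      (by rw [recip_d2g4]; exact cop_f4 h2) (cop_4f h2) (by rw [recip_d2g4]; exact cop_44 h2)
      (fun V _ _ _ ω M H hr => base4 hall h2 H hr) ((n - 4) / 3)
    rw [d2g4_deg] at this
    rwa [show 3 * ((n - 4) / 3) + 4 = n by omega] at this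
  · have := concl_RD_aux hall h2 (p := d2g5 K) d2g5_monic (by simp [d2g5, coeff_zero_eq_eval_zero])
      (by rw [recip_d2g5]; exact cop_f5 h2) (cop_5f h2) (by rw [recip_d2g5]; exact cop_55 h2)
      (fun V _ _ _ ω M H hr => base5 hall h2 H hr) ((n - 5) / 3)
    rw [d2g5_deg] at this
    rwa [show 3 * ((n - 5) / 3) + 5 = n by omega] at this

theorem concl_all {n : ℕ} (hn : 2 ≤ n) (hK : Nat.card K = 2 → 3 ≤ n) : Concl n K := by
  by_cases h2 : (2 : K) = 0
  · by_cases hα : ∃ α : K, α ≠ 0 ∧ α ≠ 1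
    · obtain ⟨α, h0, h1⟩ := hα
      exact concl_char_two h2 h0 h1
    · have hall : ∀ x : K, x = 0 ∨ x = 1 := by
        intro x
        by_contra hx
        push Not at hx
        exact hα ⟨x, hx⟩
      refine concl_RD hall h2 (hK ?_)
      rw [Nat.card_eq_two_iff]
      refine ⟨0, 1, zero_ne_one, ?_⟩
      ext x; simpa using hall x
  · by_cases hα : ∃ α : K, α ≠ 0 ∧ α ^ 4 ≠ 1
    · obtain ⟨α, h0, h4⟩ := hα
      exact concl_generic h2 h0 h4
    by_cases hβ : ∃ α : K, α * α = -1
    · obtain ⟨α, h⟩ := hβ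
      exact concl_RA h2 h
    push Not at hα hβ
    have hx : ∀ x : K, x = 0 ∨ x = 1 ∨ x = -1 := by
      intro x
      by_cases h0 : x = 0
      · exact Or.inl h0
      right
      have h4 := hα x h0
      have : (x * x + 1) * ((x - 1) * (x + 1)) = 0 := by linear_combination h4
      rcases mul_eq_zero.1 this with h | h
      · exact absurd (eq_neg_of_add_eq_zero_left h) (hβ x)
      · rcases mul_eq_zero.1 h with h | h
        · exact Or.inl (sub_eq_zero.1 h)
        · exact Or.inr (eq_neg_of_add_eq_zero_left h)
    refine concl_RC ⟨?_, hx⟩ hn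
    rcases hx 2 with h | h | h
    · exact absurd h h2
    · exact absurd (by linear_combination h : (1 : K) = 0) one_ne_zero
    · linear_combination h

end RD3

theorem symplectic_class_covering_number_two {K : Type*} [Field K] {n : ℕ}
    (hn : 2 ≤ n) (hK : Nat.card K = 2 → 3 ≤ n) :
    ∃ P : Matrix (Fin n ⊕ Fin n) (Fin n ⊕ Fin n) K,
      IsSymplectic P ∧ IsCyclicMat P ∧ IsStrictlyHyperbolic P ∧
      ∀ M : Matrix (Fin n ⊕ Fin n) (Fin n ⊕ Fin n) K,
        IsSymplectic M → M ≠ -(1 : Matrix (Fin n ⊕ Fin n) (Fin n ⊕ Fin n) K) →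
        ∃ S₁ S₂ : Matrix (Fin n ⊕ Fin n) (Fin n ⊕ Fin n) K,
          IsSymplectic S₁ ∧ IsSymplectic S₂ ∧
          M = (S₁ * P * S₁⁻¹) * (S₂ * P * S₂⁻¹) :=
  concl_all hn hK
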